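/- For every natural number k ≥ 1 and every odd natural number n satisfying n > exp(exp(√(2.51·(2^(k+1) − 1)/e^γ)))/2^k, Robin's inequality holds for 2^k·n: σ(2^k·n) < e^γ · 2^k·n · log(log(2^k·n)). -/

import Mathlib

open Real

/-- Robin's inequality for `n`: `σ(n) < e^γ · n · log(log n)`. -/
def RobinInequality (n : ℕ) : Prop :=
  (ArithmeticFunction.sigma 1 n : ℝ) <
    Real.exp Real.eulerMascheroniConstant * n * Real.log (Real.log n)

open Filter Topology in
/-- An entire function that is not locally zero at `ρ` factors through its zero at `ρ`. -/
theorem exists_entire_factor_at {f : ℂ → ℂ} (hf : Differentiable ℂ f) {ρ : ℂ}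
    (h : analyticOrderAt f ρ ≠ ⊤) :
    ∃ q : ℂ → ℂ, Differentiable ℂ q ∧ q ρ ≠ 0 ∧
      ∀ z, f z = (z - ρ) ^ analyticOrderNatAt f ρ * q z := by
  obtain ⟨g, hg, hg0, hfg⟩ := (hf.analyticAt ρ).analyticOrderAt_ne_top.1 h
  set n := analyticOrderNatAt f ρ
  classical
  let q : ℂ → ℂ := fun z => if z = ρ then g ρ else f z / (z - ρ) ^ n
  have hqg : q =ᶠ[𝓝 ρ] g := by
    filter_upwards [hfg] with z hz
    by_cases hzρ : z = ρ
    · simp [q, hzρ]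
    · have : (z - ρ) ^ n ≠ 0 := pow_ne_zero _ (sub_ne_zero.2 hzρ)
      simp [q, hzρ, hz, this]
  refine ⟨q, fun z => ?_, ?_, fun z => ?_⟩
  · by_cases hzρ : z = ρ
    · subst hzρ
      exact (hqg.differentiableAt_iff).2 hg.differentiableAt
    · have h1 : q =ᶠ[𝓝 z] fun w => f w / (w - ρ) ^ n := by
        filter_upwards [isOpen_ne.mem_nhds hzρ] with w hw
        have hw' : w ≠ ρ := hw
        simp [q, hw']
      refine h1.differentiableAt_iff.2 ?_
      have : (z - ρ) ^ n ≠ 0 := pow_ne_zero _ (sub_ne_zero.2 hzρ)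
      exact (hf z).div (by fun_prop) this
  · simpa [q] using hg0
  · by_cases hzρ : z = ρ
    · subst hzρ
      have := hfg.self_of_nhds
      simpa [q] using this
    · have : (z - ρ) ^ n ≠ 0 := pow_ne_zero _ (sub_ne_zero.2 hzρ)
      simp only [q, hzρ, if_false]
      field_simp

/-- Splitting off finitely many zeros of an entire function. -/
theorem exists_entire_factor {f : ℂ → ℂ} (hf : Differentiable ℂ f)
    (h : ∀ ρ, analyticOrderAt f ρ ≠ ⊤)
    (T : Finset ℂ) :
    ∃ q : ℂ → ℂ, Differentiable ℂ q ∧ (∀ ρ ∈ T, q ρ ≠ 0) ∧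
      ∀ z, f z = (∏ ρ ∈ T, (z - ρ) ^ analyticOrderNatAt f ρ) * q z := by
  classical
  induction T using Finset.induction_on with
  | empty => exact ⟨f, hf, by simp, by simp⟩
  | insert ρ T hρ ih =>
    obtain ⟨q, hq, hq0, hfq⟩ := ih
    set P : ℂ → ℂ := fun z => ∏ ρ ∈ T, (z - ρ) ^ analyticOrderNatAt f ρ
    have hP : Differentiable ℂ P := by fun_prop
    have hPρ : P ρ ≠ 0 := by
      refine Finset.prod_ne_zero_iff.2 fun a ha => pow_ne_zero _ (sub_ne_zero.2 ?_)
      rintro rfl; exact hρ ha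
    have hfe : f = P * q := funext hfq
    have hord : analyticOrderAt f ρ = analyticOrderAt q ρ := by
      conv_lhs => rw [hfe]
      rw [analyticOrderAt_mul (hP.analyticAt ρ) (hq.analyticAt ρ),
        analyticOrderAt_eq_zero.2 (Or.inr hPρ), zero_add]
    obtain ⟨r, hr, hr0, hqr⟩ := exists_entire_factor_at hq (ρ := ρ) (hord ▸ h ρ)
    have hn : analyticOrderNatAt f ρ = analyticOrderNatAt q ρ := by
      simp [analyticOrderNatAt, hord]
    refine ⟨r, hr, fun a ha => ?_, fun z => ?_⟩
    · rcases Finset.mem_insert.1 ha with rfl | ha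
      · exact hr0
      · intro hra
        exact hq0 a ha (by rw [hqr a, hra, mul_zero])
    · rw [Finset.prod_insert hρ, hn, hfq z, hqr z]
      ring

open Metric in
/-- The logarithmic derivative of a zero-free function on a disc varies slowly
near the center if the function is not too large. -/
theorem norm_logDeriv_sub_le {q : ℂ → ℂ} {R L : ℝ} (hR : 0 < R) (hL : 0 < L)
    (hq : DifferentiableOn ℂ q (ball 0 R)) (hq0 : ∀ z ∈ ball (0 : ℂ) R, q z ≠ 0)
    (hb : ∀ z ∈ ball (0 : ℂ) R, ‖q z‖ ≤ ‖q 0‖ * Real.exp L)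
    {s : ℂ} (hs : s ∈ ball (0 : ℂ) (R / 4)) :
    ‖logDeriv q s - logDeriv q 0‖ ≤ 64 * L / R ^ 2 * ‖s‖ := by
  have h0R : (0 : ℂ) ∈ ball (0 : ℂ) R := mem_ball_self hR
  have hdl : DifferentiableOn ℂ (logDeriv q) (ball 0 R) := by
    intro z hz
    exact ((hq.deriv isOpen_ball).div hq hq0) z hz
  obtain ⟨h, hh0, hh⟩ := hdl.isExactOn_ball.with_val_at 0 0
  have hhd : DifferentiableOn ℂ h (ball 0 R) := fun z hz =>
    (hh z hz).differentiableAt.differentiableWithinAt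
  have hexp : ∀ z ∈ ball (0 : ℂ) R, q z = q 0 * Complex.exp (h z) := by
    intro z hz
    have hconst : ∀ z ∈ ball (0 : ℂ) R, HasDerivAt (fun z => q z * Complex.exp (- h z)) 0 z := by
      intro z hz
      have h1 := ((hq z hz).differentiableAt (isOpen_ball.mem_nhds hz)).hasDerivAt
      have h2 := h1.mul (hh z hz).neg.cexp
      refine h2.congr_deriv ?_
      have := hq0 z hz
      simp only [logDeriv_apply]
      field_simp
      ring
    have h3 : q z * Complex.exp (- h z) = q 0 * Complex.exp (- h 0) := by
      refine (convex_ball (0 : ℂ) R).is_const_of_fderivWithin_eq_zero (𝕜 := ℂ)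
        (f := fun z => q z * Complex.exp (- h z))
        (fun w hw => (hconst w hw).differentiableAt.differentiableWithinAt) ?_ hz h0R
      intro w hw
      rw [fderivWithin_of_isOpen isOpen_ball hw]
      ext
      simp [(hconst w hw).deriv]
    rw [hh0, neg_zero, Complex.exp_zero, mul_one] at h3
    rw [← h3, mul_assoc, ← Complex.exp_add]; simp
  have hre : Set.MapsTo h (ball 0 R) {z | z.re ≤ L} := by
    intro z hz
    have h1 := hb z hz
    rw [hexp z hz, norm_mul, Complex.norm_exp] at h1
    exact Real.exp_le_exp.1 (le_of_mul_le_mul_left h1 (norm_pos_iff.2 (hq0 0 h0R)))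
  have hhb : ∀ z ∈ closedBall (0 : ℂ) (R / 2), ‖h z‖ ≤ 2 * L := by
    intro z hz
    have hz' : ‖z‖ ≤ R / 2 := by simpa using hz
    refine (Complex.borelCaratheodory_zero hL hhd hre hR (by simp; linarith) hh0).trans ?_
    rw [div_le_iff₀ (by linarith)]
    nlinarith
  have hd : ∀ z ∈ ball (0 : ℂ) (R / 4), ‖logDeriv q z‖ ≤ 8 * L / R := by
    intro z hz
    have hz' : ‖z‖ < R / 4 := by simpa using hz
    have hsub : closedBall z (R / 4) ⊆ closedBall (0 : ℂ) (R / 2) :=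
      closedBall_subset_closedBall' (by simp; linarith)
    have hsub2 : closedBall (0 : ℂ) (R / 2) ⊆ ball 0 R := closedBall_subset_ball (by linarith)
    rw [← (hh z (ball_subset_ball (by linarith) hz)).deriv]
    refine (Complex.norm_deriv_le_of_forall_mem_sphere_norm_le (R := R / 4) (C := 2 * L)
      (by positivity) ?_ ?_).trans (le_of_eq (by field_simp; ring))
    · exact (hhd.mono (hsub.trans hsub2)).diffContOnCl_ball subset_rfl
    · exact fun w hw => hhb w (hsub (sphere_subset_closedBall hw))
  have h0 : (0 : ℂ) ∈ ball (0 : ℂ) (R / 4) := mem_ball_self (by positivity)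
  have := Complex.dist_le_div_mul_dist_of_mapsTo_ball (f := logDeriv q) (c := 0) (R₁ := R / 4)
    (R₂ := 16 * L / R) (hdl.mono (ball_subset_ball (by linarith))) ?_ hs
  · rw [dist_eq_norm, dist_zero_right] at this
    refine this.trans (le_of_eq ?_)
    field_simp; ring
  · intro z hz
    rw [mem_closedBall, dist_eq_norm]
    calc _ ≤ ‖logDeriv q z‖ + ‖logDeriv q 0‖ := norm_sub_le _ _
      _ ≤ 8 * L / R + 8 * L / R := add_le_add (hd z hz) (hd 0 h0)
      _ = _ := by ring

open Filter Topology in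
/-- An entire function with nonzero value somewhere is nowhere locally zero. -/
theorem analyticOrderAt_ne_top_of_entire {f : ℂ → ℂ} (hf : Differentiable ℂ f) (h0 : f 0 ≠ 0)
    (ρ : ℂ) :
    analyticOrderAt f ρ ≠ ⊤ := by
  intro h
  have h1 := analyticOrderAt_eq_top.1 h
  have hA : AnalyticOnNhd ℂ f Set.univ := fun z _ => hf.analyticAt z
  exact h0 (hA.eqOn_zero_of_preconnected_of_eventuallyEq_zero isPreconnected_univ
    (Set.mem_univ ρ) h1 (Set.mem_univ 0))

open Filter Topology in
/-- An entire function has finitely many zeros in a disc. -/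
theorem finite_zeros_of_entire {f : ℂ → ℂ} (hf : Differentiable ℂ f) (h0 : f 0 ≠ 0) (R : ℝ) :
    {z : ℂ | f z = 0 ∧ ‖z‖ ≤ R}.Finite := by
  by_contra hinf
  obtain ⟨x, _, hx⟩ := Set.Infinite.exists_accPt_of_subset_isCompact hinf
    (isCompact_closedBall (0 : ℂ) R) (fun z hz => by simpa using hz.2)
  have hA : AnalyticOnNhd ℂ f Set.univ := fun z _ => hf.analyticAt z
  refine h0 (hA.eqOn_zero_of_preconnected_of_frequently_eq_zero isPreconnected_univ
    (Set.mem_univ x) ?_ (Set.mem_univ 0))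
  exact (accPt_iff_frequently_nhdsNE.1 hx).mono fun z hz => hz.1

/-- The zeros of an entire function in the closed disc of radius `R`. -/
noncomputable def zerosInDisc (f : ℂ → ℂ) (R : ℝ) : Finset ℂ :=
  open Classical in
  if h : {z : ℂ | f z = 0 ∧ ‖z‖ ≤ R}.Finite then h.toFinset else ∅

theorem mem_zerosInDisc {f : ℂ → ℂ} (hf : Differentiable ℂ f) (h0 : f 0 ≠ 0) {R : ℝ} {z : ℂ} :
    z ∈ zerosInDisc f R ↔ f z = 0 ∧ ‖z‖ ≤ R := by
  simp [zerosInDisc, finite_zeros_of_entire hf h0 R]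

open Metric in
theorem norm_logDeriv_sub_sum_le {f : ℂ → ℂ} (hf : Differentiable ℂ f) (h0 : f 0 ≠ 0) {R L : ℝ}
    (hR : 0 < R) (hL : 0 < L) (hb : ∀ z : ℂ, ‖z‖ = 3 * R → ‖f z‖ ≤ ‖f 0‖ * Real.exp L) {s : ℂ}
    (hs : ‖s‖ < R / 4) (hfs : f s ≠ 0) :
    ‖(logDeriv f s - logDeriv f 0) -
      ∑ ρ ∈ zerosInDisc f R, (analyticOrderNatAt f ρ : ℂ) * (1 / (s - ρ) + 1 / ρ)‖
      ≤ 64 * L / R ^ 2 * ‖s‖ := by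
  set T := zerosInDisc f R with hT
  obtain ⟨q, hq, hq0, hfq⟩ := exists_entire_factor hf (analyticOrderAt_ne_top_of_entire hf h0) T
  set m := analyticOrderNatAt f
  have hq00 : q 0 ≠ 0 := fun h => h0 (by rw [hfq, h, mul_zero])
  have hqs : q s ≠ 0 := fun h => hfs (by rw [hfq, h, mul_zero])
  have hTne : ∀ w, f w ≠ 0 → ∀ ρ ∈ T, w - ρ ≠ 0 := by
    intro w hw ρ hρ h
    rw [sub_eq_zero] at h
    exact hw (h ▸ ((mem_zerosInDisc hf h0).1 hρ).1)
  have hlog : ∀ w, f w ≠ 0 → logDeriv f w = ∑ ρ ∈ T, (m ρ : ℂ) * (1 / (w - ρ)) + logDeriv q w := by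
    intro w hw
    have hqw : q w ≠ 0 := fun h => hw (by rw [hfq, h, mul_zero])
    have hne := hTne w hw
    have h1 : f = fun z => (∏ ρ ∈ T, (fun z => (z - ρ) ^ m ρ) z) * q z := funext hfq
    conv_lhs => rw [h1]
    rw [logDeriv_mul (f := fun z => (∏ ρ ∈ T, (fun z => (z - ρ) ^ m ρ) z)) _
      (Finset.prod_ne_zero_iff.2 fun ρ hρ => pow_ne_zero _ (hne ρ hρ)) hqw (by fun_prop) (hq w),
      logDeriv_prod (s := T) (f := fun ρ z => (z - ρ) ^ m ρ) (fun ρ hρ => pow_ne_zero _ (hne ρ hρ))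
          (fun _ _ => by fun_prop)]
    congr 1
    refine Finset.sum_congr rfl fun ρ _ => ?_
    rw [logDeriv_fun_pow (by fun_prop)]
    simp [logDeriv_apply]
  have hnz : ∀ z ∈ ball (0 : ℂ) R, q z ≠ 0 := by
    intro z hz h
    have hz' : z ∈ T := (mem_zerosInDisc hf h0).2
      ⟨by rw [hfq, h, mul_zero], by simpa using (mem_ball_zero_iff.1 hz).le⟩
    exact hq0 z hz' h
  have hqb : ∀ z : ℂ, ‖z‖ = 3 * R → ‖q z‖ ≤ ‖q 0‖ * Real.exp L := by
    intro z hz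
    have h1 := hb z hz
    rw [hfq z, hfq 0, norm_mul, norm_mul, norm_prod, norm_prod] at h1
    have hP0 : 0 < ∏ ρ ∈ T, ‖(0 - ρ) ^ m ρ‖ := by
      refine Finset.prod_pos fun ρ hρ => norm_pos_iff.2 (pow_ne_zero _ (hTne 0 h0 ρ hρ))
    have hP : ∏ ρ ∈ T, ‖(0 - ρ) ^ m ρ‖ ≤ ∏ ρ ∈ T, ‖(z - ρ) ^ m ρ‖ := by
      refine Finset.prod_le_prod (fun _ _ => norm_nonneg _) fun ρ hρ => ?_
      rw [norm_pow, norm_pow]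
      refine pow_le_pow_left₀ (norm_nonneg _) ?_ _
      have h2 := ((mem_zerosInDisc hf h0).1 hρ).2
      have h3 := norm_sub_norm_le z ρ
      rw [zero_sub, norm_neg]; linarith
    have : (∏ ρ ∈ T, ‖(0 - ρ) ^ m ρ‖) * ‖q z‖ ≤
        (∏ ρ ∈ T, ‖(0 - ρ) ^ m ρ‖) * (‖q 0‖ * Real.exp L) := by
      calc _ ≤ (∏ ρ ∈ T, ‖(z - ρ) ^ m ρ‖) * ‖q z‖ := by gcongr
        _ ≤ _ := h1.trans (by rw [mul_assoc])
    exact le_of_mul_le_mul_left this hP0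
  have hqb' : ∀ z ∈ ball (0 : ℂ) R, ‖q z‖ ≤ ‖q 0‖ * Real.exp L := by
    intro z hz
    refine Complex.norm_le_of_forall_mem_frontier_norm_le (U := ball (0 : ℂ) (3 * R)) isBounded_ball
      hq.diffContOnCl (fun w hw => ?_) (subset_closure (ball_subset_ball (by linarith) hz))
    rw [frontier_ball _ (by positivity)] at hw
    exact hqb w (by simpa using hw)
  have key := norm_logDeriv_sub_le hR hL hq.differentiableOn hnz hqb' (s := s) (by simpa using hs)
  rw [hlog s hfs, hlog 0 h0]
  convert key using 2
  have : ∀ ρ : ℂ, (m ρ : ℂ) * (1 / (s - ρ) + 1 / ρ) =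
      m ρ * (1 / (s - ρ)) - m ρ * (1 / (0 - ρ)) := by
    intro ρ
    rw [zero_sub, one_div_neg_eq_neg_one_div]; ring
  simp_rw [this, Finset.sum_sub_distrib]
  ring

open Filter Topology in
/-- Partial fraction expansion of the logarithmic derivative of an entire function of order less
than two. -/
theorem tendsto_sum_logDeriv {f : ℂ → ℂ} (hf : Differentiable ℂ f) (h0 : f 0 ≠ 0) {C a : ℝ}
    (hC : 0 < C) (ha : a < 2) (hb : ∀ z : ℂ, ‖f z‖ ≤ Real.exp (C * (1 + ‖z‖) ^ a)) {s : ℂ}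
    (hfs : f s ≠ 0) :
    Tendsto (fun R : ℝ =>
        ∑ ρ ∈ zerosInDisc f R, (analyticOrderNatAt f ρ : ℂ) * (1 / (s - ρ) + 1 / ρ))
      atTop (𝓝 (logDeriv f s - logDeriv f 0)) := by
  set K : ℝ := |Real.log ‖f 0‖|
  rw [tendsto_iff_norm_sub_tendsto_zero]
  have hlim : Tendsto (fun R : ℝ => 64 * (C * (1 + 3 * R) ^ a + K + 1) / R ^ 2 * ‖s‖)
      atTop (𝓝 0) := by
    have h1 : Tendsto (fun R : ℝ => (1 + 3 * R) ^ a / R ^ 2) atTop (𝓝 0) := by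
      have h2 : Tendsto (fun R : ℝ => (1 + 3 * R) ^ (-(2 - a)) * ((1 / R + 3) ^ 2)) atTop
          (𝓝 (0 * (0 + 3) ^ 2)) := by
        refine Tendsto.mul ?_ ?_
        · refine (tendsto_rpow_neg_atTop (by linarith)).comp ?_
          exact tendsto_atTop_add_const_left _ _ (tendsto_id.const_mul_atTop (by norm_num))
        · refine Tendsto.pow (Tendsto.add_const _ ?_) _
          exact (tendsto_inv_atTop_zero (𝕜 := ℝ)).congr fun R => (one_div R).symm
      rw [zero_mul] at h2
      refine h2.congr' ?_
      filter_upwards [eventually_gt_atTop 0] with R hR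
      have h3 : (0 : ℝ) < 1 + 3 * R := by positivity
      rw [neg_sub, Real.rpow_sub h3, show (2 : ℝ) = ((2 : ℕ) : ℝ) by norm_num, Real.rpow_natCast]
      field_simp
    have h2 : Tendsto (fun R : ℝ => 1 / R ^ 2) atTop (𝓝 0) := by
      simpa [Function.comp_def] using
        tendsto_inv_atTop_zero.comp (tendsto_pow_atTop (α := ℝ) (n := 2) (by norm_num))
    have h3 := (((h1.const_mul C).add (h2.const_mul (K + 1))).const_mul 64).mul_const ‖s‖
    simp only [mul_zero, add_zero, zero_mul] at h3
    refine h3.congr fun R => ?_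
    ring
  refine squeeze_zero' (Eventually.of_forall fun _ => norm_nonneg _) ?_ hlim
  filter_upwards [eventually_gt_atTop 0, eventually_gt_atTop (4 * ‖s‖)] with R hR hRs
  rw [norm_sub_rev]
  refine norm_logDeriv_sub_sum_le hf h0 hR (by positivity) (fun z hz => (hb z).trans ?_)
    (by linarith) hfs
  rw [hz]
  have hpos : 0 < ‖f 0‖ := norm_pos_iff.2 h0
  conv_rhs => rw [← Real.exp_log hpos, ← Real.exp_add]
  refine Real.exp_le_exp.2 ?_
  have : - K ≤ Real.log ‖f 0‖ := neg_abs_le _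
  linarith

/-- Riemann's xi function, normalised by `ξ(0) = ξ(1) = 1`. -/
noncomputable def xiFun (s : ℂ) : ℂ := s * (s - 1) * completedRiemannZeta₀ s + 1

theorem differentiable_xiFun : Differentiable ℂ xiFun := by
  unfold xiFun
  have := differentiable_completedZeta₀
  fun_prop

theorem xiFun_one_sub (s : ℂ) : xiFun (1 - s) = xiFun s := by
  simp only [xiFun, completedRiemannZeta₀_one_sub]; ring

@[simp] theorem xiFun_zero : xiFun 0 = 1 := by simp [xiFun]
@[simp] theorem xiFun_one : xiFun 1 = 1 := by simp [xiFun]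

theorem xiFun_eq {s : ℂ} (h0 : s ≠ 0) (h1 : s ≠ 1) :
    xiFun s = s * (s - 1) * completedRiemannZeta s := by
  have h1' : 1 - s ≠ 0 := sub_ne_zero.2 h1.symm
  rw [xiFun, completedRiemannZeta_eq]
  field_simp
  ring

theorem xiFun_eq_mul_riemannZeta {s : ℂ} (h0 : 0 < s.re) (h1 : s ≠ 1) :
    xiFun s = s * (s - 1) * (Complex.Gammaℝ s * riemannZeta s) := by
  have hs0 : s ≠ 0 := by rintro rfl; simp at h0
  rw [xiFun_eq hs0 h1, riemannZeta_def_of_ne_zero hs0,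
    mul_div_cancel₀ _ (Complex.Gammaℝ_ne_zero_of_re_pos h0)]

/-- The nontrivial zeros lie in the open critical strip. -/
theorem xiFun_ne_zero_of_one_le_re {s : ℂ} (hs : 1 ≤ s.re) : xiFun s ≠ 0 := by
  by_cases h1 : s = 1
  · simp [h1]
  have h0 : 0 < s.re := by linarith
  have hs0 : s ≠ 0 := by rintro rfl; simp at h0
  rw [xiFun_eq_mul_riemannZeta h0 h1]
  exact mul_ne_zero (mul_ne_zero hs0 (sub_ne_zero.2 h1))
    (mul_ne_zero (Complex.Gammaℝ_ne_zero_of_re_pos h0) (riemannZeta_ne_zero_of_one_le_re hs))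

theorem re_lt_one_of_xiFun_eq_zero {s : ℂ} (hs : xiFun s = 0) : s.re < 1 := by
  by_contra! h
  exact xiFun_ne_zero_of_one_le_re h hs

theorem re_pos_of_xiFun_eq_zero {s : ℂ} (hs : xiFun s = 0) : 0 < s.re := by
  have := re_lt_one_of_xiFun_eq_zero (s := 1 - s) (by rw [xiFun_one_sub, hs])
  simp at this; linarith

open MeasureTheory Set in
theorem exists_bound_completedRiemannZeta₀_strip :
    ∃ K : ℝ, 0 < K ∧ ∀ s : ℂ, 0 ≤ s.re → s.re ≤ 2 → ‖completedRiemannZeta₀ s‖ ≤ K := by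
  set P := HurwitzZeta.hurwitzEvenFEPair 0
  have hconv : ∀ s : ℂ, MellinConvergent P.f_modif s := fun s =>
    (P.isStrongFEPair_toStrongFEPair.hasMellin s).1
  have h0 := (hconv 0).norm
  have h1 := (hconv 1).norm
  set K := (∫ t in Ioi (0 : ℝ), ‖(t : ℂ) ^ ((0 : ℂ) - 1) • P.f_modif t‖) +
    ∫ t in Ioi (0 : ℝ), ‖(t : ℂ) ^ ((1 : ℂ) - 1) • P.f_modif t‖ with hK
  have hK0 : 0 ≤ K := by positivity
  refine ⟨K + 1, by positivity, fun s hs0 hs2 => ?_⟩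
  have hs : completedRiemannZeta₀ s = mellin P.f_modif (s / 2) / 2 := rfl
  have key : ‖mellin P.f_modif (s / 2)‖ ≤ K := by
    rw [hK, ← integral_add h0 h1]
    refine (norm_integral_le_integral_norm _).trans ?_
    refine setIntegral_mono_on (hconv _).norm (h0.add h1) measurableSet_Ioi fun t ht => ?_
    have ht' : (0 : ℝ) < t := ht
    simp only [norm_smul, Complex.norm_cpow_eq_rpow_re_of_pos ht', ← add_mul]
    refine mul_le_mul_of_nonneg_right ?_ (norm_nonneg _)
    have e1 : (s / 2 - 1).re = s.re / 2 - 1 := by simp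
    have e2 : ((0 : ℂ) - 1).re = -1 := by simp
    have e3 : ((1 : ℂ) - 1).re = 0 := by simp
    rw [e1, e2, e3]
    rcases le_total t 1 with h | h
    · have := Real.rpow_le_rpow_of_exponent_ge ht' h (show (-1 : ℝ) ≤ s.re / 2 - 1 by linarith)
      exact this.trans (le_add_of_nonneg_right (by positivity))
    · have := Real.rpow_le_rpow_of_exponent_le h (show s.re / 2 - 1 ≤ (0 : ℝ) by linarith)
      exact this.trans (le_add_of_nonneg_left (by positivity))
  rw [hs, norm_div]
  have : ‖(2 : ℂ)‖ = 2 := by simp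
  rw [this]
  linarith

theorem norm_riemannZeta_le_of_two_le_re {s : ℂ} (hs : 2 ≤ s.re) : ‖riemannZeta s‖ ≤ 2 := by
  rw [zeta_eq_tsum_one_div_nat_cpow (by linarith)]
  have hsum : HasSum (fun n : ℕ => 1 / (n : ℝ) ^ 2) (π ^ 2 / 6) := hasSum_zeta_two
  have hle : ∀ n : ℕ, ‖1 / (n : ℂ) ^ s‖ ≤ 1 / (n : ℝ) ^ 2 := by
    intro n
    rcases Nat.eq_zero_or_pos n with rfl | hn
    · have : s ≠ 0 := by rintro rfl; norm_num at hs
      simp [this]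
    · rw [norm_div, norm_one, Complex.norm_natCast_cpow_of_pos hn]
      have h1 : (1 : ℝ) ≤ n := by exact_mod_cast hn
      have := Real.rpow_le_rpow_of_exponent_le h1 hs
      rw [Real.rpow_two] at this
      gcongr
  have h1 := tsum_of_norm_bounded hsum hle
  refine h1.trans ?_
  have := Real.pi_lt_d2
  have := Real.pi_pos
  nlinarith

theorem Gamma_le_exp {x : ℝ} (hx : 1 ≤ x) : Real.Gamma x ≤ Real.exp (16 * x ^ (3 / 2 : ℝ)) := by
  have hx0 : 0 < x := by linarith
  have h1 : Real.Gamma x ≤ Real.Gamma (x + 1) := by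
    rw [Real.Gamma_add_one hx0.ne']
    have := Real.Gamma_pos_of_pos hx0
    nlinarith
  have h2 : Real.Gamma (x + 1) ≤ Real.Gamma (⌈x⌉₊ + 1) :=
    Real.Gamma_strictMonoOn_Ici.monotoneOn (Set.mem_Ici.2 (by linarith))
      (Set.mem_Ici.2 (by have := Nat.le_ceil x; linarith)) (by have := Nat.le_ceil x; linarith)
  rw [Real.Gamma_nat_eq_factorial] at h2
  have h3 : ((⌈x⌉₊.factorial : ℕ) : ℝ) ≤ (⌈x⌉₊ : ℝ) ^ ⌈x⌉₊ := by
    exact_mod_cast Nat.factorial_le_pow _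
  have h4 : (⌈x⌉₊ : ℝ) ≤ 2 * x := by have := (Nat.ceil_lt_add_one hx0.le); linarith
  have hc1 : (1 : ℝ) ≤ ⌈x⌉₊ := by exact_mod_cast Nat.one_le_ceil_iff.2 hx0
  have h5 : (⌈x⌉₊ : ℝ) ^ ⌈x⌉₊ ≤ Real.exp (16 * x ^ (3 / 2 : ℝ)) := by
    have e : (⌈x⌉₊ : ℝ) ^ ⌈x⌉₊ = Real.exp (⌈x⌉₊ * Real.log ⌈x⌉₊) := by
      rw [Real.exp_nat_mul, Real.exp_log (by linarith)]
    rw [e]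
    refine Real.exp_le_exp.2 ?_
    have hlog : Real.log ⌈x⌉₊ ≤ 2 * Real.log x + 2 := by
      have : Real.log ⌈x⌉₊ ≤ Real.log (2 * x) := Real.log_le_log (by linarith) h4
      rw [Real.log_mul (by norm_num) hx0.ne'] at this
      have := Real.log_two_lt_d9
      have := Real.log_nonneg hx
      linarith
    have hlx : Real.log x ≤ 2 * x ^ (1 / 2 : ℝ) := by
      have := Real.log_le_rpow_div hx0.le (ε := 1 / 2) (by norm_num)
      linarith
    have h1x : 1 ≤ x ^ (1 / 2 : ℝ) := Real.one_le_rpow hx (by norm_num)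
    have hmul : x ^ (3 / 2 : ℝ) = x * x ^ (1 / 2 : ℝ) := by
      rw [show (3 / 2 : ℝ) = 1 + 1 / 2 by norm_num, Real.rpow_add hx0, Real.rpow_one]
    rw [hmul]
    have hln : 0 ≤ Real.log ⌈x⌉₊ := Real.log_nonneg hc1
    calc (⌈x⌉₊ : ℝ) * Real.log ⌈x⌉₊ ≤ 2 * x * (6 * x ^ (1 / 2 : ℝ)) := by
          refine mul_le_mul h4 (by linarith) hln (by linarith)
      _ ≤ _ := by nlinarith [mul_pos hx0 (show 0 < x ^ (1 / 2 : ℝ) by linarith)]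
  linarith

open MeasureTheory Set in
theorem norm_Gamma_le_Gamma_re {s : ℂ} (hs : 0 < s.re) : ‖Complex.Gamma s‖ ≤ Real.Gamma s.re := by
  rw [Complex.Gamma_eq_integral hs, Real.Gamma_eq_integral hs, Complex.GammaIntegral]
  refine (norm_integral_le_integral_norm _).trans (le_of_eq ?_)
  refine setIntegral_congr_fun measurableSet_Ioi fun t ht => ?_
  have ht' : (0 : ℝ) < t := ht
  simp [Complex.norm_cpow_eq_rpow_re_of_pos ht', Complex.norm_exp]

theorem norm_Gammaℝ_le {s : ℂ} (hs : 2 ≤ s.re) :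
    ‖Complex.Gammaℝ s‖ ≤ Real.exp (16 * (1 + ‖s‖) ^ (3 / 2 : ℝ)) := by
  rw [Complex.Gammaℝ_def, norm_mul, Complex.norm_cpow_eq_rpow_re_of_pos Real.pi_pos]
  have h1 : π ^ (-s / 2).re ≤ 1 := by
    refine Real.rpow_le_one_of_one_le_of_nonpos (by linarith [Real.pi_gt_three]) ?_
    simp; linarith
  have hre : (s / 2).re = s.re / 2 := by simp
  have h2 : ‖Complex.Gamma (s / 2)‖ ≤ Real.Gamma (s.re / 2) := by
    have := norm_Gamma_le_Gamma_re (s := s / 2) (by rw [hre]; linarith)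
    rwa [hre] at this
  have h3 := Gamma_le_exp (x := s.re / 2) (by linarith)
  have h4 : (s.re / 2) ^ (3 / 2 : ℝ) ≤ (1 + ‖s‖) ^ (3 / 2 : ℝ) := by
    refine Real.rpow_le_rpow (by linarith) ?_ (by norm_num)
    have := Complex.re_le_norm s
    have := norm_nonneg s
    linarith
  calc _ ≤ 1 * ‖Complex.Gamma (s / 2)‖ := by gcongr
    _ = ‖Complex.Gamma (s / 2)‖ := one_mul _
    _ ≤ _ := h2.trans (h3.trans (Real.exp_le_exp.2 (by linarith)))

theorem exists_growth_xiFun :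
    ∃ C : ℝ, 0 < C ∧ ∀ z : ℂ, ‖xiFun z‖ ≤ Real.exp (C * (1 + ‖z‖) ^ (3 / 2 : ℝ)) := by
  obtain ⟨K, hK, hKb⟩ := exists_bound_completedRiemannZeta₀_strip
  have main : ∀ z : ℂ, 0 ≤ z.re → ‖xiFun z‖ ≤ Real.exp ((K + 20) * (1 + ‖z‖) ^ (3 / 2 : ℝ)) := by
    intro z hz
    set r := 1 + ‖z‖
    have hr : 1 ≤ r := by simp [r]
    have hr32 : r ≤ r ^ (3 / 2 : ℝ) := by
      conv_lhs => rw [← Real.rpow_one r]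
      exact Real.rpow_le_rpow_of_exponent_le hr (by norm_num)
    have hzr : ‖z‖ ≤ r := by simp [r]
    have hz1 : ‖z - 1‖ ≤ r := (norm_sub_le _ _).trans (by simp [r, add_comm])
    have hrexp : r ≤ Real.exp r := by linarith [Real.add_one_le_exp r]
    rcases le_total z.re 2 with h2 | h2
    · have hKe : K + 1 ≤ Real.exp K := Real.add_one_le_exp K
      calc ‖xiFun z‖ ≤ ‖z‖ * ‖z - 1‖ * ‖completedRiemannZeta₀ z‖ + 1 := by
            unfold xiFun
            refine (norm_add_le _ _).trans ?_
            simp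
        _ ≤ r * r * K + r * r * 1 := by
            have := hKb z hz h2
            gcongr
            nlinarith
        _ = r * r * (K + 1) := by ring
        _ ≤ Real.exp r * Real.exp r * Real.exp K := by gcongr
        _ = Real.exp (r + r + K) := by rw [← Real.exp_add, ← Real.exp_add]
        _ ≤ _ := Real.exp_le_exp.2 (by nlinarith)
    · have hne : z ≠ 1 := by rintro rfl; norm_num at h2
      rw [xiFun_eq_mul_riemannZeta (by linarith) hne]
      have h2e : (2 : ℝ) ≤ Real.exp 1 := by linarith [Real.add_one_le_exp 1]
      calc _ = ‖z‖ * ‖z - 1‖ * (‖Complex.Gammaℝ z‖ * ‖riemannZeta z‖) := by simp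
        _ ≤ Real.exp r * Real.exp r * (Real.exp (16 * r ^ (3 / 2 : ℝ)) * Real.exp 1) := by
            have := norm_Gammaℝ_le h2
            have := norm_riemannZeta_le_of_two_le_re h2
            gcongr
            · linarith
            · linarith
            · linarith
        _ = Real.exp (r + r + (16 * r ^ (3 / 2 : ℝ) + 1)) := by simp only [← Real.exp_add]
        _ ≤ _ := Real.exp_le_exp.2 (by nlinarith)
  refine ⟨4 * (K + 20), by positivity, fun z => ?_⟩
  rcases le_total 0 z.re with h | h
  · refine (main z h).trans (Real.exp_le_exp.2 ?_)
    have : 0 ≤ (1 + ‖z‖) ^ (3 / 2 : ℝ) := by positivity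
    nlinarith
  · rw [← xiFun_one_sub]
    refine (main (1 - z) (by simp; linarith)).trans (Real.exp_le_exp.2 ?_)
    have h1 : (1 + ‖1 - z‖) ^ (3 / 2 : ℝ) ≤ (2 * (1 + ‖z‖)) ^ (3 / 2 : ℝ) := by
      refine Real.rpow_le_rpow (by positivity) ?_ (by norm_num)
      have := norm_sub_le (1 : ℂ) z
      simp at this
      linarith [norm_nonneg z]
    rw [Real.mul_rpow (by norm_num) (by positivity)] at h1
    have h2 : (2 : ℝ) ^ (3 / 2 : ℝ) ≤ 4 := by
      calc (2 : ℝ) ^ (3 / 2 : ℝ) ≤ 2 ^ (2 : ℝ) :=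
            Real.rpow_le_rpow_of_exponent_le (by norm_num) (by norm_num)
        _ = 4 := by norm_num
    have h3 : 0 ≤ (1 + ‖z‖) ^ (3 / 2 : ℝ) := by positivity
    have h4 : (1 + ‖1 - z‖) ^ (3 / 2 : ℝ) ≤ 4 * (1 + ‖z‖) ^ (3 / 2 : ℝ) :=
      h1.trans (mul_le_mul_of_nonneg_right h2 h3)
    calc _ ≤ (K + 20) * (4 * (1 + ‖z‖) ^ (3 / 2 : ℝ)) := by gcongr
      _ = _ := by ring

/-- The multiplicity of a zero of `ξ`. -/
noncomputable def xiMult (ρ : ℂ) : ℕ := analyticOrderNatAt xiFun ρ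

theorem xiMult_ne_zero_iff {ρ : ℂ} : xiMult ρ ≠ 0 ↔ xiFun ρ = 0 := by
  constructor
  · exact apply_eq_zero_of_analyticOrderNatAt_ne_zero
  · intro h h0
    have h1 := analyticOrderAt_ne_top_of_entire differentiable_xiFun (by simp) ρ
    have h2 : analyticOrderAt xiFun ρ = 0 := by
      rw [← Nat.cast_analyticOrderNatAt h1]
      simpa [xiMult] using h0
    rw [analyticOrderAt_eq_zero] at h2
    rcases h2 with h2 | h2
    · exact h2 (differentiable_xiFun.analyticAt ρ)
    · exact h2 h

theorem xiMult_eq_zero_of_ne {ρ : ℂ} (h : xiFun ρ ≠ 0) : xiMult ρ = 0 := by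
  by_contra h0
  exact h (xiMult_ne_zero_iff.1 h0)

theorem xiMult_one_sub (ρ : ℂ) : xiMult (1 - ρ) = xiMult ρ := by
  have h : xiFun = xiFun ∘ fun z => 1 - z := funext fun z => (xiFun_one_sub z).symm
  unfold xiMult analyticOrderNatAt
  congr 1
  conv_rhs => rw [h]
  have := (differentiable_xiFun.analyticAt (1 - ρ)).analyticOrderAt_comp (g := fun z : ℂ => 1 - z)
    (z₀ := ρ) (by fun_prop)
  rw [this]
  have h1 : analyticOrderAt (fun z : ℂ => 1 - z - (1 - ρ)) ρ = 1 := by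
    have h2 : (fun z : ℂ => 1 - z - (1 - ρ)) = fun z => (-1 : ℂ) * (z - ρ) := by ext; ring
    have := (show AnalyticAt ℂ (fun z : ℂ => 1 - z - (1 - ρ)) ρ by
      fun_prop).analyticOrderAt_eq_natCast (n := 1)
    rw [Nat.cast_one] at this
    refine this.2 ⟨fun _ => -1, analyticAt_const, by simp, ?_⟩
    filter_upwards with z
    simp
  rw [h1, mul_one]

/-- Partial sums over discs converge to the full sum. -/
theorem tendsto_sum_zerosInDisc {E : Type*} [NormedAddCommGroup E] [CompleteSpace E] {g : ℂ → E}
    (hg : Summable fun ρ => ‖g ρ‖) (h0 : ∀ ρ, xiFun ρ ≠ 0 → g ρ = 0) :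
    Filter.Tendsto (fun R : ℝ => ∑ ρ ∈ zerosInDisc xiFun R, g ρ)
        Filter.atTop (nhds (∑' ρ, g ρ)) := by
  classical
  have h1 : ∀ R : ℝ, ∑ ρ ∈ zerosInDisc xiFun R, g ρ =
      ∑' ρ, if ρ ∈ zerosInDisc xiFun R then g ρ else 0 := by
    intro R
    rw [tsum_eq_sum (s := zerosInDisc xiFun R) (fun ρ hρ => by simp [hρ])]
    exact Finset.sum_congr rfl fun ρ hρ => by simp [hρ]
  simp_rw [h1]
  refine tendsto_tsum_of_dominated_convergence hg (fun ρ => ?_) ?_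
  · refine tendsto_const_nhds.congr' ?_
    filter_upwards [Filter.eventually_ge_atTop ‖ρ‖] with R hR
    by_cases hρ : xiFun ρ = 0
    · rw [if_pos ((mem_zerosInDisc differentiable_xiFun (by simp)).2 ⟨hρ, hR⟩)]
    · simp [h0 ρ hρ]
  · filter_upwards with R ρ
    split_ifs
    · exact le_rfl
    · simp

theorem hasSum_of_tendsto_zerosInDisc {g : ℂ → ℝ} (hg : ∀ ρ, 0 ≤ g ρ)
    (h0 : ∀ ρ, xiFun ρ ≠ 0 → g ρ = 0) {a : ℝ}
    (h : Filter.Tendsto (fun R : ℝ => ∑ ρ ∈ zerosInDisc xiFun R, g ρ) Filter.atTop (nhds a)) :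
    HasSum g a := by
  classical
  have hmono : Monotone fun R : ℝ => ∑ ρ ∈ zerosInDisc xiFun R, g ρ := by
    intro R S hRS
    refine Finset.sum_le_sum_of_subset_of_nonneg (fun ρ hρ => ?_) fun ρ _ _ => hg ρ
    rw [mem_zerosInDisc differentiable_xiFun (by simp)] at hρ ⊢
    exact ⟨hρ.1, hρ.2.trans hRS⟩
  have hsum : Summable g := by
    refine summable_of_sum_le hg (c := a) fun T => ?_
    obtain ⟨R, hR⟩ : ∃ R : ℝ, ∀ ρ ∈ T, ‖ρ‖ ≤ R := by
      refine ⟨∑ ρ ∈ T, ‖ρ‖,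
          fun ρ hρ => Finset.single_le_sum (f := fun ρ => ‖ρ‖) (fun _ _ => norm_nonneg _) hρ⟩
    calc ∑ ρ ∈ T, g ρ = ∑ ρ ∈ T.filter (fun ρ => xiFun ρ = 0), g ρ := by
          rw [Finset.sum_filter]
          refine Finset.sum_congr rfl fun ρ _ => ?_
          split_ifs with h
          · rfl
          · exact h0 ρ h
      _ ≤ ∑ ρ ∈ zerosInDisc xiFun R, g ρ := by
          refine Finset.sum_le_sum_of_subset_of_nonneg (fun ρ hρ => ?_) fun ρ _ _ => hg ρ
          rw [Finset.mem_filter] at hρ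
          exact (mem_zerosInDisc differentiable_xiFun (by simp)).2 ⟨hρ.2, hR ρ hρ.1⟩
      _ ≤ a := hmono.ge_of_tendsto h R
  have := tendsto_sum_zerosInDisc (g := g) (by simpa [abs_of_nonneg (hg _)] using hsum) h0
  rw [tendsto_nhds_unique h this]
  exact hsum.hasSum

/-- The value `ξ'(1)/ξ(1)`. -/
noncomputable def xiConst : ℝ := (eulerMascheroniConstant - Real.log (4 * π)) / 2 + 1

theorem completedRiemannZeta₀_one_eq : completedRiemannZeta₀ 1 = (xiConst : ℂ) := by
  rw [completedRiemannZeta₀_one, xiConst]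
  have : Complex.log (4 * π) = (Real.log (4 * π) : ℝ) := by
    rw [Complex.ofReal_log (by positivity)]; norm_num
  rw [this]; push_cast; ring

theorem hasDerivAt_xiFun (s : ℂ) : HasDerivAt xiFun
    ((2 * s - 1) * completedRiemannZeta₀ s + s * (s - 1) * deriv completedRiemannZeta₀ s) s := by
  have h1 := (differentiable_completedZeta₀ s).hasDerivAt
  have h2 : HasDerivAt (fun s : ℂ => s * (s - 1)) (1 * (s - 1) + s * 1) s :=
    (hasDerivAt_id s).mul ((hasDerivAt_id s).sub_const 1)
  refine ((h2.mul h1).add_const 1).congr_deriv ?_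
  ring

theorem logDeriv_xiFun_one : logDeriv xiFun 1 = (xiConst : ℂ) := by
  rw [logDeriv_apply, (hasDerivAt_xiFun 1).deriv, xiFun_one, completedRiemannZeta₀_one_eq]
  norm_num

theorem logDeriv_xiFun_zero : logDeriv xiFun 0 = -(xiConst : ℂ) := by
  rw [logDeriv_apply, (hasDerivAt_xiFun 0).deriv, xiFun_zero]
  have : completedRiemannZeta₀ 0 = (xiConst : ℂ) := by
    rw [← completedRiemannZeta₀_one_eq, ← completedRiemannZeta₀_one_sub]; norm_num
  rw [this]; norm_num

theorem tendsto_logDeriv_xiFun {s : ℂ} (hs : xiFun s ≠ 0) :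
    Filter.Tendsto (fun R : ℝ => ∑ ρ ∈ zerosInDisc xiFun R, (xiMult ρ : ℂ) * (1 / (s - ρ) + 1 / ρ))
      Filter.atTop (nhds (logDeriv xiFun s + xiConst)) := by
  obtain ⟨C, hC, hb⟩ := exists_growth_xiFun
  have := tendsto_sum_logDeriv differentiable_xiFun (by simp) hC (by norm_num) hb hs
  rwa [logDeriv_xiFun_zero, sub_neg_eq_add] at this

theorem one_div_re_pos {z : ℂ} (hz : 0 < z.re) : 0 < (1 / z).re := by
  have h0 : z ≠ 0 := by rintro rfl; simp at hz
  rw [one_div, Complex.inv_re]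
  exact div_pos hz (Complex.normSq_pos.2 h0)

theorem one_div_mul_eq {ρ : ℂ} (h : xiFun ρ = 0) :
    1 / (ρ * (1 - ρ)) = 1 / (1 - ρ) + 1 / ρ := by
  have h0 : ρ ≠ 0 := by rintro rfl; simp at h
  have h1 : 1 - ρ ≠ 0 := by
    intro h'; rw [sub_eq_zero] at h'; subst h'; simp at h
  field_simp
  ring

theorem xiMult_mul_nonneg {g : ℂ → ℝ} (hg : ∀ ρ, xiFun ρ = 0 → 0 ≤ g ρ) (ρ : ℂ) :
    0 ≤ (xiMult ρ : ℝ) * g ρ := by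
  by_cases h : xiFun ρ = 0
  · exact mul_nonneg (Nat.cast_nonneg _) (hg ρ h)
  · simp [xiMult_eq_zero_of_ne h]

theorem re_one_div_pos_of_zero {ρ : ℂ} (h : xiFun ρ = 0) : 0 < (1 / ρ).re :=
  one_div_re_pos (re_pos_of_xiFun_eq_zero h)

theorem re_one_div_one_sub_pos_of_zero {ρ : ℂ} (h : xiFun ρ = 0) : 0 < (1 / (1 - ρ)).re :=
  one_div_re_pos (re_pos_of_xiFun_eq_zero (by rwa [xiFun_one_sub]))

theorem hasSum_re_one_div_mul :
    HasSum (fun ρ : ℂ => (xiMult ρ : ℝ) * (1 / (ρ * (1 - ρ))).re) (2 * xiConst) := by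
  refine hasSum_of_tendsto_zerosInDisc (xiMult_mul_nonneg fun ρ h => ?_)
    (fun ρ h => by simp [xiMult_eq_zero_of_ne h]) ?_
  · rw [one_div_mul_eq h, Complex.add_re]
    exact (add_pos (re_one_div_one_sub_pos_of_zero h) (re_one_div_pos_of_zero h)).le
  · have h1 := (Complex.continuous_re.tendsto _).comp (tendsto_logDeriv_xiFun (s := 1) (by simp))
    rw [logDeriv_xiFun_one] at h1
    have h2 : ((xiConst : ℂ) + xiConst).re = 2 * xiConst := by simp; ring
    rw [h2] at h1
    refine h1.congr fun R => ?_
    simp only [Function.comp_apply, Complex.re_sum]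
    refine Finset.sum_congr rfl fun ρ hρ => ?_
    rw [mem_zerosInDisc differentiable_xiFun (by simp)] at hρ
    rw [one_div_mul_eq hρ.1, ← Complex.ofReal_natCast, Complex.re_ofReal_mul]

theorem summable_re_one_div : Summable fun ρ : ℂ => (xiMult ρ : ℝ) * (1 / ρ).re := by
  refine Summable.of_nonneg_of_le (xiMult_mul_nonneg fun ρ h => (re_one_div_pos_of_zero h).le)
    (fun ρ => ?_) hasSum_re_one_div_mul.summable
  by_cases h : xiFun ρ = 0
  · rw [one_div_mul_eq h, Complex.add_re]
    have := re_one_div_one_sub_pos_of_zero h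
    gcongr
    linarith
  · simp [xiMult_eq_zero_of_ne h]

theorem hasSum_re_one_div : HasSum (fun ρ : ℂ => (xiMult ρ : ℝ) * (1 / ρ).re) xiConst := by
  have h1 := summable_re_one_div.hasSum
  have h2 := (Equiv.subLeft (1 : ℂ)).hasSum_iff.2 h1
  have h3 : HasSum (fun ρ : ℂ => (xiMult ρ : ℝ) * (1 / (ρ * (1 - ρ))).re)
      ((∑' ρ : ℂ, (xiMult ρ : ℝ) * (1 / ρ).re) + ∑' ρ : ℂ, (xiMult ρ : ℝ) * (1 / ρ).re) := by
    refine (h2.add h1).congr_fun fun ρ => ?_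
    simp only [Function.comp_apply, Equiv.subLeft_apply, xiMult_one_sub]
    by_cases h : xiFun ρ = 0
    · rw [one_div_mul_eq h, Complex.add_re]; ring
    · simp [xiMult_eq_zero_of_ne h]
  have h4 := h3.unique hasSum_re_one_div_mul
  have h5 : ∑' ρ : ℂ, (xiMult ρ : ℝ) * (1 / ρ).re = xiConst := by linarith
  rwa [h5] at h1

theorem log_le_half_sub_inv {t : ℝ} (ht : 1 ≤ t) : Real.log t ≤ (t - t⁻¹) / 2 := by
  rw [← Real.sinh_log (by linarith)]
  exact Real.self_le_sinh_iff.2 (Real.log_nonneg ht)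

theorem harmonic_sub_log_sub_le_eulerMascheroni {n : ℕ} (hn : 1 ≤ n) :
    (harmonic n : ℝ) - Real.log n - 1 / (2 * n) ≤ eulerMascheroniConstant := by
  set a : ℕ → ℝ :=
    fun n => (harmonic (n + 1) : ℝ) - Real.log ((n : ℝ) + 1) - 1 / (2 * ((n : ℝ) + 1))
  have hmono : Monotone a := by
    refine monotone_nat_of_le_succ fun n => ?_
    simp only [a]
    have hn : (0 : ℝ) < n + 1 := by positivity
    have h := log_le_half_sub_inv (t := ((n : ℝ) + 1 + 1) / (n + 1))
      (by rw [le_div_iff₀ hn]; linarith)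
    rw [Real.log_div (by positivity) (by positivity)] at h
    rw [harmonic_succ (n + 1)]
    push_cast
    have e : (((n : ℝ) + 1 + 1) / (n + 1) - (((n : ℝ) + 1 + 1) / (n + 1))⁻¹) / 2
      = (1 / (n + 1) + 1 / (n + 1 + 1)) / 2 := by field_simp; ring
    rw [e] at h
    have e2 : (1 : ℝ) / (2 * (n + 1)) = (1 / (n + 1)) / 2 := by field_simp
    have e3 : (1 : ℝ) / (2 * (n + 1 + 1)) = (1 / (n + 1 + 1)) / 2 := by field_simp
    have e4 : ((n : ℝ) + 1 + 1)⁻¹ = 1 / (n + 1 + 1) := by rw [one_div]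
    rw [e2, e3, e4]
    linarith
  have hlim : Filter.Tendsto a Filter.atTop (nhds eulerMascheroniConstant) := by
    have h1 := (tendsto_harmonic_sub_log).comp (Filter.tendsto_add_atTop_nat 1)
    have h2 : Filter.Tendsto (fun n : ℕ => 1 / (2 * ((n : ℝ) + 1))) Filter.atTop (nhds 0) := by
      have := (tendsto_one_div_add_atTop_nhds_zero_nat (𝕜 := ℝ)).const_mul (1 / 2)
      rw [mul_zero] at this
      refine this.congr fun n => by field_simp
    have h3 := h1.sub h2
    rw [sub_zero] at h3
    refine h3.congr fun n => ?_
    simp [a]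
  obtain ⟨k, rfl⟩ : ∃ k, n = k + 1 := ⟨n - 1, by omega⟩
  have := hmono.ge_of_tendsto hlim k
  simpa [a] using this

theorem eulerMascheroni_le_harmonic_sub_log (n : ℕ) :
    eulerMascheroniConstant ≤ (harmonic n : ℝ) - Real.log (n + 1 / 2) := by
  set a : ℕ → ℝ := fun n => (harmonic n : ℝ) - Real.log ((n : ℝ) + 1 / 2)
  have hanti : Antitone a := by
    refine antitone_nat_of_succ_le fun n => ?_
    simp only [a]
    have hn : (0 : ℝ) < n + 1 / 2 := by positivity
    have h := Real.le_log_one_add_of_nonneg (x := 1 / ((n : ℝ) + 1 / 2)) (by positivity)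
    have e : (1 : ℝ) + 1 / ((n : ℝ) + 1 / 2) = ((n + 1 : ℕ) + 1 / 2) / (n + 1 / 2) := by
      push_cast; field_simp; ring
    rw [e, Real.log_div (by positivity) (by positivity)] at h
    have e2 : 2 * (1 / ((n : ℝ) + 1 / 2)) / (1 / ((n : ℝ) + 1 / 2) + 2) = ((n : ℝ) + 1)⁻¹ := by
      field_simp; ring
    rw [e2] at h
    rw [harmonic_succ]
    push_cast at h ⊢
    linarith
  have hlim : Filter.Tendsto a Filter.atTop (nhds eulerMascheroniConstant) := by
    have h1 := tendsto_harmonic_sub_log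
    have h2 : Filter.Tendsto (fun n : ℕ => Real.log (1 + (1 / 2) * (1 / (n : ℝ))))
        Filter.atTop (nhds 0) := by
      have := (((tendsto_one_div_atTop_nhds_zero_nat (𝕜 := ℝ)).const_mul (1 / 2)).const_add 1).log
        (by norm_num)
      simpa using this
    have h3 := h1.sub h2
    rw [sub_zero] at h3
    refine h3.congr' ?_
    filter_upwards [Filter.eventually_gt_atTop 0] with n hn
    have hn' : (0 : ℝ) < n := by exact_mod_cast hn
    have : (n : ℝ) + 1 / 2 = n * (1 + (1 / 2) * (1 / (n : ℝ))) := by field_simp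
    simp only [a]
    rw [this, Real.log_mul (by positivity) (by positivity)]
    ring
  exact hanti.le_of_tendsto hlim n

theorem eulerMascheroni_gt : 0.57721 < eulerMascheroniConstant := by
  have h := harmonic_sub_log_sub_le_eulerMascheroni (n := 128) (by norm_num)
  have hH : (5.433147 : ℚ) < harmonic 128 := by decide +kernel
  have hH' : (5.433147 : ℝ) < harmonic 128 := by
    have := (Rat.cast_lt (K := ℝ)).2 hH
    norm_num at this ⊢
  have hl : Real.log ((128 : ℕ) : ℝ) = 7 * Real.log 2 := by
    rw [show ((128 : ℕ) : ℝ) = 2 ^ 7 by norm_num, Real.log_pow]; norm_num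
  rw [hl] at h
  have := Real.log_two_lt_d9
  norm_num at h
  linarith

theorem eulerMascheroni_lt : eulerMascheroniConstant < 0.57722 := by
  have h := eulerMascheroni_le_harmonic_sub_log 128
  have hH : harmonic 128 < (5.433148 : ℚ) := by decide +kernel
  have hH' : harmonic 128 < (5.433148 : ℝ) := by
    have := (Rat.cast_lt (K := ℝ)).2 hH
    norm_num at this ⊢
  have hl : 7 * Real.log 2 + 2 / 513 ≤ Real.log (((128 : ℕ) : ℝ) + 1 / 2) := by
    rw [show ((128 : ℕ) : ℝ) + 1 / 2 = 2 ^ 7 * (1 + 1 / 256) by norm_num,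
      Real.log_mul (by norm_num) (by norm_num), Real.log_pow]
    have := Real.le_log_one_add_of_nonneg (x := 1 / 256) (by norm_num)
    norm_num at this ⊢
    linarith
  have := Real.log_two_gt_d9
  linarith

theorem le_log_of_two_pow_le {x : ℝ} {a b : ℕ} (hb : 0 < b) (h : (2 : ℝ) ^ a ≤ x ^ b) :
    (a : ℝ) / b * Real.log 2 ≤ Real.log x := by
  have := Real.log_le_log (by positivity) h
  rw [Real.log_pow, Real.log_pow] at this
  have hb' : (0 : ℝ) < b := by exact_mod_cast hb
  rw [div_mul_eq_mul_div, div_le_iff₀ hb']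
  linarith

theorem log_le_of_le_two_pow {x : ℝ} (hx : 0 < x) {a b : ℕ} (hb : 0 < b) (h : x ^ b ≤ (2 : ℝ) ^ a) :
    Real.log x ≤ (a : ℝ) / b * Real.log 2 := by
  have := Real.log_le_log (by positivity) h
  rw [Real.log_pow, Real.log_pow] at this
  have hb' : (0 : ℝ) < b := by exact_mod_cast hb
  rw [div_mul_eq_mul_div, le_div_iff₀ hb']
  linarith

theorem log_four_pi_gt : 2.5307 < Real.log (4 * π) := by
  have h1 : Real.log 12.566 ≤ Real.log (4 * π) :=
    Real.log_le_log (by norm_num) (by linarith [Real.pi_gt_d4])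
  have h2 := le_log_of_two_pow_le (x := 12.566) (a := 157) (b := 43) (by norm_num)
    (by norm_num)
  have := Real.log_two_gt_d9
  norm_num at h2
  linarith

theorem two_xiConst_lt : 2 * xiConst < 0.04652 := by
  have := log_four_pi_gt
  have := eulerMascheroni_lt
  unfold xiConst
  linarith

theorem xiFun_zero_ne {ρ : ℂ} (h : xiFun ρ = 0) : ρ ≠ 0 := by rintro rfl; simp at h

theorem xiFun_zero_one_sub_ne {ρ : ℂ} (h : xiFun ρ = 0) : 1 - ρ ≠ 0 := by
  intro h'; rw [sub_eq_zero] at h'; subst h'; simp at h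

theorem one_le_xiMult {ρ : ℂ} (h : xiFun ρ = 0) : (1 : ℝ) ≤ xiMult ρ := by
  exact_mod_cast Nat.one_le_iff_ne_zero.2 (xiMult_ne_zero_iff.2 h)

theorem mul_one_sub_re (ρ : ℂ) : (ρ * (1 - ρ)).re = ρ.re * (1 - ρ.re) + ρ.im ^ 2 := by
  simp; ring

theorem mul_one_sub_im (ρ : ℂ) : (ρ * (1 - ρ)).im = ρ.im * (1 - 2 * ρ.re) := by
  simp; ring

/-- All nontrivial zeros have imaginary part at least `6.4` in absolute value. -/
theorem im_sq_ge_of_zero {ρ : ℂ} (h : xiFun ρ = 0) : 41 ≤ ρ.im ^ 2 := by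
  have hs := hasSum_re_one_div_mul
  have hpos : ∀ ρ : ℂ, xiFun ρ = 0 → 0 ≤ (1 / (ρ * (1 - ρ))).re := fun ρ h => by
    rw [one_div_mul_eq h, Complex.add_re]
    exact (add_pos (re_one_div_one_sub_pos_of_zero h) (re_one_div_pos_of_zero h)).le
  have hL := two_xiConst_lt
  have h0 := re_pos_of_xiFun_eq_zero h
  have h1 := re_lt_one_of_xiFun_eq_zero h
  have hm := one_le_xiMult h
  have hp := hpos ρ h
  by_cases hρ : 1 - ρ = ρ
  · exfalso
    have e : ρ = 1 / 2 := by linear_combination (-1 / 2 : ℂ) * hρ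
    have := le_hasSum hs ρ (fun σ _ => xiMult_mul_nonneg hpos σ)
    have e2 : (1 / (ρ * (1 - ρ))).re = 4 := by rw [e]; norm_num
    rw [e2] at this
    linarith
  · have h2 := sum_le_hasSum {ρ, 1 - ρ} (fun σ _ => xiMult_mul_nonneg hpos σ) hs
    rw [Finset.sum_pair (Ne.symm hρ), xiMult_one_sub, sub_sub_cancel, mul_comm (1 - ρ) ρ] at h2
    set w := ρ * (1 - ρ)
    set A := ρ.re * (1 - ρ.re) + ρ.im ^ 2 with hA
    have hre : w.re = A := mul_one_sub_re ρ
    have him : w.im = ρ.im * (1 - 2 * ρ.re) := mul_one_sub_im ρ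
    have hA0 : 0 < A := by have := mul_pos h0 (sub_pos.2 h1); positivity
    have h3 : 1 / (A + 1) ≤ (1 / w).re := by
      rw [one_div w, Complex.inv_re, Complex.normSq_apply, hre, him, div_le_div_iff₀ (by positivity)
        (add_pos_of_pos_of_nonneg (mul_pos hA0 hA0) (mul_self_nonneg _))]
      have : (ρ.im * (1 - 2 * ρ.re)) * (ρ.im * (1 - 2 * ρ.re)) ≤ A := by
        have e : A - (ρ.im * (1 - 2 * ρ.re)) * (ρ.im * (1 - 2 * ρ.re)) =
          ρ.re * (1 - ρ.re) * (1 + 4 * ρ.im ^ 2) := by rw [hA]; ring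
        have : 0 ≤ ρ.re * (1 - ρ.re) * (1 + 4 * ρ.im ^ 2) := by
          have := mul_pos h0 (sub_pos.2 h1); positivity
        linarith
      nlinarith
    have h4 : 2 * (1 / (A + 1)) ≤ 0.04652 := by nlinarith
    have h5 : 41.9 ≤ A := by
      rw [mul_one_div, div_le_iff₀ (by positivity)] at h4
      norm_num at h4
      linarith
    nlinarith [sq_nonneg (2 * ρ.re - 1)]

theorem abs_im_ge_of_zero {ρ : ℂ} (h : xiFun ρ = 0) : 6 ≤ |ρ.im| := by
  have := im_sq_ge_of_zero h
  rw [← sq_abs] at this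
  nlinarith [abs_nonneg ρ.im]

theorem norm_one_div_le_of_zero {ρ : ℂ} (h : xiFun ρ = 0) :
    ‖1 / (ρ * (1 - ρ))‖ ≤ (83 / 82) * (1 / (ρ * (1 - ρ))).re := by
  have h0 := re_pos_of_xiFun_eq_zero h
  have h1 := re_lt_one_of_xiFun_eq_zero h
  have hγ := im_sq_ge_of_zero h
  set w := ρ * (1 - ρ)
  have hre : w.re = ρ.re * (1 - ρ.re) + ρ.im ^ 2 := mul_one_sub_re ρ
  have him : w.im = ρ.im * (1 - 2 * ρ.re) := mul_one_sub_im ρ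
  have hp := mul_pos h0 (sub_pos.2 h1)
  have hw : 0 < w.re := by rw [hre]; positivity
  have hw0 : w ≠ 0 := by rintro h; rw [h] at hw; simp at hw
  have hn : 0 < ‖w‖ := norm_pos_iff.2 hw0
  rw [norm_div, norm_one, one_div w, Complex.inv_re, Complex.normSq_eq_norm_sq, div_le_iff₀ hn]
  have e : 83 / 82 * (w.re / ‖w‖ ^ 2) * ‖w‖ = (83 / 82 * w.re) / ‖w‖ := by field_simp
  rw [e, le_div_iff₀ hn, one_mul]
  refine abs_le_of_sq_le_sq' ?_ (by positivity) |>.2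
  rw [← Complex.normSq_eq_norm_sq, Complex.normSq_apply]
  have h2 : w.im * w.im * 41 ≤ w.re * w.re := by
    rw [him, hre]
    have h3 : (1 - 2 * ρ.re) ^ 2 ≤ 1 := by nlinarith
    calc ρ.im * (1 - 2 * ρ.re) * (ρ.im * (1 - 2 * ρ.re)) * 41 =
        41 * ρ.im ^ 2 * (1 - 2 * ρ.re) ^ 2 := by ring
      _ ≤ 41 * ρ.im ^ 2 * 1 := by gcongr
      _ ≤ ρ.im ^ 2 * ρ.im ^ 2 := by nlinarith
      _ ≤ _ := by nlinarith
  nlinarith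

theorem summable_norm_one_div_mul :
    Summable fun ρ : ℂ => (xiMult ρ : ℝ) * ‖1 / (ρ * (1 - ρ))‖ := by
  refine Summable.of_nonneg_of_le (fun ρ => by positivity) (fun ρ => ?_)
    (hasSum_re_one_div_mul.summable.mul_left (83 / 82))
  by_cases h : xiFun ρ = 0
  · have := mul_le_mul_of_nonneg_left (norm_one_div_le_of_zero h)
      (Nat.cast_nonneg (α := ℝ) (xiMult ρ))
    linarith
  · simp [xiMult_eq_zero_of_ne h]

/-- `∑ 1/|ρ(1-ρ)|` over the nontrivial zeros. -/
theorem tsum_norm_one_div_mul_le :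
    ∑' ρ : ℂ, (xiMult ρ : ℝ) * ‖1 / (ρ * (1 - ρ))‖ ≤ 0.0471 := by
  calc _ ≤ ∑' ρ : ℂ, (83 / 82) * ((xiMult ρ : ℝ) * (1 / (ρ * (1 - ρ))).re) := by
        refine summable_norm_one_div_mul.tsum_le_tsum (fun ρ => ?_)
          (hasSum_re_one_div_mul.summable.mul_left (83 / 82))
        by_cases h : xiFun ρ = 0
        · have := mul_le_mul_of_nonneg_left (norm_one_div_le_of_zero h)
            (Nat.cast_nonneg (α := ℝ) (xiMult ρ))
          linarith
        · simp [xiMult_eq_zero_of_ne h]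
    _ = 83 / 82 * (2 * xiConst) := by rw [tsum_mul_left, hasSum_re_one_div_mul.tsum_eq]
    _ ≤ _ := by linarith [two_xiConst_lt]

theorem norm_sub_zero_pos {s ρ : ℂ} (h : xiFun ρ = 0) : s.re - 1 ≤ ‖s - ρ‖ := by
  have h1 := re_lt_one_of_xiFun_eq_zero h
  have := Complex.re_le_norm (s - ρ)
  rw [Complex.sub_re] at this
  linarith

theorem one_div_sub_add_eq {s ρ : ℂ} (hs : 1 < s.re) (h : xiFun ρ = 0) :
    1 / (s - ρ) + 1 / ρ = s / (ρ * (s - ρ)) := by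
  have h0 := xiFun_zero_ne h
  have h1 : s - ρ ≠ 0 := by
    have := norm_sub_zero_pos (s := s) h
    exact norm_pos_iff.1 (by linarith)
  field_simp
  ring

theorem norm_div_le_of_zero {s ρ : ℂ} (hs : 1 < s.re) (h : xiFun ρ = 0) :
    ‖s / (ρ * (s - ρ))‖ ≤ ‖s‖ * (1 + ‖s - 1‖ / (s.re - 1)) * ‖1 / (ρ * (1 - ρ))‖ := by
  have h0 := norm_pos_iff.2 (xiFun_zero_ne h)
  have h1 := norm_pos_iff.2 (xiFun_zero_one_sub_ne h)
  have h2 := norm_sub_zero_pos (s := s) h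
  have hs' : 0 < s.re - 1 := by linarith
  have h3 : 0 < ‖s - ρ‖ := by linarith
  have h4 : ‖1 - ρ‖ ≤ ‖s - ρ‖ * (1 + ‖s - 1‖ / (s.re - 1)) := by
    calc ‖1 - ρ‖ = ‖(s - ρ) - (s - 1)‖ := by congr 1; ring
      _ ≤ ‖s - ρ‖ + ‖s - 1‖ := norm_sub_le _ _
      _ = ‖s - ρ‖ + (s.re - 1) * (‖s - 1‖ / (s.re - 1)) := by field_simp
      _ ≤ ‖s - ρ‖ + ‖s - ρ‖ * (‖s - 1‖ / (s.re - 1)) := by gcongr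
      _ = _ := by ring
  rw [norm_div, norm_mul, norm_div, norm_mul, norm_one, mul_one_div,
      div_le_div_iff₀ (by positivity) (by positivity)]
  calc ‖s‖ * (‖ρ‖ * ‖1 - ρ‖) ≤ ‖s‖ * (‖ρ‖ * (‖s - ρ‖ * (1 + ‖s - 1‖ / (s.re - 1)))) := by gcongr
    _ = _ := by ring

theorem summable_norm_xiTerm {s : ℂ} (hs : 1 < s.re) :
    Summable fun ρ : ℂ => ‖(xiMult ρ : ℂ) * (1 / (s - ρ) + 1 / ρ)‖ := by
  refine Summable.of_nonneg_of_le (fun ρ => norm_nonneg _) (fun ρ => ?_)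
    (summable_norm_one_div_mul.mul_left (‖s‖ * (1 + ‖s - 1‖ / (s.re - 1))))
  by_cases h : xiFun ρ = 0
  · rw [one_div_sub_add_eq hs h, norm_mul, Complex.norm_natCast, mul_left_comm]
    exact mul_le_mul_of_nonneg_left (norm_div_le_of_zero hs h) (Nat.cast_nonneg _)
  · simp [xiMult_eq_zero_of_ne h]

/-- Partial fractions for `ξ'/ξ` right of the critical strip. -/
theorem hasSum_logDeriv_xiFun {s : ℂ} (hs : 1 < s.re) :
    HasSum (fun ρ : ℂ => (xiMult ρ : ℂ) * (1 / (s - ρ) + 1 / ρ)) (logDeriv xiFun s + xiConst) := by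
  have h1 := tendsto_sum_zerosInDisc (summable_norm_xiTerm hs)
    (fun ρ h => by simp [xiMult_eq_zero_of_ne h])
  have h2 := tendsto_logDeriv_xiFun (xiFun_ne_zero_of_one_le_re hs.le)
  rw [tendsto_nhds_unique h2 h1]
  exact (summable_norm_xiTerm hs).of_norm.hasSum

theorem hasSum_re_logDeriv_xiFun {s : ℂ} (hs : 1 < s.re) :
    HasSum (fun ρ : ℂ => (xiMult ρ : ℝ) * (1 / (s - ρ)).re) (logDeriv xiFun s).re := by
  have h1 := (Complex.hasSum_re (hasSum_logDeriv_xiFun hs)).sub hasSum_re_one_div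
  rw [Complex.add_re, Complex.ofReal_re, add_sub_cancel_right] at h1
  refine h1.congr_fun fun ρ => ?_
  rw [← Complex.ofReal_natCast, Complex.re_ofReal_mul, Complex.add_re]
  ring

theorem hasDerivAt_log_Gamma {x : ℝ} (hx : 0 < x) :
    HasDerivAt (Real.log ∘ Real.Gamma) (Complex.digamma x).re x ∧ (Complex.digamma x).im = 0 := by
  have hd : DifferentiableAt ℂ Complex.Gamma x := by
    refine Complex.differentiableAt_Gamma _ fun m h => ?_
    have := congrArg Complex.re h
    simp at this
    have hm : (0 : ℝ) ≤ m := Nat.cast_nonneg m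
    linarith
  have h1 : HasDerivAt Real.Gamma (deriv Complex.Gamma x).re x := by
    have := hd.hasDerivAt.real_of_complex
    simpa only [Complex.Gamma_ofReal, Complex.ofReal_re] using this
  have h2 : deriv Complex.Gamma x = ((deriv Complex.Gamma x).re : ℂ) := by
    have e1 := hd.hasDerivAt.comp_ofReal
    have e2 := h1.ofReal_comp
    refine e1.unique (e2.congr_of_eventuallyEq (Filter.Eventually.of_forall fun y => ?_))
    exact Complex.Gamma_ofReal y
  have hG : 0 < Real.Gamma x := Real.Gamma_pos_of_pos hx
  have h3 : Complex.digamma x = (((deriv Complex.Gamma x).re / Real.Gamma x : ℝ) : ℂ) := by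
    rw [Complex.digamma_def, logDeriv_apply, h2, Complex.Gamma_ofReal]
    push_cast
    simp
  rw [h3, Complex.ofReal_re, Complex.ofReal_im]
  exact ⟨h1.log hG.ne', rfl⟩

theorem log_Gamma_slope {x : ℝ} (hx : 0 < x) :
    slope (Real.log ∘ Real.Gamma) x (x + 1) = Real.log x := by
  have hG : 0 < Real.Gamma x := Real.Gamma_pos_of_pos hx
  rw [slope_def_field]
  simp only [Function.comp_apply]
  rw [Real.Gamma_add_one hx.ne', Real.log_mul hx.ne' hG.ne']
  ring

theorem re_digamma_le_log {x : ℝ} (hx : 0 < x) : (Complex.digamma x).re ≤ Real.log x := by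
  rw [← log_Gamma_slope hx]
  exact Real.convexOn_log_Gamma.le_slope_of_hasDerivAt (Set.mem_Ioi.2 hx)
    (Set.mem_Ioi.2 (by linarith)) (by linarith) (hasDerivAt_log_Gamma hx).1

theorem log_le_re_digamma_add_one {x : ℝ} (hx : 0 < x) :
    Real.log x ≤ (Complex.digamma (x + 1 : ℝ)).re := by
  rw [← log_Gamma_slope hx]
  exact Real.convexOn_log_Gamma.slope_le_of_hasDerivAt (Set.mem_Ioi.2 hx)
    (Set.mem_Ioi.2 (by linarith)) (by linarith) (hasDerivAt_log_Gamma (by linarith)).1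

theorem digamma_add_natCast {z : ℂ} (hz : 0 < z.re) (N : ℕ) :
    Complex.digamma (z + N) = Complex.digamma z + ∑ n ∈ Finset.range N, 1 / (z + n) := by
  induction N with
  | zero => simp
  | succ N ih =>
    rw [Finset.sum_range_succ, ← add_assoc, ← ih, Nat.cast_succ, ← add_assoc,
      Complex.digamma_apply_add_one]
    · rw [one_div]
    · intro m h
      have := congrArg Complex.re h
      simp at this
      have hm : (0 : ℝ) ≤ m := Nat.cast_nonneg m
      have hN : (0 : ℝ) ≤ N := Nat.cast_nonneg N
      linarith

/-- The summand of the digamma series. -/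
noncomputable def digammaTerm (z : ℂ) (n : ℕ) : ℂ := 1 / ((n : ℂ) + 1) - 1 / (z + n)

theorem norm_digammaTerm_le {z : ℂ} (hz : 1 ≤ z.re) (n : ℕ) :
    ‖digammaTerm z n‖ ≤ (‖z‖ + 1) * (1 / ((n : ℝ) + 1) ^ 2) := by
  have hn : (0 : ℝ) < (n : ℝ) + 1 := by positivity
  have h1 : (n : ℝ) + 1 ≤ ‖z + n‖ := by
    have := Complex.re_le_norm (z + n)
    simp at this
    linarith
  have h2 : ‖(n : ℂ) + 1‖ = n + 1 := by
    rw [show (n : ℂ) + 1 = ((n + 1 : ℕ) : ℂ) by push_cast; ring, Complex.norm_natCast]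
    push_cast
    ring
  have h3 : z + n ≠ 0 := norm_pos_iff.1 (by linarith)
  have h4 : (n : ℂ) + 1 ≠ 0 := norm_pos_iff.1 (by linarith)
  have e : digammaTerm z n = (z - 1) / (((n : ℂ) + 1) * (z + n)) := by
    unfold digammaTerm; field_simp; ring
  rw [e, norm_div, norm_mul, h2, mul_one_div]
  have h5 : ‖z - 1‖ ≤ ‖z‖ + 1 := (norm_sub_le _ _).trans (by simp)
  gcongr
  nlinarith

theorem summable_one_div_add_one_sq : Summable fun n : ℕ => 1 / ((n : ℝ) + 1) ^ 2 := by
  have := (summable_nat_add_iff 1).2 (Real.summable_one_div_nat_pow.2 (one_lt_two))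
  simpa using this

theorem summable_norm_digammaTerm {z : ℂ} (hz : 1 ≤ z.re) : Summable fun n => ‖digammaTerm z n‖ :=
  Summable.of_nonneg_of_le (fun _ => norm_nonneg _) (norm_digammaTerm_le hz)
    (summable_one_div_add_one_sq.mul_left _)

theorem sum_digammaTerm (z : ℂ) (N : ℕ) :
    ∑ n ∈ Finset.range N, digammaTerm z n =
      (harmonic N : ℂ) - ∑ n ∈ Finset.range N, 1 / (z + n) := by
  simp only [digammaTerm, Finset.sum_sub_distrib]
  congr 1
  simp [harmonic]

theorem digamma_ofReal_eq_tsum {x : ℝ} (hx : 1 ≤ x) :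
    Complex.digamma x = -eulerMascheroniConstant + ∑' n, digammaTerm x n := by
  have hx0 : 0 < x := by linarith
  have h1 := (summable_norm_digammaTerm (z := x) (by simpa using hx)).of_norm.hasSum.tendsto_sum_nat
  have h2 : Filter.Tendsto (fun N : ℕ => (Complex.digamma ((x + N : ℝ) : ℂ)).re - Real.log N)
      Filter.atTop (nhds 0) := by
    have hu : Filter.Tendsto (fun N : ℕ => Real.log (x + N) - Real.log N)
        Filter.atTop (nhds 0) := by
      have := (((tendsto_one_div_atTop_nhds_zero_nat (𝕜 := ℝ)).const_mul x).const_add 1).log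
        (by norm_num)
      simp only [mul_zero, add_zero, Real.log_one] at this
      refine this.congr' ?_
      filter_upwards [Filter.eventually_gt_atTop 0] with N hN
      have hN' : (0 : ℝ) < N := by exact_mod_cast hN
      rw [← Real.log_div (by positivity) (by positivity)]
      congr 1
      field_simp
      ring
    refine tendsto_of_tendsto_of_tendsto_of_le_of_le' tendsto_const_nhds hu ?_ ?_
    · filter_upwards [Filter.eventually_gt_atTop 0] with N hN
      have hN' : (0 : ℝ) < N := by exact_mod_cast hN
      have h3 := log_le_re_digamma_add_one (x := x + N - 1) (by linarith)
      rw [sub_add_cancel] at h3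
      have h4 : Real.log N ≤ Real.log (x + N - 1) := Real.log_le_log hN' (by linarith)
      linarith
    · filter_upwards with N
      have := re_digamma_le_log (x := x + N) (by positivity)
      linarith
  have h3 : Filter.Tendsto (fun N : ℕ => ((harmonic N : ℝ) - Real.log N) +
      (((Complex.digamma ((x + N : ℝ) : ℂ)).re - Real.log N) * (-1))) Filter.atTop
      (nhds (eulerMascheroniConstant + 0 * (-1))) :=
    tendsto_harmonic_sub_log.add (h2.mul_const _)
  have h4 : ∀ N : ℕ, ((harmonic N : ℝ) - Real.log N) +
      (((Complex.digamma ((x + N : ℝ) : ℂ)).re - Real.log N) * (-1)) =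
      (∑ n ∈ Finset.range N, digammaTerm x n).re - (Complex.digamma x).re := by
    intro N
    rw [sum_digammaTerm, Complex.ofReal_add, Complex.ofReal_natCast,
      digamma_add_natCast (by simpa using hx0), Complex.add_re, Complex.sub_re, Complex.ratCast_re]
    ring
  simp_rw [h4] at h3
  have h5 := ((Complex.continuous_re.tendsto _).comp h1).sub_const (Complex.digamma x).re
  have h6 := tendsto_nhds_unique h3 h5
  have him : (∑' n, digammaTerm x n).im = 0 := by
    rw [Complex.im_tsum (summable_norm_digammaTerm (by simpa using hx)).of_norm]
    refine (tsum_congr fun n => ?_).trans tsum_zero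
    have : digammaTerm x n = ((1 / ((n : ℝ) + 1) - 1 / (x + n) : ℝ) : ℂ) := by
      simp [digammaTerm]
    rw [this, Complex.ofReal_im]
  apply Complex.ext
  · simp; linarith
  · simp [him, (hasDerivAt_log_Gamma hx0).2]

open Filter Topology in
/-- The series for the digamma function. -/
theorem digamma_eq_tsum {z : ℂ} (hz : 1 < z.re) :
    Complex.digamma z = -eulerMascheroniConstant + ∑' n, digammaTerm z n := by
  set U : Set ℂ := {w : ℂ | 1 < w.re} ∩ Metric.ball 0 (‖z‖ + 3) with hU
  have hopen : IsOpen U :=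
    (isOpen_lt continuous_const Complex.continuous_re).inter Metric.isOpen_ball
  have hconv : Convex ℝ U := (convex_halfSpace_re_gt 1).inter (convex_ball 0 _)
  have hterm : DifferentiableOn ℂ (fun w => ∑' n, digammaTerm w n) U := by
    refine Complex.differentiableOn_tsum_of_summable_norm
      (u := fun n => (‖z‖ + 3 + 1) * (1 / ((n : ℝ) + 1) ^ 2))
      (summable_one_div_add_one_sq.mul_left _) (fun n w hw => ?_) hopen (fun n w hw => ?_)
    · have hw1 : 1 < w.re := hw.1
      have : w + n ≠ 0 := by
        intro h
        have := congrArg Complex.re h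
        simp at this
        have hm : (0 : ℝ) ≤ n := Nat.cast_nonneg n
        linarith
      unfold digammaTerm
      refine DifferentiableAt.differentiableWithinAt ?_
      exact (differentiableAt_const _).sub ((differentiableAt_const _).div (by fun_prop) this)
    · refine (norm_digammaTerm_le (le_of_lt hw.1) n).trans ?_
      have : ‖w‖ < ‖z‖ + 3 := by simpa using hw.2
      gcongr
  have hdig : DifferentiableOn ℂ Complex.digamma U := by
    have hG : DifferentiableOn ℂ Complex.Gamma U := fun w hw => by
      refine (Complex.differentiableAt_Gamma _ fun m h => ?_).differentiableWithinAt
      have hw1 : 1 < w.re := hw.1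
      have := congrArg Complex.re h
      simp at this
      have hm : (0 : ℝ) ≤ m := Nat.cast_nonneg m
      linarith
    exact (hG.deriv hopen).div hG fun w hw =>
      Complex.Gamma_ne_zero_of_re_pos (lt_trans zero_lt_one hw.1)
  have hf := hdig.analyticOnNhd hopen
  have hg := ((differentiableOn_const
    (-(eulerMascheroniConstant : ℂ))).add hterm).analyticOnNhd hopen
  have h2U : (2 : ℂ) ∈ U := ⟨by simp, by simp; linarith [norm_nonneg z]⟩
  refine hf.eqOn_of_preconnected_of_frequently_eq hg hconv.isPreconnected h2U ?_
    (show z ∈ U from ⟨hz, by simp⟩)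
  have ht : Tendsto (fun n : ℕ => ((2 + 1 / ((n : ℝ) + 1) : ℝ) : ℂ)) atTop (𝓝[≠] 2) := by
    refine tendsto_nhdsWithin_iff.2 ⟨?_, Eventually.of_forall fun n => ?_⟩
    · have := ((tendsto_one_div_add_atTop_nhds_zero_nat (𝕜 := ℝ)).const_add 2)
      have h := (Complex.continuous_ofReal.tendsto _).comp this
      simpa [Function.comp_def] using h
    · have hn : (0 : ℝ) < 1 / ((n : ℝ) + 1) := by positivity
      intro h
      have := congrArg Complex.re (Set.mem_singleton_iff.1 h)
      rw [Complex.ofReal_re] at this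
      simp at this
      simp at hn
      linarith
  refine ht.frequently (Frequently.of_forall fun n => ?_)
  exact digamma_ofReal_eq_tsum (by have : (0 : ℝ) < 1 / ((n : ℝ) + 1) := by positivity
                                   linarith)

theorem one_div_re_ge {w : ℂ} (hw : 0 < w.re) :
    Real.log ‖w + 1‖ - Real.log ‖w‖ - 1 / (2 * ‖w‖ ^ 2) ≤ (1 / w).re := by
  have hw0 : w ≠ 0 := by rintro rfl; simp at hw
  have h1 : 0 < ‖w‖ := norm_pos_iff.2 hw0
  have h2 : 0 < ‖w + 1‖ := norm_pos_iff.2 fun h => by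
    have := congrArg Complex.re h; simp at this; linarith
  have e : (‖w + 1‖ / ‖w‖) ^ 2 = 1 + 2 * (1 / w).re + 1 / ‖w‖ ^ 2 := by
    rw [one_div w, Complex.inv_re, div_pow, ← Complex.normSq_eq_norm_sq,
        ← Complex.normSq_eq_norm_sq]
    have : Complex.normSq w ≠ 0 := (Complex.normSq_pos.2 hw0).ne'
    field_simp
    simp [Complex.normSq_apply]; ring
  have h3 := Real.log_le_sub_one_of_pos (show 0 < (‖w + 1‖ / ‖w‖) ^ 2 by positivity)
  rw [e, ← e, Real.log_pow, Real.log_div h2.ne' h1.ne', e] at h3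
  have e2 : 1 / (2 * ‖w‖ ^ 2) = (1 / ‖w‖ ^ 2) / 2 := by field_simp
  rw [e2]
  push_cast at h3
  linarith

theorem re_digamma_le {z : ℂ} (hz : 3 / 2 ≤ z.re) :
    (Complex.digamma z).re ≤ Real.log ‖z‖ + 1 / 2 := by
  have hpart : ∀ N : ℕ, Real.log ‖z + N‖ - Real.log ‖z‖ - (1 - 1 / ((N : ℝ) + 1)) / 2 ≤
      (∑ n ∈ Finset.range N, 1 / (z + n)).re := by
    intro N
    induction N with
    | zero => simp
    | succ N ih =>
      rw [Finset.sum_range_succ, Complex.add_re]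
      have hN : (0 : ℝ) ≤ N := Nat.cast_nonneg N
      have hre : 3 / 2 + (N : ℝ) ≤ (z + N).re := by simp; linarith
      have h1 := one_div_re_ge (w := z + N) (by linarith)
      have h2 : 1 / (2 * ‖z + N‖ ^ 2) ≤ (1 / ((N : ℝ) + 1) - 1 / ((N : ℝ) + 1 + 1)) / 2 := by
        have h3 : 3 / 2 + (N : ℝ) ≤ ‖z + N‖ := hre.trans (Complex.re_le_norm _)
        have e : (1 / ((N : ℝ) + 1) - 1 / ((N : ℝ) + 1 + 1)) / 2 =
            1 / (2 * (((N : ℝ) + 1) * (N + 1 + 1))) := by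
          field_simp; ring
        rw [e]
        have : ((N : ℝ) + 1) * (N + 1 + 1) ≤ ‖z + N‖ ^ 2 := by nlinarith
        gcongr
      push_cast
      rw [← add_assoc]
      linarith
  have hz1 : 1 < z.re := by linarith
  have h1 := (summable_norm_digammaTerm hz1.le).of_norm.hasSum.tendsto_sum_nat
  have h2 := (Complex.continuous_re.tendsto _).comp h1
  have h3 : (∑' n, digammaTerm z n).re ≤ eulerMascheroniConstant + (Real.log ‖z‖ + 1 / 2) := by
    have hz0 : 0 < ‖z‖ := (by linarith : 0 < z.re).trans_le (Complex.re_le_norm z)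
    refine le_of_tendsto_of_tendsto h2 (tendsto_harmonic_sub_log.add_const (Real.log ‖z‖ + 1 / 2))
        ?_
    filter_upwards [Filter.eventually_gt_atTop 0] with N hN
    have hN' : (0 : ℝ) < N := by exact_mod_cast hN
    simp only [Function.comp_apply, sum_digammaTerm, Complex.sub_re, Complex.ratCast_re]
    have h4 : Real.log N ≤ Real.log ‖z + N‖ := by
      refine Real.log_le_log hN' (le_trans ?_ (Complex.re_le_norm _))
      simp; linarith
    have h5 : (0 : ℝ) ≤ 1 / ((N : ℝ) + 1) := by positivity
    have := hpart N
    linarith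
  rw [digamma_eq_tsum hz1]
  simp
  linarith

/-- The Dirichlet series of the von Mangoldt function. -/
noncomputable def mangoldtSeries (s : ℂ) : ℂ :=
  LSeries (fun n => (ArithmeticFunction.vonMangoldt n : ℂ)) s

theorem logDeriv_Gammaℝ {s : ℂ} (hs : 0 < s.re) :
    logDeriv Complex.Gammaℝ s = -(1 / 2) * Real.log π + 1 / 2 * Complex.digamma (s / 2) := by
  have hs2 : 0 < (s / 2).re := by simpa using hs
  have hdG : HasDerivAt (fun z => Complex.Gamma (z / 2)) (deriv Complex.Gamma (s / 2) * (1 / 2))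
      s := by
    have h1 : HasDerivAt Complex.Gamma (deriv Complex.Gamma (s / 2)) (s / 2) :=
      (Complex.differentiableAt_Gamma _ (fun m h => by
        rw [h] at hs2; simp at hs2; linarith [(Nat.cast_nonneg m : (0:ℝ) ≤ m)])).hasDerivAt
    exact h1.comp s ((hasDerivAt_id s).div_const 2)
  have hpi : (π : ℂ) ≠ 0 := by exact_mod_cast Real.pi_ne_zero
  have hdp : HasDerivAt (fun z : ℂ => (π : ℂ) ^ (-z / 2))
      ((π : ℂ) ^ (-s / 2) * Complex.log π * (-1 / 2)) s :=
    (((hasDerivAt_id s).neg).div_const 2).const_cpow (Or.inl hpi)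
  have h := (hdp.mul hdG).deriv
  have he : Complex.Gammaℝ =
      (fun z : ℂ => (π : ℂ) ^ (-z / 2)) * fun z => Complex.Gamma (z / 2) := by
    ext z; simp [Complex.Gammaℝ_def]
  rw [logDeriv_apply, he, h, Complex.digamma, logDeriv_apply, Complex.ofReal_log pi_pos.le]
  have h1 : (π : ℂ) ^ (-s / 2) ≠ 0 := by simp [Complex.cpow_eq_zero_iff, hpi]
  have h2 := Complex.Gamma_ne_zero_of_re_pos hs2
  simp only [Pi.mul_apply]
  field_simp

theorem mangoldtSeries_eq {s : ℂ} (hs : 1 < s.re) :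
    mangoldtSeries s = 1 / (s - 1) - 1 / 2 * Real.log π + 1 / 2 * Complex.digamma (s / 2 + 1)
      - logDeriv xiFun s := by
  have hs1 : s ≠ 1 := by rintro rfl; simp at hs
  have hs0 : s ≠ 0 := by rintro rfl; norm_num at hs
  have hs10 : s - 1 ≠ 0 := sub_ne_zero.2 hs1
  have hz := riemannZeta_ne_zero_of_one_lt_re hs
  have hpos : 0 < s.re := by linarith
  have hG := Complex.Gammaℝ_ne_zero_of_re_pos hpos
  have hev : xiFun =ᶠ[nhds s] fun z => (z * (z - 1)) * (Complex.Gammaℝ z * riemannZeta z) := by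
    have ho : {z : ℂ | 1 < z.re} ∈ nhds s :=
      (isOpen_lt continuous_const Complex.continuous_re).mem_nhds hs
    filter_upwards [ho] with z hz
    exact xiFun_eq_mul_riemannZeta (by linarith) (by rintro rfl; simp at hz)
  have hdG : DifferentiableAt ℂ Complex.Gammaℝ s := by
    by_contra hc
    have h0 := logDeriv_eq_zero_of_not_differentiableAt _ _ hc
    have hinv := Complex.differentiable_Gammaℝ_inv s
    have := (hinv.fun_inv (inv_ne_zero hG))
    simp only [inv_inv] at this
    exact hc this
  have hdz := differentiableAt_riemannZeta hs1
  have hl : logDeriv xiFun s =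
      1 / s + 1 / (s - 1) + (logDeriv Complex.Gammaℝ s + logDeriv riemannZeta s) := by
    rw [(logDeriv_congr_nhds hev).self_of_nhds]
    rw [logDeriv_mul (f := fun z => z * (z - 1)) (g := fun z => Complex.Gammaℝ z * riemannZeta z)
      s (mul_ne_zero hs0 hs10) (mul_ne_zero hG hz) (by fun_prop) (hdG.mul hdz),
      logDeriv_mul (f := fun z => z) (g := fun z => z - 1) s hs0 hs10 (by fun_prop) (by fun_prop),
      logDeriv_mul (f := Complex.Gammaℝ) (g := riemannZeta) s hG hz hdG hdz]
    simp [logDeriv_apply]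
  have hψ := Complex.digamma_apply_add_one (s / 2) (fun m h => by
    have h2 : (s / 2).re = -(m : ℝ) := by rw [h]; simp
    have h3 : (s / 2).re = s.re / 2 := by simp
    linarith [(Nat.cast_nonneg m : (0:ℝ) ≤ m)])
  have hL : mangoldtSeries s = - logDeriv riemannZeta s := by
    rw [mangoldtSeries, ArithmeticFunction.LSeries_vonMangoldt_eq_deriv_riemannZeta_div hs,
      logDeriv_apply, neg_div]
  rw [hL, hl, logDeriv_Gammaℝ hpos, hψ]
  field_simp
  ring

theorem hasSum_re_mangoldtSeries {σ : ℝ} (hσ : 1 < σ) (t : ℝ) :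
    HasSum (fun n : ℕ => ArithmeticFunction.vonMangoldt n * (n : ℝ) ^ (-σ) * cos (t * log n))
      (mangoldtSeries (σ + t * Complex.I)).re := by
  have hs : 1 < ((σ : ℂ) + t * Complex.I).re := by simpa using hσ
  have h2 := Complex.hasSum_re (ArithmeticFunction.LSeriesSummable_vonMangoldt hs).hasSum
  refine HasSum.congr_fun (g := fun n : ℕ => _) h2 fun n => ?_
  rcases Nat.eq_zero_or_pos n with rfl | hn
  · simp
  have hn' : (0 : ℝ) < n := by exact_mod_cast hn
  rw [LSeries.term_of_ne_zero hn.ne', div_eq_mul_inv, ← Complex.cpow_neg, Complex.re_ofReal_mul,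
    mul_assoc, Complex.cpow_def_of_ne_zero (by exact_mod_cast hn.ne'), ← Complex.natCast_log,
    Complex.exp_re, rpow_def_of_pos hn']
  simp [-Complex.natCast_log, mul_comm]

theorem re_mangoldtSeries_nonneg {σ : ℝ} (hσ : 1 < σ) : 0 ≤ (mangoldtSeries σ).re := by
  have h := hasSum_re_mangoldtSeries hσ 0
  simp only [Complex.ofReal_zero, zero_mul, add_zero, cos_zero, mul_one] at h
  exact h.nonneg fun n => mul_nonneg ArithmeticFunction.vonMangoldt_nonneg (by positivity)

theorem trig_mangoldtSeries_nonneg {σ : ℝ} (hσ : 1 < σ) (t : ℝ) :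
    0 ≤ 5 * (mangoldtSeries σ).re + 8 * (mangoldtSeries (σ + t * Complex.I)).re
      + 4 * (mangoldtSeries (σ + ((2 * t : ℝ) : ℂ) * Complex.I)).re
      + (mangoldtSeries (σ + ((3 * t : ℝ) : ℂ) * Complex.I)).re := by
  have h0 := hasSum_re_mangoldtSeries hσ 0
  simp only [Complex.ofReal_zero, zero_mul, add_zero, cos_zero, mul_one] at h0
  have h := (((h0.mul_left 5).add ((hasSum_re_mangoldtSeries hσ t).mul_left 8)).add
    ((hasSum_re_mangoldtSeries hσ (2 * t)).mul_left 4)).add (hasSum_re_mangoldtSeries hσ (3 * t))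
  refine h.nonneg fun n => ?_
  have hA : 0 ≤ ArithmeticFunction.vonMangoldt n * (n : ℝ) ^ (-σ) :=
    mul_nonneg ArithmeticFunction.vonMangoldt_nonneg (by positivity)
  rw [mul_assoc 2 t, mul_assoc 3 t, cos_two_mul, cos_three_mul]
  set c := cos (t * log n)
  have hc : -1 ≤ c := neg_one_le_cos _
  have := mul_nonneg hA (mul_nonneg (by linarith : 0 ≤ 1 + c) (sq_nonneg (1 + 2 * c)))
  linarith

theorem re_logDeriv_xiFun_ge {s ρ : ℂ} (hs : 1 < s.re) (h : xiFun ρ = 0) :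
    (1 / (s - ρ)).re ≤ (logDeriv xiFun s).re := by
  have hnn : ∀ ρ, xiFun ρ = 0 → 0 ≤ (1 / (s - ρ)).re := fun ρ h =>
    (one_div_re_pos (by have := re_lt_one_of_xiFun_eq_zero h; simp; linarith)).le
  have h1 := le_hasSum (hasSum_re_logDeriv_xiFun hs) ρ fun ρ' _ => xiMult_mul_nonneg hnn ρ'
  nlinarith [hnn ρ h, one_le_xiMult h]

theorem re_logDeriv_xiFun_nonneg {s : ℂ} (hs : 1 < s.re) : 0 ≤ (logDeriv xiFun s).re :=
  (hasSum_re_logDeriv_xiFun hs).nonneg fun ρ => xiMult_mul_nonneg (fun ρ h =>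
    (one_div_re_pos (by have := re_lt_one_of_xiFun_eq_zero h; simp; linarith)).le) ρ

theorem log_pi_gt_one : 1 < log π := by
  rw [lt_log_iff_exp_lt pi_pos]
  linarith [exp_one_lt_d9, pi_gt_three]

theorem re_mangoldtSeries_ofReal {σ : ℝ} (hσ : 1 < σ) :
    (mangoldtSeries σ).re ≤ 1 / (σ - 1) - 1 / 2 * log π + 1 / 2 * log (σ / 2 + 1)
      - (logDeriv xiFun σ).re := by
  have hs : 1 < (σ : ℂ).re := by simpa
  have h := re_digamma_le_log (x := σ / 2 + 1) (by linarith)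
  rw [mangoldtSeries_eq hs]
  have e : (1 : ℂ) / (σ - 1) - 1 / 2 * Real.log π + 1 / 2 * Complex.digamma (σ / 2 + 1)
      - logDeriv xiFun σ = ((1 / (σ - 1) - 1 / 2 * log π : ℝ) : ℂ)
        + ((1 / 2 : ℝ) : ℂ) * Complex.digamma ((σ / 2 + 1 : ℝ) : ℂ) - logDeriv xiFun σ := by
    push_cast; ring
  rw [e, Complex.sub_re, Complex.add_re, Complex.ofReal_re, Complex.re_ofReal_mul]
  linarith

theorem re_mangoldtSeries_le {σ t : ℝ} (hσ : 1 < σ) (hσ' : σ ≤ 1.2) (ht : 6 ≤ |t|) :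
    (mangoldtSeries (σ + t * Complex.I)).re ≤ 1 / 2 * log |t| - 0.2
      - (logDeriv xiFun (σ + t * Complex.I)).re := by
  set s : ℂ := σ + t * Complex.I with hsdef
  have hre : s.re = σ := by simp [hsdef]
  have him : s.im = t := by simp [hsdef]
  have hs : 1 < s.re := by rw [hre]; exact hσ
  have ht2 : 36 ≤ t ^ 2 := by rw [← sq_abs]; nlinarith
  have h1 : (1 / (s - 1)).re ≤ 0.01 := by
    rw [one_div, Complex.inv_re, Complex.normSq_apply, Complex.sub_re, Complex.sub_im, hre, him,
      div_le_iff₀ (by simp; nlinarith)]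
    simp
    nlinarith
  have h2 : (Complex.digamma (s / 2 + 1)).re ≤ log |t| + 1 / 2 := by
    have hz : (s / 2 + 1).re = σ / 2 + 1 := by simp [hre]
    have hz' : (s / 2 + 1).im = t / 2 := by simp [him]
    refine (re_digamma_le (by rw [hz]; linarith)).trans ?_
    have hpos : 0 < ‖s / 2 + 1‖ := norm_pos_iff.2 (by
      intro h0; rw [h0] at hz; simp at hz; linarith)
    have : ‖s / 2 + 1‖ ≤ |t| := by
      rw [← abs_norm, ← sq_le_sq, ← Complex.normSq_eq_norm_sq, Complex.normSq_apply, hz, hz']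
      nlinarith
    linarith [log_le_log hpos this]
  have hlp := log_pi_gt_one
  rw [mangoldtSeries_eq hs]
  have e : (1 : ℂ) / (s - 1) - 1 / 2 * Real.log π + 1 / 2 * Complex.digamma (s / 2 + 1)
      - logDeriv xiFun s = 1 / (s - 1) - ((1 / 2 * log π : ℝ) : ℂ)
        + ((1 / 2 : ℝ) : ℂ) * Complex.digamma (s / 2 + 1) - logDeriv xiFun s := by
    push_cast; ring
  rw [e, Complex.sub_re, Complex.add_re, Complex.sub_re, Complex.ofReal_re, Complex.re_ofReal_mul]
  linarith

/-- A classical zero-free region. -/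
theorem one_sub_re_ge_of_zero {ρ : ℂ} (h : xiFun ρ = 0) : 0.05 / log |ρ.im| ≤ 1 - ρ.re := by
  set t := ρ.im with ht
  set L := log |t| with hL
  have h6 : 6 ≤ |t| := abs_im_ge_of_zero h
  have hL1 : 1.7 < L := by
    rw [hL, lt_log_iff_exp_lt (by linarith)]
    have : exp 1.7 ^ 10 < 6 ^ 10 := by
      rw [← exp_nat_mul]
      have : exp ((10 : ℕ) * (1.7 : ℝ)) = exp 1 ^ 17 := by rw [← exp_nat_mul]; norm_num
      rw [this]
      calc exp 1 ^ 17 ≤ 2.7182818286 ^ 17 := by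
            gcongr; exact exp_one_lt_d9.le
        _ < 6 ^ 10 := by norm_num
    exact (lt_of_pow_lt_pow_left₀ 10 (by norm_num) this).trans_le h6
  have hLpos : 0 < L := by linarith
  set d := 1 / (5 * L) with hd
  have hdpos : 0 < d := by positivity
  have hd' : d ≤ 0.2 := by
    rw [hd, div_le_iff₀ (by positivity)]; nlinarith
  have hσ : 1 < 1 + d := by linarith
  have hσ' : 1 + d ≤ 1.2 := by linarith
  have hβ := re_lt_one_of_xiFun_eq_zero h
  have i0 := re_mangoldtSeries_ofReal hσ
  have i0' := re_logDeriv_xiFun_nonneg (s := ((1 + d : ℝ) : ℂ)) (by simpa using hdpos)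
  have hlog : log ((1 + d) / 2 + 1) ≤ log π :=
    log_le_log (by linarith) (by linarith [pi_gt_three])
  have i1 := re_mangoldtSeries_le hσ hσ' h6
  have i1' := re_logDeriv_xiFun_ge (s := ((1 + d : ℝ) : ℂ) + t * Complex.I) (by simpa using hdpos) h
  have e1 : (1 / (((1 + d : ℝ) : ℂ) + t * Complex.I - ρ)).re = 1 / (1 + d - ρ.re) := by
    have : ((1 + d : ℝ) : ℂ) + t * Complex.I - ρ = ((1 + d - ρ.re : ℝ) : ℂ) := by
      apply Complex.ext <;> simp [ht]
    rw [this, ← Complex.ofReal_one, ← Complex.ofReal_div, Complex.ofReal_re]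
  rw [e1] at i1'
  have habs2 : |2 * t| = 2 * |t| := by rw [abs_mul]; simp
  have habs3 : |3 * t| = 3 * |t| := by rw [abs_mul]; simp
  have i2 := re_mangoldtSeries_le (t := 2 * t) hσ hσ' (by rw [habs2]; linarith)
  have i2' := re_logDeriv_xiFun_nonneg (s := ((1 + d : ℝ) : ℂ) + ((2 * t : ℝ) : ℂ) * Complex.I)
    (by simpa using hdpos)
  have i3 := re_mangoldtSeries_le (t := 3 * t) hσ hσ' (by rw [habs3]; linarith)
  have i3' := re_logDeriv_xiFun_nonneg (s := ((1 + d : ℝ) : ℂ) + ((3 * t : ℝ) : ℂ) * Complex.I)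
    (by simpa using hdpos)
  rw [habs2, log_mul (by norm_num) (by linarith)] at i2
  rw [habs3, log_mul (by norm_num) (by linarith)] at i3
  have hl2 := log_two_lt_d9
  have hl3 : log 3 < 1.4 := by
    have := log_lt_log (by norm_num : (0:ℝ) < 3) (by norm_num : (3:ℝ) < 2 ^ 2)
    rw [log_pow] at this; push_cast at this; linarith
  have htr := trig_mangoldtSeries_nonneg hσ t
  have hd5 : 1 / (1 + d - 1) = 5 * L := by rw [hd]; field_simp; ring
  rw [hd5] at i0
  have key : 8 * (1 / (1 + d - ρ.re)) ≤ 31.5 * L := by linarith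
  have hp : 0 < 1 + d - ρ.re := by linarith
  rw [mul_one_div, div_le_iff₀ hp] at key
  have hdL : d * L = 1 / 5 := by rw [hd]; field_simp
  rw [div_le_iff₀ hLpos]
  nlinarith

theorem log_le_sum_sq_div {x : ℝ} (hx : 0 < x) (K : ℕ) (hK : x ≤ 2 ^ K) :
    log x ≤ 2 * log 2 * ∑ k ∈ Finset.range K, x ^ 2 / (4 ^ k + x ^ 2) := by
  have hl2 := log_pos (by norm_num : (1:ℝ) < 2)
  induction K with
  | zero => simpa using log_nonpos hx.le (by simpa using hK)
  | succ K ih =>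
    by_cases h : x ≤ 2 ^ K
    · refine (ih h).trans ?_
      rw [Finset.sum_range_succ]
      gcongr
      linarith [show 0 ≤ x ^ 2 / (4 ^ K + x ^ 2) by positivity]
    · push Not at h
      have h1 : ∀ k ∈ Finset.range (K + 1), (1 : ℝ) / 2 ≤ x ^ 2 / (4 ^ k + x ^ 2) := by
        intro k hk
        have hk' : k ≤ K := by simpa [Nat.lt_succ_iff] using hk
        have : (4 : ℝ) ^ k ≤ x ^ 2 := by
          calc (4 : ℝ) ^ k = (2 ^ k) ^ 2 := by rw [← pow_mul, mul_comm, pow_mul]; norm_num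
            _ ≤ (2 ^ K) ^ 2 := by gcongr; norm_num
            _ ≤ x ^ 2 := by gcongr
        rw [div_le_div_iff₀ (by norm_num) (by positivity)]
        linarith
      have h2 := Finset.card_nsmul_le_sum _ _ _ h1
      have h3 := log_le_log hx hK
      rw [log_pow] at h3
      rw [Finset.card_range, nsmul_eq_mul] at h2
      nlinarith

theorem sum_range_linear_div_two_pow (A B : ℝ) (K : ℕ) :
    ∑ k ∈ Finset.range K, (A + B * k) / 2 ^ k
      = 2 * A + 2 * B - (2 * A + 2 * B * (K + 1)) / 2 ^ K := by
  induction K with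
  | zero => simp
  | succ K ih =>
    rw [Finset.sum_range_succ, ih]
    push_cast
    field_simp
    ring

theorem sum_xiMult_div_le (T : Finset ℂ) {σ : ℝ} (hσ : 1 < σ) :
    ∑ ρ ∈ T, (xiMult ρ : ℝ) * (1 / (σ ^ 2 + ρ.im ^ 2))
      ≤ (1 / (σ - 1) - 1 / 2 + 1 / 2 * log (σ / 2 + 1)) / (σ - 1) := by
  have hs : 1 < (σ : ℂ).re := by simpa
  have hF : (logDeriv xiFun σ).re ≤ 1 / (σ - 1) - 1 / 2 + 1 / 2 * log (σ / 2 + 1) := by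
    linarith [re_mangoldtSeries_ofReal hσ, re_mangoldtSeries_nonneg hσ, log_pi_gt_one]
  have hnn : ∀ ρ, xiFun ρ = 0 → 0 ≤ (1 / ((σ : ℂ) - ρ)).re := fun ρ h =>
    (one_div_re_pos (by have := re_lt_one_of_xiFun_eq_zero h; simp; linarith)).le
  have h1 := sum_le_hasSum T (fun ρ _ => xiMult_mul_nonneg hnn ρ) (hasSum_re_logDeriv_xiFun hs)
  rw [le_div_iff₀ (by linarith), Finset.sum_mul]
  refine (Finset.sum_le_sum fun ρ _ => ?_).trans (h1.trans hF)
  by_cases h : xiFun ρ = 0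
  · have hb := re_lt_one_of_xiFun_eq_zero h
    have hb0 := re_pos_of_xiFun_eq_zero h
    rw [mul_assoc]
    refine mul_le_mul_of_nonneg_left ?_ (Nat.cast_nonneg _)
    rw [one_div (_ - _), Complex.inv_re, Complex.normSq_apply]
    simp only [Complex.sub_re, Complex.sub_im, Complex.ofReal_re, Complex.ofReal_im]
    have hp : 0 < σ - ρ.re := by linarith
    rw [one_div_mul_eq_div]
    apply div_le_div₀ hp.le (by linarith) (by nlinarith [sq_nonneg ρ.im, mul_pos hp hp])
    nlinarith
  · simp [xiMult_eq_zero_of_ne h]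

theorem sum_log_mul_norm_le (T : Finset ℂ) :
    ∑ ρ ∈ T, (xiMult ρ : ℝ) * ‖1 / (ρ * (1 - ρ))‖ * log |ρ.im| ≤ 0.28 := by
  obtain ⟨K, hK⟩ : ∃ K : ℕ, ∀ ρ ∈ T, |ρ.im| / 32 ≤ 2 ^ K := by
    obtain ⟨K, hK⟩ := pow_unbounded_of_one_lt (∑ ρ ∈ T, |ρ.im| / 32) (one_lt_two (α := ℝ))
    exact ⟨K, fun ρ hρ => (Finset.single_le_sum (f := fun ρ : ℂ => |ρ.im| / 32)
      (fun _ _ => by positivity) hρ).trans hK.le⟩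
  have hl2 := log_two_gt_d9
  have hl2' := log_two_lt_d9
  have hρ : ∀ ρ ∈ T, (xiMult ρ : ℝ) * ‖1 / (ρ * (1 - ρ))‖ * log |ρ.im| ≤
      5 * log 2 * ((xiMult ρ : ℝ) * ‖1 / (ρ * (1 - ρ))‖) + 2 * log 2 *
        ∑ k ∈ Finset.range K, (xiMult ρ : ℝ) * (1 / ((32 * 2 ^ k) ^ 2 + ρ.im ^ 2)) := by
    intro ρ hρT
    by_cases h : xiFun ρ = 0
    · have h6 := abs_im_ge_of_zero h
      have hb := re_lt_one_of_xiFun_eq_zero h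
      have hb0 := re_pos_of_xiFun_eq_zero h
      have hl := log_le_sum_sq_div (x := |ρ.im| / 32) (by positivity) K (hK ρ hρT)
      have h32 : log 32 = 5 * log 2 := by
        rw [show (32 : ℝ) = 2 ^ 5 by norm_num, log_pow]; norm_num
      rw [log_div (by positivity) (by norm_num), h32] at hl
      have hN : ‖1 / (ρ * (1 - ρ))‖ ≤ 1 / ρ.im ^ 2 := by
        have hi : 0 < ρ.im ^ 2 := by rw [← sq_abs]; positivity
        rw [norm_div, norm_one]
        apply one_div_le_one_div_of_le hi
        refine le_trans ?_ ((le_abs_self _).trans (Complex.abs_re_le_norm _))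
        rw [mul_one_sub_re]
        nlinarith
      have hi : 0 < ρ.im ^ 2 := by rw [← sq_abs]; positivity
      have hi0 : ρ.im ≠ 0 := by rintro h0; rw [h0] at hi; norm_num at hi
      set S := ∑ k ∈ Finset.range K, (|ρ.im| / 32) ^ 2 / (4 ^ k + (|ρ.im| / 32) ^ 2) with hS
      have hS0 : 0 ≤ S := Finset.sum_nonneg fun k _ => by positivity
      have e : ∑ k ∈ Finset.range K, (xiMult ρ : ℝ) * (1 / ((32 * 2 ^ k) ^ 2 + ρ.im ^ 2))
          = xiMult ρ * (1 / ρ.im ^ 2 * S) := by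
        rw [hS, Finset.mul_sum, Finset.mul_sum]
        refine Finset.sum_congr rfl fun k _ => ?_
        rw [div_pow, sq_abs, mul_pow, ← pow_mul, mul_comm k 2, pow_mul]
        norm_num
        field_simp
        simp
      rw [e]
      have hm : (0 : ℝ) ≤ xiMult ρ := Nat.cast_nonneg _
      have n0 := norm_nonneg (1 / (ρ * (1 - ρ)))
      set N := ‖1 / (ρ * (1 - ρ))‖
      calc (xiMult ρ : ℝ) * N * log |ρ.im| ≤ xiMult ρ * N * (5 * log 2 + 2 * log 2 * S) := by
            gcongr; linarith
        _ = 5 * log 2 * (xiMult ρ * N) + 2 * log 2 * (xiMult ρ * (N * S)) := by ring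
        _ ≤ _ := by gcongr
    · simp [xiMult_eq_zero_of_ne h]
  refine (Finset.sum_le_sum hρ).trans ?_
  rw [Finset.sum_add_distrib, ← Finset.mul_sum, ← Finset.mul_sum, Finset.sum_comm]
  have h1 : ∑ ρ ∈ T, (xiMult ρ : ℝ) * ‖1 / (ρ * (1 - ρ))‖ ≤ 0.0471 :=
    (summable_norm_one_div_mul.sum_le_tsum T fun _ _ => by positivity).trans
      tsum_norm_one_div_mul_le
  have h17 : log 17 ≤ 4.1 * log 2 := by
    have := log_le_of_le_two_pow (x := 17) (a := 41) (b := 10) (by norm_num) (by norm_num)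
      (by norm_num)
    norm_num at this ⊢
    linarith
  have h2 : ∑ k ∈ Finset.range K, ∑ ρ ∈ T, (xiMult ρ : ℝ) * (1 / ((32 * 2 ^ k) ^ 2 + ρ.im ^ 2))
      ≤ ∑ k ∈ Finset.range K, (0.954 / 31 + 0.347 / 31 * (k : ℝ)) / 2 ^ k := by
    refine Finset.sum_le_sum fun k _ => ?_
    have hk1 : (1 : ℝ) ≤ 2 ^ k := one_le_pow₀ (by norm_num)
    have hk31 : 31 * 2 ^ k ≤ (32 * 2 ^ k - 1 : ℝ) := by linarith
    refine (sum_xiMult_div_le T (σ := 32 * 2 ^ k) (by linarith)).trans ?_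
    have hlog : log (32 * 2 ^ k / 2 + 1) ≤ log 17 + k * log 2 := by
      rw [← log_pow, ← log_mul (by norm_num) (by positivity)]
      exact log_le_log (by positivity) (by linarith)
    have hinv : 1 / (32 * 2 ^ k - 1 : ℝ) ≤ 1 / 31 := by
      apply one_div_le_one_div_of_le (by norm_num); linarith
    have hk0 : (0 : ℝ) ≤ k := Nat.cast_nonneg _
    calc _ ≤ (0.954 + 0.347 * k) / (32 * 2 ^ k - 1 : ℝ) := by
          apply div_le_div_of_nonneg_right _ (by linarith)
          nlinarith
      _ ≤ (0.954 + 0.347 * k) / (31 * 2 ^ k : ℝ) := by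
          gcongr
      _ = _ := by field_simp
  rw [sum_range_linear_div_two_pow] at h2
  have h3 : 0 ≤ (2 * (0.954 / 31) + 2 * (0.347 / 31) * ((K : ℝ) + 1)) / 2 ^ K := by positivity
  nlinarith

theorem summable_log_mul_norm :
    Summable fun ρ : ℂ => (xiMult ρ : ℝ) * ‖1 / (ρ * (1 - ρ))‖ * log |ρ.im| := by
  refine summable_of_sum_le (c := 0.28) (fun ρ => ?_) sum_log_mul_norm_le
  rw [mul_assoc]
  exact xiMult_mul_nonneg (g := fun ρ => ‖1 / (ρ * (1 - ρ))‖ * log |ρ.im|) (fun ρ h =>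
    mul_nonneg (norm_nonneg _) (log_nonneg (by linarith [abs_im_ge_of_zero h]))) ρ

theorem tsum_log_mul_norm_le :
    ∑' ρ : ℂ, (xiMult ρ : ℝ) * ‖1 / (ρ * (1 - ρ))‖ * log |ρ.im| ≤ 0.28 :=
  summable_log_mul_norm.tsum_le_of_sum_le sum_log_mul_norm_le

open MeasureTheory Set in
theorem hasSum_laplace {ι : Type*} {g : ι → ℝ → ℂ} {b : ι → ℝ} (hb : Summable b)
    (hg : ∀ i, Continuous (g i)) (hgb : ∀ i u, 0 ≤ u → ‖g i u‖ ≤ b i * rexp (u / 2))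
    {z : ℂ} (hz : z.re = 1) :
    HasSum (fun i => ∫ u in Ioi (0 : ℝ), g i u * Complex.exp (-(z * u)))
      (∫ u in Ioi (0 : ℝ), (∑' i, g i u) * Complex.exp (-(z * u))) := by
  have hexp : ∀ u : ℝ, ‖Complex.exp (-(z * u))‖ = rexp (-u) := fun u => by
    rw [Complex.norm_exp]; simp [hz]
  have hbnn : ∀ i, 0 ≤ b i := fun i => by
    have := (norm_nonneg _).trans (hgb i 0 le_rfl); simpa using this
  have hsub : Function.support (fun i => ∫ u in Ioi (0 : ℝ), g i u * Complex.exp (-(z * u)))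
      ⊆ Function.support b := by
    intro i hi hbi
    apply hi
    refine setIntegral_eq_zero_of_forall_eq_zero fun u hu => ?_
    have := hgb i u (le_of_lt hu)
    rw [hbi, zero_mul] at this
    rw [norm_le_zero_iff.1 this, zero_mul]
  have hsub2 : ∀ u ∈ Ioi (0 : ℝ), (∑' i, g i u) * Complex.exp (-(z * u)) =
      ∑' i : Function.support b, g i u * Complex.exp (-(z * u)) := by
    intro u hu
    rw [tsum_mul_right, ← tsum_subtype_eq_of_support_subset (f := fun i => g i u)]
    intro i hi hbi
    apply hi
    have := hgb i u (le_of_lt hu)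
    rw [hbi, zero_mul] at this
    exact norm_le_zero_iff.1 this
  rw [setIntegral_congr_fun measurableSet_Ioi hsub2, ← hasSum_subtype_iff_of_support_subset hsub]
  have : Countable (Function.support b) := hb.countable_support
  have hInt : IntegrableOn (fun u : ℝ => rexp (-(1 / 2) * u)) (Ioi 0) :=
    exp_neg_integrableOn_Ioi 0 (by norm_num)
  have hle : ∀ i u, u ∈ Ioi (0 : ℝ) →
      ‖g i u * Complex.exp (-(z * u))‖ ≤ b i * rexp (-(1 / 2) * u) := by
    intro i u hu
    rw [norm_mul, hexp]
    calc _ ≤ b i * rexp (u / 2) * rexp (-u) := by gcongr; exact hgb i u (le_of_lt hu)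
      _ = _ := by rw [mul_assoc, ← Real.exp_add]; ring_nf
  have hI : ∀ i, IntegrableOn (fun u : ℝ => g i u * Complex.exp (-(z * u))) (Ioi 0) := fun i => by
    refine Integrable.mono' (hInt.const_mul (b i)) ?_ ?_
    · exact ((hg i).mul (by fun_prop)).aestronglyMeasurable
    · exact (ae_restrict_mem measurableSet_Ioi).mono fun u hu => hle i u hu
  refine hasSum_integral_of_summable_integral_norm (fun i => hI i) ?_
  refine Summable.of_nonneg_of_le (fun i => integral_nonneg fun u => norm_nonneg _) (fun i => ?_)
    ((hb.subtype (Function.support b)).mul_right (∫ u in Ioi (0 : ℝ), rexp (-(1 / 2) * u)))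
  rw [← integral_const_mul]
  exact setIntegral_mono_on (hI i).norm (hInt.const_mul _) measurableSet_Ioi (hle i)

open MeasureTheory Set in
theorem continuousOn_tsum_of_le_exp {ι : Type*} {g : ι → ℝ → ℂ} {b : ι → ℝ} (hb : Summable b)
    (hg : ∀ i, Continuous (g i)) (hgb : ∀ i u, 0 ≤ u → ‖g i u‖ ≤ b i * rexp (u / 2)) :
    ContinuousOn (fun u => ∑' i, g i u) (Ici 0) := by
  have h : ContinuousOn (fun u : ℝ => ∑' i, g i u * (rexp (-(u / 2)) : ℂ)) (Ici 0) := by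
    refine continuousOn_tsum (fun i => ((hg i).mul (by fun_prop)).continuousOn) hb ?_
    intro i u hu
    rw [norm_mul, Complex.norm_real, Real.norm_eq_abs, Real.abs_exp]
    calc _ ≤ b i * rexp (u / 2) * rexp (-(u / 2)) := by gcongr; exact hgb i u hu
      _ = b i := by rw [mul_assoc, ← Real.exp_add]; simp
  have h2 : ContinuousOn (fun u : ℝ => (∑' i, g i u * (rexp (-(u / 2)) : ℂ)) * (rexp (u / 2) : ℂ))
      (Ici 0) := h.mul (by fun_prop)
  refine h2.congr fun u _ => ?_
  simp only
  rw [tsum_mul_right, mul_assoc, ← Complex.ofReal_mul, ← Real.exp_add]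
  simp

open MeasureTheory Set in
theorem integrableOn_laplace {f : ℝ → ℂ} {B : ℝ} (hf : ContinuousOn f (Ici 0))
    (hfb : ∀ u, 0 ≤ u → ‖f u‖ ≤ B * rexp (u / 2)) {z : ℂ} (hz : z.re = 1) :
    IntegrableOn (fun u : ℝ => f u * Complex.exp (-(z * u))) (Ioi 0) := by
  have hInt : IntegrableOn (fun u : ℝ => rexp (-(1 / 2) * u)) (Ioi 0) :=
    exp_neg_integrableOn_Ioi 0 (by norm_num)
  refine Integrable.mono' (hInt.const_mul B) ?_ ?_
  · exact ((hf.mono Ioi_subset_Ici_self).mul (by fun_prop)).aestronglyMeasurable measurableSet_Ioi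
  · refine (ae_restrict_mem measurableSet_Ioi).mono fun u hu => ?_
    rw [norm_mul, Complex.norm_exp]
    calc _ ≤ B * rexp (u / 2) * rexp (-u) := by
          simp only [Complex.neg_re, Complex.mul_re, hz]
          simp
          gcongr
          exact hfb u (le_of_lt hu)
      _ = _ := by rw [mul_assoc, ← Real.exp_add]; ring_nf

open MeasureTheory Set FourierTransform in
/-- A function of moderate growth is determined by its Laplace transform on a vertical line. -/
theorem eq_zero_of_laplace_eq_zero {f : ℝ → ℂ} {B : ℝ} (hf : ContinuousOn f (Ici 0))
    (hfb : ∀ u, 0 ≤ u → ‖f u‖ ≤ B * rexp (u / 2))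
    (h0 : ∀ z : ℂ, z.re = 1 → ∫ u in Ioi (0 : ℝ), f u * Complex.exp (-(z * u)) = 0)
    {u : ℝ} (hu : 0 < u) : f u = 0 := by
  set F : ℝ → ℂ := (Ioi (0 : ℝ)).indicator fun u => f u * Complex.exp (-((1 : ℂ) * u)) with hF
  have hFi : Integrable F :=
    (integrable_indicator_iff measurableSet_Ioi).2 (integrableOn_laplace hf hfb (by simp))
  have hFF : 𝓕 F = 0 := by
    ext w
    rw [Real.fourier_real_eq_integral_exp_smul]
    have : ∀ v : ℝ, Complex.exp (((-2 * π * v * w : ℝ) : ℂ) * Complex.I) • F v =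
        (Ioi (0 : ℝ)).indicator
          (fun u => f u * Complex.exp (-((1 + 2 * π * w * Complex.I : ℂ) * u))) v := by
      intro v
      by_cases hv : v ∈ Ioi (0 : ℝ)
      · rw [hF, indicator_of_mem hv, indicator_of_mem hv, smul_eq_mul, mul_left_comm,
          ← Complex.exp_add]
        congr 2
        push_cast
        ring
      · rw [hF, indicator_of_notMem hv, indicator_of_notMem hv, smul_zero]
    simp_rw [this]
    rw [integral_indicator measurableSet_Ioi]
    exact h0 _ (by simp)
  have hc : ContinuousAt F u := by
    have h1 : ContinuousAt (fun u : ℝ => f u * Complex.exp (-((1 : ℂ) * u))) u :=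
      (hf.continuousAt (Ici_mem_nhds hu)).mul (by fun_prop)
    refine h1.congr ?_
    filter_upwards [Ioi_mem_nhds hu] with v hv
    rw [hF, indicator_of_mem hv]
  have h1 := hFi.fourierInv_fourier_eq (by rw [hFF]; exact integrable_zero _ _ _) hc
  have h2 : F u = 0 := by
    rw [← h1, hFF, Real.fourierInv_eq']
    simp
  rw [hF, indicator_of_mem (show u ∈ Ioi 0 from hu)] at h2
  simpa using h2

open MeasureTheory Set in
theorem integral_Ioi_zero_exp {a : ℂ} (ha : 0 < a.re) :
    ∫ u in Ioi (0 : ℝ), Complex.exp (-(a * u)) = 1 / a := by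
  have := integral_exp_mul_complex_Ioi (a := -a) (by simpa) 0
  simp only [neg_mul] at this
  rw [this]; simp

open MeasureTheory Set in
theorem integrableOn_Ioi_exp {a : ℂ} (ha : 0 < a.re) (c : ℝ) :
    IntegrableOn (fun u : ℝ => Complex.exp (-(a * u))) (Ioi c) := by
  have := integrableOn_exp_mul_complex_Ioi (a := -a) (by simpa) c
  simpa only [neg_mul] using this

/-- The function `u ↦ ∫ t in 0..u, exp (-c t)`. -/
noncomputable def expRamp (c : ℂ) (u : ℝ) : ℂ := (1 - Complex.exp (-(c * u))) / c

theorem continuous_expRamp (c : ℂ) : Continuous (expRamp c) := by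
  unfold expRamp; fun_prop

theorem norm_expRamp_le {c : ℂ} (hc : 0 ≤ c.re) {u : ℝ} (hu : 0 ≤ u) :
    ‖expRamp c u‖ ≤ 2 * ‖1 / c‖ := by
  rw [expRamp, div_eq_mul_one_div, norm_mul]
  gcongr
  refine (norm_sub_le _ _).trans ?_
  rw [norm_one, Complex.norm_exp]
  have : rexp (-(c * u)).re ≤ 1 := by
    rw [exp_le_one_iff]; simp; positivity
  linarith

open MeasureTheory Set in
theorem integral_expRamp {c z : ℂ} (hc : 0 < c.re) (hz : z.re = 1) :
    ∫ u in Ioi (0 : ℝ), expRamp c u * Complex.exp (-(z * u)) = 1 / (z * (z + c)) := by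
  have hc0 : c ≠ 0 := by rintro rfl; simp at hc
  have hz0 : z ≠ 0 := by rintro rfl; simp at hz
  have hzc : z + c ≠ 0 := by
    intro h; have := congrArg Complex.re h; simp [hz] at this; linarith
  have e : ∀ u : ℝ, expRamp c u * Complex.exp (-(z * u)) =
      1 / c * (Complex.exp (-(z * u)) - Complex.exp (-((z + c) * u))) := by
    intro u
    have : Complex.exp (-((z + c) * u)) = Complex.exp (-(c * u)) * Complex.exp (-(z * u)) := by
      rw [← Complex.exp_add]; ring_nf
    rw [expRamp, this]; ring
  have h1 : 0 < z.re := by rw [hz]; norm_num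
  have h2 : 0 < (z + c).re := by simp; linarith
  simp_rw [e]
  rw [integral_const_mul, integral_sub (integrableOn_Ioi_exp h1 0) (integrableOn_Ioi_exp h2 0),
    integral_Ioi_zero_exp h1, integral_Ioi_zero_exp h2]
  field_simp
  ring

open MeasureTheory Set Filter in
theorem integral_Ioi_id_mul_exp {z : ℂ} (hz : z.re = 1) :
    ∫ u in Ioi (0 : ℝ), (u : ℂ) * Complex.exp (-(z * u)) = 1 / z ^ 2 := by
  have hz0 : z ≠ 0 := by rintro rfl; simp at hz
  have hInt : IntegrableOn (fun u : ℝ => (u : ℂ) * Complex.exp (-(z * u))) (Ioi 0) := by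
    refine integrableOn_laplace (f := fun u => (u : ℂ)) (B := 2) (by fun_prop) (fun u hu => ?_) hz
    rw [Complex.norm_real, Real.norm_of_nonneg hu]
    linarith [add_one_le_exp (u / 2)]
  have hd : ∀ u ∈ Ici (0 : ℝ), HasDerivAt
      (fun u : ℝ => -((u : ℂ) / z + 1 / z ^ 2) * Complex.exp (-(z * u)))
      ((u : ℂ) * Complex.exp (-(z * u))) u := by
    intro u _
    have h1 : HasDerivAt (fun u : ℝ => (u : ℂ)) 1 u := Complex.ofRealCLM.hasDerivAt
    have h2 := ((h1.div_const z).add_const (1 / z ^ 2)).neg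
    have h3 := ((h1.const_mul z).neg).cexp
    refine (h2.mul h3).congr_deriv ?_
    simp only [Pi.neg_apply]
    field_simp
    ring
  have ht : Tendsto (fun u : ℝ => -((u : ℂ) / z + 1 / z ^ 2) * Complex.exp (-(z * u)))
      atTop (nhds 0) := by
    rw [tendsto_zero_iff_norm_tendsto_zero]
    have h1 : Tendsto (fun u : ℝ => u * rexp (-u)) atTop (nhds 0) := by
      simpa using tendsto_pow_mul_exp_neg_atTop_nhds_zero 1
    have h2 : Tendsto (fun u : ℝ => rexp (-u)) atTop (nhds 0) :=
      tendsto_exp_neg_atTop_nhds_zero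
    have h3 := (h1.const_mul ‖1 / z‖).add (h2.const_mul ‖1 / z ^ 2‖)
    simp only [mul_zero, add_zero] at h3
    refine squeeze_zero' (Eventually.of_forall fun _ => norm_nonneg _) ?_ h3
    filter_upwards [eventually_ge_atTop 0] with u hu
    rw [norm_mul, norm_neg, Complex.norm_exp]
    have : (-(z * u)).re = -u := by simp [hz]
    rw [this]
    calc _ ≤ (‖(u : ℂ) / z‖ + ‖1 / z ^ 2‖) * rexp (-u) := by
          gcongr; exact norm_add_le _ _
      _ = _ := by
          rw [div_eq_mul_one_div (u : ℂ), norm_mul, Complex.norm_real, Real.norm_of_nonneg hu]; ring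
  rw [integral_Ioi_of_hasDerivAt_of_tendsto' hd hInt ht]
  simp

/-- The weighted sum `∑ Λ(n) (1/n - exp (-u))` over `n ≤ exp u`. -/
noncomputable def mangoldtRamp (u : ℝ) : ℝ :=
  ∑' n : ℕ, ArithmeticFunction.vonMangoldt n * max (1 / (n : ℝ) - rexp (-u)) 0

theorem mangoldtRamp_eq_sum {u : ℝ} {N : ℕ} (hN : rexp u ≤ N) :
    mangoldtRamp u = ∑ n ∈ Finset.range N,
      ArithmeticFunction.vonMangoldt n * max (1 / (n : ℝ) - rexp (-u)) 0 := by
  refine tsum_eq_sum fun n hn => ?_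
  have hn' : rexp u ≤ n := hN.trans (by simpa using hn)
  have : 1 / (n : ℝ) ≤ rexp (-u) := by
    rw [Real.exp_neg, ← one_div]
    exact one_div_le_one_div_of_le (exp_pos u) hn'
  rw [max_eq_right (by linarith), mul_zero]

theorem mangoldtRamp_term_le (n : ℕ) (u : ℝ) :
    ArithmeticFunction.vonMangoldt n * max (1 / (n : ℝ) - rexp (-u)) 0
      ≤ ArithmeticFunction.vonMangoldt n * (n : ℝ) ^ (-(3 / 2 : ℝ)) * rexp (u / 2) := by
  rw [mul_assoc]
  refine mul_le_mul_of_nonneg_left ?_ ArithmeticFunction.vonMangoldt_nonneg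
  rcases Nat.eq_zero_or_pos n with rfl | hn
  · simp; positivity
  have hn' : (0 : ℝ) < n := by exact_mod_cast hn
  refine max_le ?_ (by positivity)
  by_cases h : 1 / (n : ℝ) ≤ rexp (-u)
  · have : 0 ≤ (n : ℝ) ^ (-(3 / 2 : ℝ)) * rexp (u / 2) := by positivity
    linarith
  · push Not at h
    have hnu : (n : ℝ) ≤ rexp u := by
      rw [Real.exp_neg, ← one_div] at h
      exact (lt_of_one_div_lt_one_div (exp_pos u) h).le
    have h1 : log n ≤ u := (log_le_iff_le_exp hn').2 hnu
    have h2 : 1 / (n : ℝ) ≤ (n : ℝ) ^ (-(3 / 2 : ℝ)) * rexp (u / 2) := by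
      rw [one_div, ← rpow_neg_one, rpow_def_of_pos hn', rpow_def_of_pos hn', ← Real.exp_add]
      apply exp_le_exp.2
      linarith
    linarith [exp_pos (-u)]

theorem summable_mangoldt_rpow {σ : ℝ} (hσ : 1 < σ) :
    Summable fun n : ℕ => ArithmeticFunction.vonMangoldt n * (n : ℝ) ^ (-σ) := by
  simpa using (hasSum_re_mangoldtSeries hσ 0).summable

open MeasureTheory Set in
theorem integral_mangoldtRamp_term {n : ℕ} (hn : 0 < n) {z : ℂ} (hz : z.re = 1) :
    ∫ u in Ioi (0 : ℝ), ((max (1 / (n : ℝ) - rexp (-u)) 0 : ℝ) : ℂ) * Complex.exp (-(z * u))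
      = (n : ℂ) ^ (-(1 + z)) * (1 / (z * (z + 1))) := by
  have hn' : (0 : ℝ) < n := by exact_mod_cast hn
  have hz0 : z ≠ 0 := by rintro rfl; simp at hz
  have hz1 : z + 1 ≠ 0 := by
    intro h; have := congrArg Complex.re h; norm_num [hz] at this
  have hln : 0 ≤ log n := log_natCast_nonneg n
  have e1 : ∫ u in Ioi (0 : ℝ), ((max (1 / (n : ℝ) - rexp (-u)) 0 : ℝ) : ℂ) * Complex.exp (-(z * u))
      = ∫ u in Ioi (log n),
          ((max (1 / (n : ℝ) - rexp (-u)) 0 : ℝ) : ℂ) * Complex.exp (-(z * u)) := by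
    refine setIntegral_eq_of_subset_of_forall_sdiff_eq_zero measurableSet_Ioi
      (Ioi_subset_Ioi hln) fun u hu => ?_
    have hu' : u ≤ log n := by simpa using hu.2
    have : 1 / (n : ℝ) ≤ rexp (-u) := by
      rw [one_div, ← exp_log hn', ← Real.exp_neg]
      exact exp_le_exp.2 (by linarith)
    rw [max_eq_right (by linarith)]; simp
  have e2 : ∀ u ∈ Ioi (log n), ((max (1 / (n : ℝ) - rexp (-u)) 0 : ℝ) : ℂ) * Complex.exp (-(z * u))
      = 1 / (n : ℂ) * Complex.exp (-(z * u)) - Complex.exp (-((z + 1) * u)) := by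
    intro u hu
    have : rexp (-u) ≤ 1 / (n : ℝ) := by
      rw [one_div, ← exp_log hn', ← Real.exp_neg]
      exact exp_le_exp.2 (by linarith [mem_Ioi.1 hu])
    rw [max_eq_left (by linarith)]
    have h3 : Complex.exp (-((z + 1) * u)) = Complex.exp (-(u : ℂ)) * Complex.exp (-(z * u)) := by
      rw [← Complex.exp_add]; ring_nf
    rw [h3]; push_cast; ring
  have h1 : 0 < z.re := by rw [hz]; norm_num
  have h2 : 0 < (z + 1).re := by simp [hz]
  have i1 := integral_exp_mul_complex_Ioi (a := -z) (by simpa) (log n)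
  have i2 := integral_exp_mul_complex_Ioi (a := -(z + 1)) (by simp [hz]) (log n)
  simp only [neg_mul] at i1 i2
  rw [e1, setIntegral_congr_fun measurableSet_Ioi e2,
    integral_sub ((integrableOn_Ioi_exp h1 _).const_mul _) (integrableOn_Ioi_exp h2 _),
    integral_const_mul, i1, i2]
  have hnC : (n : ℂ) ≠ 0 := by exact_mod_cast hn.ne'
  have q1 : Complex.exp (-(z * (Real.log n : ℝ))) = (n : ℂ) ^ (-z) := by
    rw [Complex.cpow_def_of_ne_zero hnC, ← Complex.natCast_log]; ring_nf
  have q2 : Complex.exp (-((z + 1) * (Real.log n : ℝ))) = (n : ℂ) ^ (-z) * (1 / n) := by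
    rw [one_div, ← Complex.cpow_neg_one, ← Complex.cpow_add _ _ hnC,
      Complex.cpow_def_of_ne_zero hnC, ← Complex.natCast_log]; ring_nf
  have q3 : (n : ℂ) ^ (-(1 + z)) = (n : ℂ) ^ (-z) * (1 / n) := by
    rw [one_div, ← Complex.cpow_neg_one, ← Complex.cpow_add _ _ hnC]; ring_nf
  rw [q1, q2, q3]
  field_simp
  ring

open MeasureTheory Set in
theorem laplace_mangoldtRamp {z : ℂ} (hz : z.re = 1) :
    ∫ u in Ioi (0 : ℝ), (mangoldtRamp u : ℂ) * Complex.exp (-(z * u))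
      = mangoldtSeries (1 + z) / (z * (z + 1)) := by
  have hs : 1 < (1 + z).re := by simp [hz]
  have hz0 : z ≠ 0 := by rintro rfl; simp at hz
  have h1 := hasSum_laplace
    (g := fun (n : ℕ) u =>
      ((ArithmeticFunction.vonMangoldt n * max (1 / (n : ℝ) - rexp (-u)) 0 : ℝ) : ℂ))
    (summable_mangoldt_rpow (σ := 3 / 2) (by norm_num)) (fun n => by fun_prop)
    (fun n u hu => by
      rw [Complex.norm_real, Real.norm_of_nonneg
        (mul_nonneg ArithmeticFunction.vonMangoldt_nonneg (le_max_right _ _))]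
      exact mangoldtRamp_term_le n u) hz
  have h2 := (ArithmeticFunction.LSeriesSummable_vonMangoldt hs).hasSum.mul_right
    (1 / (z * (z + 1)))
  have h3 : (fun n : ℕ => ∫ u in Ioi (0 : ℝ),
      ((ArithmeticFunction.vonMangoldt n * max (1 / (n : ℝ) - rexp (-u)) 0 : ℝ) : ℂ)
        * Complex.exp (-(z * u))) = fun n =>
      LSeries.term (fun n => (ArithmeticFunction.vonMangoldt n : ℂ)) (1 + z) n *
          (1 / (z * (z + 1))) := by
    ext n
    rcases Nat.eq_zero_or_pos n with rfl | hn
    · simp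
    · rw [LSeries.term_of_ne_zero hn.ne', div_eq_mul_inv _ ((n : ℂ) ^ (1 + z)), ← Complex.cpow_neg,
        mul_assoc,
        ← integral_mangoldtRamp_term hn hz, ← integral_const_mul]
      congr 1 with u
      push_cast; ring
  rw [h3] at h1
  simp_rw [mangoldtRamp, Complex.ofReal_tsum]
  rw [h1.unique h2, mangoldtSeries, LSeries, mul_one_div]

/-- The contribution of the trivial zeros to the explicit formula. -/
noncomputable def trivialTerm (n : ℕ) (u : ℝ) : ℂ :=
  1 / (2 * ((n : ℂ) + 1)) * expRamp (2 * n + 3) u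

/-- The contribution of a nontrivial zero to the explicit formula. -/
noncomputable def zeroTerm (ρ : ℂ) (u : ℝ) : ℂ := xiMult ρ * (1 / ρ) * expRamp (1 - ρ) u

theorem continuous_trivialTerm (n : ℕ) : Continuous (trivialTerm n) :=
  continuous_const.mul (continuous_expRamp _)

theorem continuous_zeroTerm (ρ : ℂ) : Continuous (zeroTerm ρ) :=
  continuous_const.mul (continuous_expRamp _)

theorem norm_trivialTerm_le (n : ℕ) {u : ℝ} (hu : 0 ≤ u) :
    ‖trivialTerm n u‖ ≤ 1 / ((n : ℝ) + 1) ^ 2 := by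
  have h := norm_expRamp_le (c := 2 * n + 3) (by simp; positivity) hu
  have h1 : ‖1 / (2 * (n : ℂ) + 3)‖ = 1 / (2 * n + 3) := by
    have : (1 / (2 * (n : ℂ) + 3)) = ((1 / (2 * (n : ℝ) + 3) : ℝ) : ℂ) := by push_cast; ring
    rw [this, Complex.norm_real, Real.norm_of_nonneg (by positivity)]
  have h2 : ‖1 / (2 * ((n : ℂ) + 1))‖ = 1 / (2 * (n + 1)) := by
    have : (1 / (2 * ((n : ℂ) + 1))) = ((1 / (2 * ((n : ℝ) + 1)) : ℝ) : ℂ) := by push_cast; ring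
    rw [this, Complex.norm_real, Real.norm_of_nonneg (by positivity)]
  rw [trivialTerm, norm_mul, h2]
  rw [h1] at h
  calc _ ≤ 1 / (2 * ((n : ℝ) + 1)) * (2 * (1 / (2 * n + 3))) := by gcongr
    _ ≤ _ := by
      rw [div_mul_eq_mul_div, mul_one_div, ← mul_div_assoc, div_div,
        div_le_div_iff₀ (by positivity) (by positivity)]
      nlinarith [(Nat.cast_nonneg n : (0:ℝ) ≤ n)]

theorem norm_zeroTerm_le (ρ : ℂ) {u : ℝ} (hu : 0 ≤ u) :
    ‖zeroTerm ρ u‖ ≤ 2 * ((xiMult ρ : ℝ) * ‖1 / (ρ * (1 - ρ))‖) := by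
  by_cases h : xiFun ρ = 0
  · have hb := re_lt_one_of_xiFun_eq_zero h
    have h1 := norm_expRamp_le (c := 1 - ρ) (by simp; linarith) hu
    rw [zeroTerm, norm_mul, norm_mul, Complex.norm_natCast, ← one_div_mul_one_div, norm_mul]
    calc _ ≤ (xiMult ρ : ℝ) * ‖1 / ρ‖ * (2 * ‖1 / (1 - ρ)‖) := by gcongr
      _ = _ := by ring
  · simp [zeroTerm, xiMult_eq_zero_of_ne h]

theorem laplace_trivialTerm {z : ℂ} (hz : z.re = 1) :
    ∫ u in Set.Ioi (0 : ℝ), (∑' n, trivialTerm n u) * Complex.exp (-(z * u))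
      = 1 / 2 * (Complex.digamma ((1 + z) / 2 + 1) + eulerMascheroniConstant) / (z * (z + 1)) := by
  have hz0 : z ≠ 0 := by rintro rfl; simp at hz
  have hz1 : z + 1 ≠ 0 := by
    intro h; have := congrArg Complex.re h; norm_num [hz] at this
  have hw : 1 < ((1 + z) / 2 + 1).re := by simp [hz]
  have h1 := hasSum_laplace summable_one_div_add_one_sq continuous_trivialTerm
    (fun n u hu => (norm_trivialTerm_le n hu).trans
      (le_mul_of_one_le_right (by positivity) (one_le_exp (by positivity)))) hz
  have h2 := ((summable_norm_digammaTerm hw.le).of_norm.hasSum.mul_left (1 / 2)).div_const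
    (z * (z + 1))
  have h3 : (fun n => ∫ u in Set.Ioi (0 : ℝ), trivialTerm n u * Complex.exp (-(z * u)))
      = fun n => 1 / 2 * digammaTerm ((1 + z) / 2 + 1) n / (z * (z + 1)) := by
    ext n
    simp_rw [trivialTerm, mul_assoc]
    rw [MeasureTheory.integral_const_mul, integral_expRamp (by simp; positivity) hz, digammaTerm]
    have k1 : (n : ℂ) + 1 ≠ 0 := by exact_mod_cast Nat.succ_ne_zero n
    have k2 : z + (2 * n + 3) ≠ 0 := by
      intro h; have := congrArg Complex.re h
      simp [hz] at this
      linarith [(Nat.cast_nonneg n : (0:ℝ) ≤ n)]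
    have k3 : (1 + z) / 2 + 1 + (n : ℂ) ≠ 0 := by
      intro h; apply k2; linear_combination 2 * h
    have k4 : (1 + z) / 2 + 1 + (n : ℂ) = (z + (2 * n + 3)) / 2 := by ring
    rw [k4]
    field_simp
    ring
  rw [h3] at h1
  rw [h1.unique h2, digamma_eq_tsum hw]
  ring

theorem laplace_zeroTerm {z : ℂ} (hz : z.re = 1) :
    ∫ u in Set.Ioi (0 : ℝ), (∑' ρ, zeroTerm ρ u) * Complex.exp (-(z * u))
      = (logDeriv xiFun (1 + z) + xiConst) / (z * (z + 1)) := by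
  have hz0 : z ≠ 0 := by rintro rfl; simp at hz
  have hz1 : z + 1 ≠ 0 := by
    intro h; have := congrArg Complex.re h; norm_num [hz] at this
  have hs : 1 < (1 + z).re := by simp [hz]
  have h1 := hasSum_laplace (summable_norm_one_div_mul.mul_left 2) continuous_zeroTerm
    (fun n u hu => (norm_zeroTerm_le n hu).trans
      (le_mul_of_one_le_right (by positivity) (one_le_exp (by positivity)))) hz
  have h2 := (hasSum_logDeriv_xiFun hs).div_const (z * (z + 1))
  have h3 : (fun ρ => ∫ u in Set.Ioi (0 : ℝ), zeroTerm ρ u * Complex.exp (-(z * u)))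
      = fun ρ => (xiMult ρ : ℂ) * (1 / (1 + z - ρ) + 1 / ρ) / (z * (z + 1)) := by
    ext ρ
    by_cases h : xiFun ρ = 0
    · have hb := re_lt_one_of_xiFun_eq_zero h
      have hb0 := re_pos_of_xiFun_eq_zero h
      have hρ0 : ρ ≠ 0 := by rintro rfl; simp at hb0
      simp_rw [zeroTerm, mul_assoc]
      rw [MeasureTheory.integral_const_mul, MeasureTheory.integral_const_mul,
        integral_expRamp (by simp; linarith) hz]
      have k1 : z + (1 - ρ) ≠ 0 := by
        intro h; have := congrArg Complex.re h
        simp [hz] at this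
        linarith
      have k2 : 1 + z - ρ = z + (1 - ρ) := by ring
      rw [k2]
      field_simp
      ring
    · simp [zeroTerm, xiMult_eq_zero_of_ne h]
  rw [h3] at h1
  exact h1.unique h2

theorem continuousOn_tsum_trivialTerm :
    ContinuousOn (fun u => ∑' n, trivialTerm n u) (Set.Ici 0) :=
  continuousOn_tsum_of_le_exp summable_one_div_add_one_sq continuous_trivialTerm
    (fun n u hu => (norm_trivialTerm_le n hu).trans
      (le_mul_of_one_le_right (by positivity) (one_le_exp (by positivity))))

theorem continuousOn_tsum_zeroTerm :
    ContinuousOn (fun u => ∑' ρ, zeroTerm ρ u) (Set.Ici 0) :=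
  continuousOn_tsum_of_le_exp (summable_norm_one_div_mul.mul_left 2) continuous_zeroTerm
    (fun n u hu => (norm_zeroTerm_le n hu).trans
      (le_mul_of_one_le_right (by positivity) (one_le_exp (by positivity))))

theorem norm_mangoldtRamp_term_le (n : ℕ) (u : ℝ) :
    ‖((ArithmeticFunction.vonMangoldt n * max (1 / (n : ℝ) - rexp (-u)) 0 : ℝ) : ℂ)‖
      ≤ ArithmeticFunction.vonMangoldt n * (n : ℝ) ^ (-(3 / 2 : ℝ)) * rexp (u / 2) := by
  rw [Complex.norm_real, Real.norm_of_nonneg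
    (mul_nonneg ArithmeticFunction.vonMangoldt_nonneg (le_max_right _ _))]
  exact mangoldtRamp_term_le n u

theorem continuousOn_mangoldtRamp :
    ContinuousOn (fun u => (mangoldtRamp u : ℂ)) (Set.Ici 0) := by
  simp_rw [mangoldtRamp, Complex.ofReal_tsum]
  exact continuousOn_tsum_of_le_exp
    (summable_mangoldt_rpow (σ := 3 / 2) (by norm_num)) (fun n => by fun_prop)
    (fun n u _ => norm_mangoldtRamp_term_le n u)

/-- The explicit formula for the weighted sum of the von Mangoldt function. -/
theorem mangoldtRamp_eq {u : ℝ} (hu : 0 < u) :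
    (mangoldtRamp u : ℂ) = u
      - ((1 + log π / 2 + eulerMascheroniConstant / 2 - xiConst : ℝ) : ℂ) * expRamp 1 u
      + ∑' n, trivialTerm n u - ∑' ρ, zeroTerm ρ u := by
  set C : ℂ := ((1 + log π / 2 + eulerMascheroniConstant / 2 - xiConst : ℝ) : ℂ) with hC
  have hb1 : ∀ v : ℝ, 0 ≤ v → ‖(mangoldtRamp v : ℂ)‖ ≤
      (∑' n : ℕ, ArithmeticFunction.vonMangoldt n * (n : ℝ) ^ (-(3 / 2 : ℝ))) * rexp (v / 2) := by
    intro v _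
    rw [mangoldtRamp, Complex.ofReal_tsum, ← tsum_mul_right]
    exact tsum_of_norm_bounded
      ((summable_mangoldt_rpow (σ := 3 / 2) (by norm_num)).mul_right _).hasSum
      fun n => norm_mangoldtRamp_term_le n v
  have hb2 : ∀ v : ℝ, 0 ≤ v → ‖(v : ℂ)‖ ≤ 2 * rexp (v / 2) := by
    intro v hv
    rw [Complex.norm_real, Real.norm_of_nonneg hv]
    linarith [add_one_le_exp (v / 2)]
  have hb3 : ∀ v : ℝ, 0 ≤ v → ‖C * expRamp 1 v‖ ≤ (‖C‖ * 2) * rexp (v / 2) := by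
    intro v hv
    have := norm_expRamp_le (c := 1) (by simp) hv
    rw [norm_mul, mul_assoc]
    gcongr
    refine this.trans ?_
    simp
    linarith
  have hb4 : ∀ v : ℝ, 0 ≤ v → ‖∑' n, trivialTerm n v‖ ≤
      (∑' n : ℕ, 1 / ((n : ℝ) + 1) ^ 2) * rexp (v / 2) := by
    intro v hv
    refine (tsum_of_norm_bounded summable_one_div_add_one_sq.hasSum
      fun n => norm_trivialTerm_le n hv).trans ?_
    exact le_mul_of_one_le_right (tsum_nonneg fun n => by positivity) (one_le_exp (by positivity))
  have hb5 : ∀ v : ℝ, 0 ≤ v → ‖∑' ρ, zeroTerm ρ v‖ ≤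
      (∑' ρ : ℂ, 2 * ((xiMult ρ : ℝ) * ‖1 / (ρ * (1 - ρ))‖)) * rexp (v / 2) := by
    intro v hv
    refine (tsum_of_norm_bounded (summable_norm_one_div_mul.mul_left 2).hasSum
      fun n => norm_zeroTerm_le n hv).trans ?_
    exact le_mul_of_one_le_right (tsum_nonneg fun n => by positivity) (one_le_exp (by positivity))
  have hc2 : ContinuousOn (fun v : ℝ => (v : ℂ)) (Set.Ici 0) := by fun_prop
  have hc3 : ContinuousOn (fun v : ℝ => C * expRamp 1 v) (Set.Ici 0) :=
    (continuous_const.mul (continuous_expRamp 1)).continuousOn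
  have key := eq_zero_of_laplace_eq_zero
    (f := fun v =>
      (mangoldtRamp v : ℂ) - (v - C * expRamp 1 v + ∑' n, trivialTerm n v - ∑' ρ, zeroTerm ρ v))
    (B := (∑' n : ℕ, ArithmeticFunction.vonMangoldt n * (n : ℝ) ^ (-(3 / 2 : ℝ))) + (2 + ‖C‖ * 2
      + (∑' n : ℕ, 1 / ((n : ℝ) + 1) ^ 2)
      + ∑' ρ : ℂ, 2 * ((xiMult ρ : ℝ) * ‖1 / (ρ * (1 - ρ))‖)))
    (continuousOn_mangoldtRamp.sub (((hc2.sub hc3).add continuousOn_tsum_trivialTerm).sub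
      continuousOn_tsum_zeroTerm))
    (fun v hv => by
      refine (norm_sub_le_of_le (hb1 v hv) (norm_sub_le_of_le (norm_add_le_of_le
        (norm_sub_le_of_le (hb2 v hv) (hb3 v hv)) (hb4 v hv)) (hb5 v hv))).trans (le_of_eq ?_)
      ring) ?_ hu
  · exact sub_eq_zero.1 key
  intro z hz
  have hz0 : z ≠ 0 := by rintro rfl; simp at hz
  have hz1 : z + 1 ≠ 0 := by
    intro h; have := congrArg Complex.re h; norm_num [hz] at this
  have hs : 1 < (1 + z).re := by simp [hz]
  simp_rw [sub_mul, add_mul, sub_mul]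
  have i1 := integrableOn_laplace continuousOn_mangoldtRamp hb1 hz
  have i2 := integrableOn_laplace hc2 hb2 hz
  have i3 := integrableOn_laplace hc3 hb3 hz
  have i4 := integrableOn_laplace continuousOn_tsum_trivialTerm hb4 hz
  have i5 := integrableOn_laplace continuousOn_tsum_zeroTerm hb5 hz
  have e3 : ∫ u in Set.Ioi (0 : ℝ), C * expRamp 1 u * Complex.exp (-(z * u))
      = C * (1 / (z * (z + 1))) := by
    simp_rw [mul_assoc]
    rw [MeasureTheory.integral_const_mul, integral_expRamp (by simp) hz]
  have i23 : MeasureTheory.IntegrableOn (fun u : ℝ => (u : ℂ) * Complex.exp (-(z * u))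
      - C * expRamp 1 u * Complex.exp (-(z * u))) (Set.Ioi 0) := i2.sub i3
  have i234 : MeasureTheory.IntegrableOn (fun u : ℝ => (u : ℂ) * Complex.exp (-(z * u))
      - C * expRamp 1 u * Complex.exp (-(z * u)) + (∑' n, trivialTerm n u) * Complex.exp (-(z * u)))
      (Set.Ioi 0) := i23.add i4
  have i2345 : MeasureTheory.IntegrableOn (fun u : ℝ => (u : ℂ) * Complex.exp (-(z * u))
      - C * expRamp 1 u * Complex.exp (-(z * u)) + (∑' n, trivialTerm n u) * Complex.exp (-(z * u))
      - (∑' ρ, zeroTerm ρ u) * Complex.exp (-(z * u))) (Set.Ioi 0) := i234.sub i5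
  rw [MeasureTheory.integral_sub i1 i2345, MeasureTheory.integral_sub i234 i5,
    MeasureTheory.integral_add i23 i4,
    MeasureTheory.integral_sub i2 i3, laplace_mangoldtRamp hz, integral_Ioi_id_mul_exp hz, e3,
    laplace_trivialTerm hz, laplace_zeroTerm hz, mangoldtSeries_eq hs, hC]
  push_cast
  rw [add_sub_cancel_left]
  field_simp
  ring

/-- The oscillating contribution of a nontrivial zero to the explicit formula. -/
noncomputable def zeroOsc (ρ : ℂ) (u : ℝ) : ℂ :=
  xiMult ρ * (1 / (ρ * (1 - ρ))) * Complex.exp (-((1 - ρ) * u))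

theorem continuous_zeroOsc (ρ : ℂ) : Continuous (zeroOsc ρ) := by
  unfold zeroOsc; fun_prop

theorem norm_zeroOsc (ρ : ℂ) (u : ℝ) :
    ‖zeroOsc ρ u‖ = (xiMult ρ : ℝ) * ‖1 / (ρ * (1 - ρ))‖ * rexp (-((1 - ρ.re) * u)) := by
  rw [zeroOsc, norm_mul, norm_mul, Complex.norm_natCast, Complex.norm_exp]
  simp

theorem norm_zeroOsc_le (ρ : ℂ) {u : ℝ} (hu : 0 ≤ u) :
    ‖zeroOsc ρ u‖ ≤ (xiMult ρ : ℝ) * ‖1 / (ρ * (1 - ρ))‖ := by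
  by_cases h : xiFun ρ = 0
  · rw [norm_zeroOsc]
    refine mul_le_of_le_one_right (by positivity) (exp_le_one_iff.2 ?_)
    have := re_lt_one_of_xiFun_eq_zero h
    have : 0 ≤ (1 - ρ.re) * u := mul_nonneg (by linarith) hu
    linarith
  · simp [zeroOsc, xiMult_eq_zero_of_ne h]

theorem summable_zeroOsc {u : ℝ} (hu : 0 ≤ u) : Summable fun ρ => zeroOsc ρ u :=
  Summable.of_norm_bounded summable_norm_one_div_mul fun ρ => norm_zeroOsc_le ρ hu

theorem exists_abs_mangoldtRamp_sub_le : ∃ κ : ℝ, ∀ u : ℝ, 0 < u →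
    |mangoldtRamp u - u + κ - (∑' ρ, zeroOsc ρ u).re| ≤ 3 * rexp (-u) := by
  set C : ℝ := 1 + log π / 2 + eulerMascheroniConstant / 2 - xiConst with hC
  set t : ℕ → ℝ := fun n => 1 / ((2 * ((n : ℝ) + 1)) * (2 * n + 3)) with ht
  have ht0 : ∀ n, 0 ≤ t n := fun n => by positivity
  have htle : ∀ n, t n ≤ 1 / ((n : ℝ) + 1) ^ 2 := fun n => by
    have : (0 : ℝ) ≤ n := Nat.cast_nonneg n
    apply one_div_le_one_div_of_le (by positivity)
    nlinarith
  have hts : Summable t := Summable.of_nonneg_of_le ht0 htle summable_one_div_add_one_sq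
  have htt : ∑' n, t n ≤ 2 := by
    have h1 := hasSum_zeta_two
    have h2 : HasSum (fun n : ℕ => 1 / ((n : ℝ) + 1) ^ 2) (π ^ 2 / 6) := by
      have := (hasSum_nat_add_iff' (f := fun n : ℕ => 1 / (n : ℝ) ^ 2) 1).2 h1
      simpa using this
    calc _ ≤ ∑' n : ℕ, 1 / ((n : ℝ) + 1) ^ 2 := hts.tsum_le_tsum htle summable_one_div_add_one_sq
      _ = π ^ 2 / 6 := h2.tsum_eq
      _ ≤ 2 := by nlinarith [pi_lt_d2, pi_pos]
  refine ⟨C - ∑' n, t n + 2 * xiConst, fun u hu => ?_⟩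
  have hC3 : C ≤ 3 := by
    have h1 : log π ≤ π - 1 := log_le_sub_one_of_pos pi_pos
    have h2 : 0 ≤ 2 * xiConst := hasSum_re_one_div_mul.nonneg
      (xiMult_mul_nonneg fun ρ h => by
        have := norm_one_div_le_of_zero h
        linarith [norm_nonneg (1 / (ρ * (1 - ρ)))])
    linarith [pi_lt_d2, eulerMascheroni_lt]
  have hC0 : 0 ≤ C := by linarith [two_xiConst_lt, log_pi_gt_one, eulerMascheroni_gt]
  have hT : ∑' n, trivialTerm n u
      = ((∑' n, t n - ∑' n, t n * rexp (-((2 * n + 3) * u)) : ℝ) : ℂ) := by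
    have hs : Summable fun n : ℕ => t n * rexp (-((2 * n + 3) * u)) :=
      Summable.of_nonneg_of_le (fun n => mul_nonneg (ht0 n) (exp_pos _).le)
        (fun n => mul_le_of_le_one_right (ht0 n) (exp_le_one_iff.2 (by
          have : 0 ≤ (2 * (n : ℝ) + 3) * u := by positivity
          linarith))) hts
    rw [← hts.tsum_sub hs, Complex.ofReal_tsum]
    refine tsum_congr fun n => ?_
    have k1 : (n : ℂ) + 1 ≠ 0 := by exact_mod_cast Nat.succ_ne_zero n
    have k2 : 2 * (n : ℂ) + 3 ≠ 0 := by
      have : (2 * (n : ℂ) + 3) = ((2 * n + 3 : ℕ) : ℂ) := by push_cast; ring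
      rw [this]; exact_mod_cast (by omega : 2 * n + 3 ≠ 0)
    simp only [trivialTerm, expRamp, ht]
    push_cast
    field_simp
  have hT1 : 0 ≤ ∑' n : ℕ, t n * rexp (-((2 * n + 3) * u)) :=
    tsum_nonneg fun n => mul_nonneg (ht0 n) (exp_pos _).le
  have hT2 : ∑' n : ℕ, t n * rexp (-((2 * n + 3) * u)) ≤ 2 * rexp (-u) := by
    have hle : ∀ n : ℕ, t n * rexp (-((2 * n + 3) * u)) ≤ t n * rexp (-u) := fun n => by
      refine mul_le_mul_of_nonneg_left (exp_le_exp.2 ?_) (ht0 n)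
      nlinarith [(Nat.cast_nonneg n : (0:ℝ) ≤ n)]
    have hs2 := hts.mul_right (rexp (-u))
    calc _ ≤ ∑' n : ℕ, t n * rexp (-u) :=
          (Summable.of_nonneg_of_le (fun n => mul_nonneg (ht0 n) (exp_pos _).le) hle
            hs2).tsum_le_tsum hle hs2
      _ ≤ _ := by rw [tsum_mul_right]; gcongr
  have hZ : ∑' ρ, zeroTerm ρ u =
      ∑' ρ, (xiMult ρ : ℂ) * (1 / (ρ * (1 - ρ))) - ∑' ρ, zeroOsc ρ u := by
    have hs : Summable fun ρ : ℂ => (xiMult ρ : ℂ) * (1 / (ρ * (1 - ρ))) :=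
      Summable.of_norm_bounded summable_norm_one_div_mul fun ρ => by
        rw [norm_mul, Complex.norm_natCast]
    rw [← hs.tsum_sub (summable_zeroOsc hu.le)]
    refine tsum_congr fun ρ => ?_
    rw [zeroTerm, zeroOsc, expRamp, ← one_div_mul_one_div]
    ring
  have hZr : (∑' ρ, (xiMult ρ : ℂ) * (1 / (ρ * (1 - ρ)))).re = 2 * xiConst := by
    have hs : Summable fun ρ : ℂ => (xiMult ρ : ℂ) * (1 / (ρ * (1 - ρ))) :=
      Summable.of_norm_bounded summable_norm_one_div_mul fun ρ => by
        rw [norm_mul, Complex.norm_natCast]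
    rw [Complex.re_tsum hs, ← hasSum_re_one_div_mul.tsum_eq]
    refine tsum_congr fun ρ => ?_
    rw [← Complex.ofReal_natCast, Complex.re_ofReal_mul]
  have hE : expRamp 1 u = ((1 - rexp (-u) : ℝ) : ℂ) := by simp [expRamp]
  have key := congrArg Complex.re (mangoldtRamp_eq hu)
  rw [hT, hZ, hE, ← hC] at key
  simp only [Complex.sub_re, Complex.add_re, Complex.ofReal_re, Complex.re_ofReal_mul, hZr] at key
  rw [abs_le, key]
  have := exp_pos (-u)
  constructor <;> nlinarith

section ExplicitFormula
open MeasureTheory Set Filter Topology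

/-- The partial sums of `∑ Λ(n) / (n log n)`. -/
noncomputable def mangoldtLogSum (u : ℝ) : ℝ :=
  ∑ n ∈ Finset.Ioc 0 ⌊rexp u⌋₊, ArithmeticFunction.vonMangoldt n / log n / n

theorem integral_log_mul_exp_neg :
    ∫ t in Ioi (0 : ℝ), log t * rexp (-t) = -eulerMascheroniConstant := by
  have h1 := Complex.hasDerivAt_GammaIntegral (s := 1) (by simp)
  have h2 : HasDerivAt Complex.GammaIntegral (-eulerMascheroniConstant) 1 := by
    refine Complex.hasDerivAt_Gamma_one.congr_of_eventuallyEq ?_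
    filter_upwards [(isOpen_lt continuous_const Complex.continuous_re).mem_nhds
      (by simp : (1 : ℂ) ∈ {z : ℂ | 0 < z.re})] with z hz
    exact (Complex.Gamma_eq_integral hz).symm
  have h3 := h1.unique h2
  simp only [sub_self, Complex.cpow_zero, one_mul] at h3
  have h4 : (∫ t in Ioi (0 : ℝ), ((log t * rexp (-t) : ℝ) : ℂ)) = -eulerMascheroniConstant := by
    rw [← h3]; refine integral_congr_ae (ae_of_all _ fun t => ?_); push_cast; rfl
  rw [integral_complex_ofReal] at h4
  exact_mod_cast h4

theorem integrableOn_log_mul_exp_neg : IntegrableOn (fun t => log t * rexp (-t)) (Ioi 0) := by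
  by_contra h
  have := integral_log_mul_exp_neg
  rw [integral_undef h] at this
  linarith [eulerMascheroni_gt]

theorem integral_indicator_exp_neg {c : ℝ} (hc : 0 ≤ c) :
    ∫ v in Ioi (0 : ℝ), (Ici c).indicator (fun v => rexp (-v)) v = rexp (-c) := by
  rw [setIntegral_indicator measurableSet_Ici]
  rw [← integral_exp_neg_Ioi c, ← integral_Ici_eq_integral_Ioi]
  rcases hc.eq_or_lt with rfl | hc
  · have : Ioi (0 : ℝ) ∩ Ici 0 = Ioi 0 := by ext; simp; exact fun h => h.le
    rw [this, integral_Ici_eq_integral_Ioi]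
  · rw [inter_eq_self_of_subset_right]
    exact fun x hx => hc.trans_le hx

theorem tsum_mangoldt_log_indicator {s : ℝ} (hs : 0 < s) (v : ℝ) :
    ∑' n : ℕ, ArithmeticFunction.vonMangoldt n / log n / n *
      (Ici (s * log n)).indicator (fun v => rexp (-v)) v = rexp (-v) * mangoldtLogSum (v / s) := by
  rw [tsum_eq_sum (s := Finset.Ioc 0 ⌊rexp (v / s)⌋₊), mangoldtLogSum, Finset.mul_sum]
  · refine Finset.sum_congr rfl fun n hn => ?_
    rw [Finset.mem_Ioc, Nat.le_floor_iff (exp_pos _).le] at hn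
    rw [indicator_of_mem, mul_comm]
    have : log n ≤ v / s := (log_le_iff_le_exp (by exact_mod_cast hn.1)).2 hn.2
    rw [mem_Ici]; rw [le_div_iff₀ hs] at this; linarith
  · intro n hn
    rcases n.eq_zero_or_pos with rfl | h0
    · simp
    rw [indicator_of_notMem, mul_zero]
    rw [Finset.mem_Ioc, Nat.le_floor_iff (exp_pos _).le] at hn
    rw [mem_Ici]
    intro h
    exact hn ⟨h0, (log_le_iff_le_exp (by exact_mod_cast h0)).1 (by rw [le_div_iff₀ hs]; linarith)⟩

theorem log_riemannZeta_eq_integral {s : ℝ} (hs : 0 < s) :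
    log (riemannZeta ((1 + s : ℝ) : ℂ)).re =
      ∫ v in Ioi (0 : ℝ), rexp (-v) * mangoldtLogSum (v / s) := by
  have hc : ∀ n : ℕ, 0 ≤ ArithmeticFunction.vonMangoldt n / log n / n := fun n =>
    div_nonneg (div_nonneg ArithmeticFunction.vonMangoldt_nonneg (log_natCast_nonneg n))
      (Nat.cast_nonneg n)
  have hl : ∀ n : ℕ, 0 ≤ s * log n := fun n => mul_nonneg hs.le (log_natCast_nonneg n)
  set F : ℕ → ℝ → ℝ := fun n v => ArithmeticFunction.vonMangoldt n / log n / n *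
      (Ici (s * log n)).indicator (fun v => rexp (-v)) v with hF
  have hFi : ∀ n, IntegrableOn (F n) (Ioi 0) := fun n =>
    (((integrableOn_exp_neg_Ioi 0).indicator measurableSet_Ici).const_mul _)
  have hF0 : ∀ n v, 0 ≤ F n v := fun n v =>
    mul_nonneg (hc n) (indicator_nonneg (fun _ _ => (exp_pos _).le) _)
  have hInt : ∀ n, ∫ v in Ioi (0 : ℝ), F n v
      = ArithmeticFunction.vonMangoldt n / log n / n * rexp (-(s * log n)) := fun n => by
    rw [hF]; simp only []
    rw [integral_const_mul, integral_indicator_exp_neg (hl n)]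
  have hterm : ∀ n : ℕ, ArithmeticFunction.vonMangoldt n / log n / n * rexp (-(s * log n))
      = ArithmeticFunction.vonMangoldt n / log n * (n : ℝ) ^ (-(1 + s)) := fun n => by
    rcases n.eq_zero_or_pos with rfl | h0
    · simp
    have h0' : (0 : ℝ) < n := by exact_mod_cast h0
    rw [neg_add, rpow_add h0', rpow_neg_one, rpow_def_of_pos h0']
    rw [show log n * -s = -(s * log n) by ring]; ring
  have hsum : Summable fun n : ℕ => ArithmeticFunction.vonMangoldt n / log n / n *
      rexp (-(s * log n)) := by
    refine Summable.of_nonneg_of_le (fun n => mul_nonneg (hc n) (exp_pos _).le) (fun n => ?_)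
      ((summable_mangoldt_rpow (σ := 1 + s) (by linarith)).mul_left (1 / log 2))
    rw [hterm, ← mul_assoc]
    refine mul_le_mul_of_nonneg_right ?_ (by positivity)
    have hL := ArithmeticFunction.vonMangoldt_nonneg (n := n)
    rcases Nat.lt_or_ge n 2 with h | h
    · interval_cases n <;> simp
    · rw [div_eq_mul_one_div, mul_comm]
      refine mul_le_mul_of_nonneg_right ?_ hL
      exact one_div_le_one_div_of_le (log_pos (by norm_num))
        (log_le_log (by norm_num) (by exact_mod_cast h))
  have hsn : Summable fun n => ∫ v in Ioi (0 : ℝ), ‖F n v‖ := by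
    refine hsum.congr fun n => ?_
    rw [← hInt]
    exact integral_congr_ae (ae_of_all _ fun v => by simp [abs_of_nonneg (hF0 n v)])
  have key := hasSum_integral_of_summable_integral_norm hFi hsn
  have hcongr : ∫ v in Ioi (0 : ℝ), ∑' n, F n v
      = ∫ v in Ioi (0 : ℝ), rexp (-v) * mangoldtLogSum (v / s) :=
    setIntegral_congr_fun measurableSet_Ioi fun v _ => tsum_mangoldt_log_indicator hs v
  rw [hcongr] at key
  rw [log_riemannZeta_eq (by linarith), ← key.tsum_eq]
  refine tsum_congr fun n => ?_
  rw [hInt, hterm, rpow_neg (Nat.cast_nonneg n), ← div_eq_mul_inv, div_div, mul_comm (log (n : ℝ))]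

theorem mangoldtLogSum_term_nonneg (n : ℕ) : 0 ≤ ArithmeticFunction.vonMangoldt n / log n / n :=
  div_nonneg (div_nonneg ArithmeticFunction.vonMangoldt_nonneg (log_natCast_nonneg n))
    (Nat.cast_nonneg n)

theorem monotone_mangoldtLogSum : Monotone mangoldtLogSum := fun _ _ h =>
  Finset.sum_le_sum_of_subset_of_nonneg
    (Finset.Ioc_subset_Ioc_right (Nat.floor_mono (exp_le_exp.2 h)))
    fun n _ _ => mangoldtLogSum_term_nonneg n

theorem mangoldtLogSum_eq_zero {u : ℝ} (hu : u < log 2) : mangoldtLogSum u = 0 := by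
  refine Finset.sum_eq_zero fun n hn => ?_
  rw [Finset.mem_Ioc, Nat.le_floor_iff (exp_pos _).le] at hn
  have : (n : ℝ) < 2 := hn.2.trans_lt ((lt_log_iff_exp_lt (by norm_num)).1 hu)
  have : n = 1 := by have : n < 2 := by exact_mod_cast this
                     omega
  simp [this]

/-- The Abelian step of Mertens' theorem: it identifies the constant. -/
theorem eq_eulerMascheroni_of_tendsto {L : ℝ}
    (h : Tendsto (fun u => mangoldtLogSum u - log u) atTop (𝓝 L)) :
    L = eulerMascheroniConstant := by
  obtain ⟨C, hC0, hC⟩ : ∃ C, 0 ≤ C ∧ ∀ u, log 2 ≤ u → |mangoldtLogSum u - log u| ≤ C := by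
    obtain ⟨T, hT⟩ := eventually_atTop.1 ((h.abs).eventually_le_const (lt_add_one |L|))
    have hl2 : 0 < log 2 := log_pos (by norm_num)
    refine ⟨max (|L| + 1) (mangoldtLogSum T + |log (log 2)| + |log T|), by positivity,
        fun u hu => ?_⟩
    rcases le_total T u with h1 | h1
    · exact (hT u h1).trans (le_max_left _ _)
    · refine le_trans ?_ (le_max_right _ _)
      have h2 := monotone_mangoldtLogSum h1
      have h3 : 0 ≤ mangoldtLogSum u := Finset.sum_nonneg fun n _ => mangoldtLogSum_term_nonneg n
      have h4 := log_le_log hl2 hu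
      have h5 := log_le_log (hl2.trans_le hu) h1
      rw [abs_le]
      constructor <;> linarith [neg_abs_le (log (log 2)), neg_abs_le (log T), le_abs_self (log T),
        le_abs_self (log (log 2)), abs_nonneg (log T), abs_nonneg (log (log 2))]
  set G : ℝ → ℝ → ℝ := fun s v => rexp (-v) * (mangoldtLogSum (v / s) - log (v / s)) with hG
  set B : ℝ → ℝ := fun v => C * rexp (-v) + |log v * rexp (-v)| with hB
  have hBi : IntegrableOn B (Ioi 0) :=
    ((integrableOn_exp_neg_Ioi 0).const_mul C).add integrableOn_log_mul_exp_neg.abs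
  have hGm : ∀ s, 0 < s → AEStronglyMeasurable (G s) (volume.restrict (Ioi 0)) := fun s hs => by
    have h1 : Measurable fun v => mangoldtLogSum (v / s) :=
      monotone_mangoldtLogSum.measurable.comp (measurable_id.div_const s)
    have h2 : Measurable fun v : ℝ => log (v / s) := measurable_log.comp (measurable_id.div_const s)
    exact ((measurable_exp.comp measurable_neg).mul (h1.sub h2)).aestronglyMeasurable
  have hGb : ∀ s, 0 < s → s ≤ 1 → ∀ᵐ v ∂(volume.restrict (Ioi 0)), ‖G s v‖ ≤ B v := by
    intro s hs hs1
    refine (ae_restrict_iff' measurableSet_Ioi).2 (ae_of_all _ fun v hv => ?_)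
    have hv : 0 < v := hv
    simp only [hG, hB]
    rw [norm_mul, norm_of_nonneg (exp_pos _).le, abs_mul, abs_of_pos (exp_pos _), ← add_mul,
        mul_comm,
      norm_eq_abs]
    refine mul_le_mul_of_nonneg_right ?_ (exp_pos _).le
    rcases le_or_gt (log 2) (v / s) with h1 | h1
    · linarith [hC _ h1, abs_nonneg (log v)]
    · rw [mangoldtLogSum_eq_zero h1, zero_sub, abs_neg]
      have h2 : v / s ≤ 1 := by linarith [log_two_lt_d9]
      have h3 : v ≤ v / s := le_div_self hv.le hs hs1
      rw [abs_of_nonpos (log_nonpos (by positivity) h2),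
        abs_of_nonpos (log_nonpos hv.le (h3.trans h2))]
      linarith [log_le_log hv h3]
  have hlim : Tendsto (fun s => ∫ v in Ioi (0 : ℝ), G s v) (𝓝[>] 0)
      (𝓝 (∫ v in Ioi (0 : ℝ), rexp (-v) * L)) := by
    refine tendsto_integral_filter_of_dominated_convergence B ?_ ?_ hBi ?_
    · filter_upwards [self_mem_nhdsWithin] with s hs using hGm s hs
    · filter_upwards [Ioc_mem_nhdsGT one_pos] with s hs using hGb s hs.1 hs.2
    · refine (ae_restrict_iff' measurableSet_Ioi).2 (ae_of_all _ fun v hv => ?_)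
      refine (h.comp ?_).const_mul _
      exact tendsto_inv_nhdsGT_zero.const_mul_atTop hv
  rw [integral_mul_const, integral_exp_neg_Ioi_zero, one_mul] at hlim
  have hval : ∀ s ∈ Ioc (0 : ℝ) 1, ∫ v in Ioi (0 : ℝ), G s v
      = log (riemannZeta ((1 + s : ℝ) : ℂ)).re + log s + eulerMascheroniConstant := by
    intro s hs
    have hGi : IntegrableOn (G s) (Ioi 0) := hBi.mono' (hGm s hs.1) (hGb s hs.1 hs.2)
    have hA : IntegrableOn (fun v => G s v + log v * rexp (-v)) (Ioi 0) :=
      hGi.add integrableOn_log_mul_exp_neg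
    have hE : IntegrableOn (fun v => rexp (-v) * log s) (Ioi 0) :=
      (integrableOn_exp_neg_Ioi 0).mul_const _
    rw [log_riemannZeta_eq_integral hs.1]
    have : ∫ v in Ioi (0 : ℝ), rexp (-v) * mangoldtLogSum (v / s)
        = ∫ v in Ioi (0 : ℝ), (G s v + log v * rexp (-v) - rexp (-v) * log s) := by
      refine setIntegral_congr_fun measurableSet_Ioi fun v hv => ?_
      simp only [hG]
      rw [log_div (ne_of_gt hv) hs.1.ne']; ring
    rw [this, integral_sub hA hE,
      integral_add hGi integrableOn_log_mul_exp_neg, integral_log_mul_exp_neg,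
      integral_mul_const, integral_exp_neg_Ioi_zero]
    ring
  have hz : Tendsto (fun s : ℝ => log (riemannZeta ((1 + s : ℝ) : ℂ)).re + log s) (𝓝[>] 0)
      (𝓝 0) := by
    have h1 := (Asymptotics.isLittleO_one_iff ℝ).1 log_riemannZeta_add_log_sub_isLittleO_ofReal
    have h2 : Tendsto (fun s : ℝ => 1 + s) (𝓝[>] 0) (𝓝[>] 1) := by
      refine tendsto_nhdsWithin_iff.2 ⟨?_, ?_⟩
      · have : Tendsto (fun s : ℝ => 1 + s) (𝓝 0) (𝓝 (1 + 0)) :=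
          (continuous_const.add continuous_id).tendsto 0
        rw [add_zero] at this
        exact this.mono_left nhdsWithin_le_nhds
      · filter_upwards [self_mem_nhdsWithin] with s hs
        have : 0 < s := hs
        simp [this]
    refine (h1.comp h2).congr fun s => ?_
    simp
  have h5 := hz.add_const eulerMascheroniConstant
  rw [zero_add] at h5
  refine tendsto_nhds_unique hlim (h5.congr' ?_)
  filter_upwards [Ioc_mem_nhdsGT one_pos] with s hs using (hval s hs).symm

/-- The smooth weight `1 / u + 1 / u ^ 2` in the partial summation from `Λ(n) / n` to
`Λ(n) / (n log n)`. -/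
noncomputable def logWeight (u : ℝ) : ℝ := 1 / u + 1 / u ^ 2

/-- The derivative of `logWeight`. -/
noncomputable def logWeightDeriv (u : ℝ) : ℝ := -(1 / u ^ 2 + 2 / u ^ 3)

theorem hasDerivAt_logWeight {u : ℝ} (hu : 0 < u) :
    HasDerivAt logWeight (logWeightDeriv u) u := by
  have h1 := (hasDerivAt_inv hu.ne')
  have h2 := ((hasDerivAt_pow 2 u).inv (by positivity))
  have h := h1.add h2
  convert! h using 1
  · ext v; simp [logWeight]
  · rw [logWeightDeriv]; push_cast; field_simp; ring

theorem logWeight_pos {u : ℝ} (hu : 0 < u) : 0 < logWeight u := by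
  unfold logWeight; positivity

theorem logWeightDeriv_neg {u : ℝ} (hu : 0 < u) : logWeightDeriv u < 0 := by
  unfold logWeightDeriv
  have : 0 < 1 / u ^ 2 + 2 / u ^ 3 := by positivity
  linarith

theorem continuousOn_logWeightDeriv {u U : ℝ} (hu : 0 < u) :
    ContinuousOn logWeightDeriv (Icc u U) := by
  unfold logWeightDeriv
  have : ∀ x ∈ Icc u U, x ≠ 0 := fun x hx => (hu.trans_le hx.1).ne'
  fun_prop (disch := intro x hx; have := this x hx; positivity)

theorem tendsto_logWeight : Tendsto logWeight atTop (𝓝 0) := by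
  have h1 := tendsto_inv_atTop_zero (𝕜 := ℝ)
  have := h1.add (h1.mul h1)
  simp only [mul_zero, add_zero] at this
  refine this.congr fun u => ?_
  simp only [logWeight]; ring

theorem integrableOn_logWeightDeriv {u : ℝ} (hu : 0 < u) :
    IntegrableOn logWeightDeriv (Ioi u) :=
  integrableOn_Ioi_deriv_of_nonpos (hasDerivAt_logWeight hu).continuousAt.continuousWithinAt
    (fun _ hx => hasDerivAt_logWeight (hu.trans hx))
        (fun _ hx => (logWeightDeriv_neg (hu.trans hx)).le)
    tendsto_logWeight

theorem integral_logWeightDeriv {u : ℝ} (hu : 0 < u) :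
    ∫ v in Ioi u, logWeightDeriv v = -logWeight u := by
  rw [integral_Ioi_of_hasDerivAt_of_tendsto
    (hasDerivAt_logWeight hu).continuousAt.continuousWithinAt
    (fun _ hx => hasDerivAt_logWeight (hu.trans hx)) (integrableOn_logWeightDeriv hu)
    tendsto_logWeight, zero_sub]

theorem max_inv_sub_exp {n : ℕ} (hn : 0 < n) (v : ℝ) :
    max (1 / (n : ℝ) - rexp (-v)) 0 = 1 / n - rexp (-max v (log n)) := by
  have hn' : (0 : ℝ) < n := by exact_mod_cast hn
  have he : rexp (-log n) = 1 / n := by rw [exp_neg, exp_log hn', one_div]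
  rcases le_total v (log n) with h | h
  · rw [max_eq_right h, max_eq_right, he, sub_self]
    rw [← he, sub_nonpos, exp_le_exp]; linarith
  · rw [max_eq_left h, max_eq_left]
    rw [← he, sub_nonneg, exp_le_exp]; linarith

theorem integral_max_mul_logWeightDeriv {n : ℕ} (hn : 2 ≤ n) {u U : ℝ} (hu : 0 < u) (hU : u ≤ U) :
    ∫ v in u..U, max (1 / (n : ℝ) - rexp (-v)) 0 * logWeightDeriv v =
      (max (1 / (n : ℝ) - rexp (-U)) 0 * logWeight U
        - (1 / (n * log n) - rexp (-max U (log n)) / max U (log n)))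
      - (max (1 / (n : ℝ) - rexp (-u)) 0 * logWeight u
        - (1 / (n * log n) - rexp (-max u (log n)) / max u (log n))) := by
  have hn' : (1 : ℝ) < n := by exact_mod_cast hn
  have hl : 0 < log n := log_pos hn'
  have he : rexp (-log n) = 1 / n := by rw [exp_neg, exp_log (by linarith), one_div]
  have hpos : ∀ x ∈ uIcc u U, 0 < x := fun x hx => by
    rw [uIcc_of_le hU] at hx; exact hu.trans_le hx.1
  refine intervalIntegral.integral_eq_sub_of_hasDeriv_right (f := fun v =>
      max (1 / (n : ℝ) - rexp (-v)) 0 * logWeight v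
        - (1 / (n * log n) - rexp (-max v (log n)) / max v (log n))) ?_ ?_ ?_
  · have h1 : ContinuousOn logWeight (uIcc u U) := fun x hx =>
      (hasDerivAt_logWeight (hpos x hx)).continuousAt.continuousWithinAt
    have h2 : ∀ x : ℝ, max x (log n) ≠ 0 := fun x => (hl.trans_le (le_max_right _ _)).ne'
    fun_prop (disch := simpa using fun x _ => h2 x)
  · intro v hv
    have hv0 : 0 < v := by
      rw [min_eq_left hU] at hv; exact hu.trans hv.1
    rcases lt_or_ge v (log n) with h | h
    · have h0 : max (1 / (n : ℝ) - rexp (-v)) 0 = 0 := by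
        rw [max_inv_sub_exp (by omega), max_eq_right h.le, he, sub_self]
      rw [h0, zero_mul]
      refine ((hasDerivAt_const v (0 : ℝ)).congr_of_eventuallyEq ?_).hasDerivWithinAt
      filter_upwards [gt_mem_nhds h] with x hx
      rw [max_inv_sub_exp (by omega), max_eq_right hx.le, he]
      field_simp; simp
    · rw [max_inv_sub_exp (by omega), max_eq_left h]
      have h1 : HasDerivAt (fun x => rexp (-x)) (-rexp (-v)) v := by
        simpa using (hasDerivAt_neg v).exp
      have h2 := ((h1.const_sub (1 / (n : ℝ))).mul (hasDerivAt_logWeight hv0)).sub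
        ((h1.div (hasDerivAt_id v) hv0.ne').const_sub (1 / (n * log n)))
      have h3 : HasDerivAt (fun x => (1 / (n : ℝ) - rexp (-x)) * logWeight x
          - (1 / (n * log n) - rexp (-x) / x)) ((1 / (n : ℝ) - rexp (-v)) * logWeightDeriv v)
          v := by
        convert! h2 using 1
        simp only [logWeight, id]; field_simp; ring
      refine h3.hasDerivWithinAt.congr (fun x hx => ?_) ?_
      · have hx' : log n ≤ x := h.trans (le_of_lt hx)
        rw [max_inv_sub_exp (by omega), max_eq_left hx']
      · rw [max_inv_sub_exp (by omega), max_eq_left h]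
  · refine ContinuousOn.intervalIntegrable ?_
    rw [uIcc_of_le hU]
    exact (by fun_prop : Continuous fun v => max (1 / (n : ℝ) - rexp (-v)) 0).continuousOn.mul
      (continuousOn_logWeightDeriv hu)

/-- `∑ Λ(n) (1 / (n log n) - e ^ (-u) / u)` over `n ≤ e ^ u`. -/
noncomputable def mangoldtLogRamp (u : ℝ) : ℝ :=
  mangoldtLogSum u - Chebyshev.psi (rexp u) * rexp (-u) / u

theorem mangoldtLogRamp_eq_sum {u : ℝ} {N : ℕ} (hN : rexp u ≤ N) :
    mangoldtLogRamp u = ∑ n ∈ Finset.range (N + 1), ArithmeticFunction.vonMangoldt n *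
      (1 / (n * log n) - rexp (-max u (log n)) / max u (log n)) := by
  have h1 : ∑ n ∈ Finset.range (N + 1), ArithmeticFunction.vonMangoldt n *
      (1 / (n * log n) - rexp (-max u (log n)) / max u (log n))
      = ∑ n ∈ Finset.Ioc 0 ⌊rexp u⌋₊, ArithmeticFunction.vonMangoldt n *
      (1 / (n * log n) - rexp (-max u (log n)) / max u (log n)) := by
    symm
    refine Finset.sum_subset (fun n hn => ?_) fun n _ hn => ?_
    · rw [Finset.mem_Ioc] at hn
      rw [Finset.mem_range]
      have : ⌊rexp u⌋₊ ≤ N := Nat.floor_le_of_le hN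
      omega
    · rcases n.eq_zero_or_pos with rfl | h0
      · simp
      have h0' : (0 : ℝ) < n := by exact_mod_cast h0
      rw [Finset.mem_Ioc, Nat.le_floor_iff (exp_pos _).le] at hn
      have h2 : u ≤ log n := by
        by_contra h3
        exact hn ⟨h0, (log_le_iff_le_exp h0').1 (not_le.1 h3).le⟩
      rw [max_eq_right h2, exp_neg, exp_log h0']
      have : 1 / ((n : ℝ) * log n) - (n : ℝ)⁻¹ / log n = 0 := by
        rw [one_div, mul_inv, div_eq_mul_inv, sub_self]
      rw [this, mul_zero]
  rw [h1, mangoldtLogRamp, mangoldtLogSum, Chebyshev.psi, Finset.sum_mul, Finset.sum_div,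
    ← Finset.sum_sub_distrib]
  refine Finset.sum_congr rfl fun n hn => ?_
  rw [Finset.mem_Ioc, Nat.le_floor_iff (exp_pos _).le] at hn
  have h0' : (0 : ℝ) < n := by exact_mod_cast hn.1
  rw [max_eq_left ((log_le_iff_le_exp h0').2 hn.2), div_div, mul_sub, mul_comm (log (n : ℝ))]
  ring

theorem integral_mangoldtRamp_mul {u U : ℝ} (hu : 0 < u) (hU : u ≤ U) :
    ∫ v in u..U, mangoldtRamp v * logWeightDeriv v =
      (mangoldtRamp U * logWeight U - mangoldtLogRamp U)
      - (mangoldtRamp u * logWeight u - mangoldtLogRamp u) := by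
  obtain ⟨N, hN⟩ := exists_nat_ge (rexp U)
  have hv : ∀ v ≤ U, rexp v ≤ ((N : ℕ) : ℝ) := fun v h => (exp_le_exp.2 h).trans hN
  have hv1 : ∀ v ≤ U, rexp v ≤ ((N + 1 : ℕ) : ℝ) := fun v h => by
    push_cast; linarith [hv v h]
  have h1 : ∫ v in u..U, mangoldtRamp v * logWeightDeriv v
      = ∫ v in u..U, ∑ n ∈ Finset.range (N + 1), ArithmeticFunction.vonMangoldt n *
        (max (1 / (n : ℝ) - rexp (-v)) 0 * logWeightDeriv v) := by
    refine intervalIntegral.integral_congr fun v h => ?_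
    rw [uIcc_of_le hU] at h
    rw [mangoldtRamp_eq_sum (hv1 v h.2), Finset.sum_mul]
    exact Finset.sum_congr rfl fun n _ => mul_assoc _ _ _
  rw [h1, intervalIntegral.integral_finsetSum, mangoldtRamp_eq_sum (hv1 U le_rfl),
    mangoldtRamp_eq_sum (hv1 u hU), mangoldtLogRamp_eq_sum (hv U le_rfl),
    mangoldtLogRamp_eq_sum (hv u hU), Finset.sum_mul, Finset.sum_mul, ← Finset.sum_sub_distrib,
    ← Finset.sum_sub_distrib, ← Finset.sum_sub_distrib]
  · refine Finset.sum_congr rfl fun n _ => ?_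
    rw [intervalIntegral.integral_const_mul]
    rcases Nat.lt_or_ge n 2 with h | h
    · interval_cases n <;> simp
    · rw [integral_max_mul_logWeightDeriv h hu hU]; ring
  · intro n _
    refine ContinuousOn.intervalIntegrable ?_
    rw [uIcc_of_le hU]
    exact ((by fun_prop : Continuous fun v => max (1 / (n : ℝ) - rexp (-v)) 0).continuousOn.mul
      (continuousOn_logWeightDeriv hu)).const_mul _

theorem integral_sub_const_mul_logWeightDeriv (κ : ℝ) {u U : ℝ} (hu : 0 < u) (hU : u ≤ U) :
    ∫ v in u..U, (v - κ) * logWeightDeriv v =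
      ((U - κ) * logWeight U - log U + 1 / U) - ((u - κ) * logWeight u - log u + 1 / u) := by
  refine intervalIntegral.integral_eq_sub_of_hasDerivAt
    (f := fun v => (v - κ) * logWeight v - log v + 1 / v) (fun v hv => ?_) ?_
  · rw [uIcc_of_le hU] at hv
    have hv0 : 0 < v := hu.trans_le hv.1
    have h := ((((hasDerivAt_id v).sub_const κ).mul (hasDerivAt_logWeight hv0)).sub
      (hasDerivAt_log hv0.ne')).add (hasDerivAt_inv hv0.ne')
    convert! h using 1
    · ext x; simp
    · simp only [logWeight, id]; field_simp; ring
  · refine ContinuousOn.intervalIntegrable ?_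
    rw [uIcc_of_le hU]
    exact (by fun_prop : Continuous fun v : ℝ => v - κ).continuousOn.mul
      (continuousOn_logWeightDeriv hu)

theorem continuousOn_mangoldtRamp_Icc {u : ℝ} (hu : 0 < u) (U : ℝ) :
    ContinuousOn mangoldtRamp (Icc u U) := by
  have := Complex.continuous_re.comp_continuousOn continuousOn_mangoldtRamp
  have : ContinuousOn mangoldtRamp (Ici 0) := by simpa [Function.comp_def] using this
  exact this.mono fun x hx => mem_Ici.2 (hu.le.trans hx.1)

theorem integrableOn_mangoldtRamp_mul {κ M : ℝ}
    (hM : ∀ v, 0 < v → |mangoldtRamp v - v + κ| ≤ M) {u : ℝ} (hu : 0 < u) :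
    IntegrableOn (fun v => (mangoldtRamp v - v + κ) * logWeightDeriv v) (Ioi u) := by
  refine ((integrableOn_logWeightDeriv hu).abs.const_mul M).mono' ?_ ?_
  · refine ContinuousOn.aestronglyMeasurable ?_ measurableSet_Ioi
    intro x hx
    have hx1 : Icc u (x + 1) ∈ 𝓝 x := Icc_mem_nhds hx (by linarith)
    have h1 := (continuousOn_mangoldtRamp_Icc hu (x + 1)).continuousAt hx1
    have h2 := (continuousOn_logWeightDeriv (U := x + 1) hu).continuousAt hx1
    exact (((h1.sub continuousAt_id).add_const κ).mul h2).continuousWithinAt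
  · refine (ae_restrict_iff' measurableSet_Ioi).2 (ae_of_all _ fun v hv => ?_)
    rw [norm_mul, norm_eq_abs, norm_eq_abs]
    exact mul_le_mul_of_nonneg_right (hM v (hu.trans hv)) (abs_nonneg _)

theorem mangoldtLogRamp_eq {κ M : ℝ} (hM : ∀ v, 0 < v → |mangoldtRamp v - v + κ| ≤ M)
    {u : ℝ} (hu : 0 < u) :
    mangoldtLogRamp u = log u - 1 / u + eulerMascheroniConstant
      + (mangoldtRamp u - u + κ) * logWeight u
      + ∫ v in Ioi u, (mangoldtRamp v - v + κ) * logWeightDeriv v := by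
  have hcont := continuousOn_mangoldtRamp_Icc hu
  have hInt := integrableOn_mangoldtRamp_mul hM hu
  have hkey : ∀ U, u ≤ U → ∫ v in u..U, (mangoldtRamp v - v + κ) * logWeightDeriv v =
      ((mangoldtRamp U - U + κ) * logWeight U - (mangoldtLogRamp U - log U + 1 / U))
      - ((mangoldtRamp u - u + κ) * logWeight u - (mangoldtLogRamp u - log u + 1 / u)) := by
    intro U hU
    have h1 : ∀ v, (mangoldtRamp v - v + κ) * logWeightDeriv v
        = mangoldtRamp v * logWeightDeriv v - (v - κ) * logWeightDeriv v := fun v => by ring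
    simp only [h1]
    rw [intervalIntegral.integral_sub, integral_mangoldtRamp_mul hu hU,
      integral_sub_const_mul_logWeightDeriv κ hu hU]
    · ring
    · refine ContinuousOn.intervalIntegrable ?_
      rw [uIcc_of_le hU]
      exact (hcont U).mul (continuousOn_logWeightDeriv hu)
    · refine ContinuousOn.intervalIntegrable ?_
      rw [uIcc_of_le hU]
      exact (by fun_prop : Continuous fun v : ℝ => v - κ).continuousOn.mul
        (continuousOn_logWeightDeriv hu)
  have hlim1 := intervalIntegral_tendsto_integral_Ioi u hInt tendsto_id
  have hb0 : Tendsto (fun U => (mangoldtRamp U - U + κ) * logWeight U) atTop (𝓝 0) := by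
    have h1 := tendsto_logWeight.const_mul M
    rw [mul_zero] at h1
    refine squeeze_zero_norm' ?_ h1
    filter_upwards [eventually_gt_atTop 0] with U hU
    rw [norm_mul, norm_eq_abs, norm_of_nonneg (logWeight_pos hU).le]
    exact mul_le_mul_of_nonneg_right (hM U hU) (logWeight_pos hU).le
  have hp0 : Tendsto (fun U => Chebyshev.psi (rexp U) * rexp (-U) / U - 1 / U) atTop (𝓝 0) := by
    have h1 : Tendsto (fun U : ℝ => (log 4 + 4 + 1) * U⁻¹) atTop (𝓝 0) := by
      simpa using tendsto_inv_atTop_zero.const_mul (log 4 + 4 + 1)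
    refine squeeze_zero_norm' ?_ h1
    filter_upwards [eventually_gt_atTop 0] with U hU
    have h2 := Chebyshev.psi_le_const_mul_self (exp_pos U).le
    have h3 := Chebyshev.psi_nonneg (rexp U)
    have h4 : Chebyshev.psi (rexp U) * rexp (-U) ≤ log 4 + 4 := by
      rw [exp_neg, ← div_eq_mul_inv, div_le_iff₀ (exp_pos _)]; exact h2
    have h5 : 0 ≤ Chebyshev.psi (rexp U) * rexp (-U) := mul_nonneg h3 (exp_pos _).le
    rw [← sub_div, norm_div, norm_of_nonneg hU.le, div_eq_mul_inv]
    refine mul_le_mul_of_nonneg_right ?_ (by positivity)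
    rw [norm_eq_abs, abs_le]
    constructor <;> linarith
  set I := ∫ v in Ioi u, (mangoldtRamp v - v + κ) * logWeightDeriv v with hI
  have hW : Tendsto (fun U => mangoldtLogSum U - log U) atTop
      (𝓝 (0 - I - ((mangoldtRamp u - u + κ) * logWeight u -
        (mangoldtLogRamp u - log u + 1 / u)) + 0)) := by
    refine ((((hb0.sub hlim1).sub_const _)).add hp0).congr' ?_
    filter_upwards [eventually_ge_atTop u] with U hU
    simp only [id]
    rw [hkey U hU, mangoldtLogRamp, mangoldtLogRamp]
    ring
  have := eq_eulerMascheroni_of_tendsto hW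
  linarith

theorem hasSum_integral_mul_of_le {ι : Type*} {g : ι → ℝ → ℂ} {b : ι → ℝ} {u : ℝ} (hb : Summable b)
    (hg : ∀ i, Continuous (g i)) (hgb : ∀ i v, u < v → ‖g i v‖ ≤ b i)
    {φ : ℝ → ℝ} (hφ : IntegrableOn φ (Ioi u)) :
    HasSum (fun i => ∫ v in Ioi u, g i v * φ v) (∫ v in Ioi u, (∑' i, g i v) * φ v) := by
  have hsub : Function.support (fun i => ∫ v in Ioi u, g i v * φ v) ⊆ Function.support b := by
    intro i hi hbi
    apply hi
    refine setIntegral_eq_zero_of_forall_eq_zero fun v hv => ?_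
    have := hgb i v hv
    rw [hbi] at this
    rw [norm_le_zero_iff.1 this, zero_mul]
  have hsub2 : ∀ v ∈ Ioi u, (∑' i, g i v) * φ v = ∑' i : Function.support b, g i v * φ v := by
    intro v hv
    rw [tsum_mul_right, ← tsum_subtype_eq_of_support_subset (f := fun i => g i v)]
    intro i hi hbi
    apply hi
    have := hgb i v hv
    rw [hbi] at this
    exact norm_le_zero_iff.1 this
  rw [setIntegral_congr_fun measurableSet_Ioi hsub2, ← hasSum_subtype_iff_of_support_subset hsub]
  have : Countable (Function.support b) := hb.countable_support
  have hle : ∀ i v, v ∈ Ioi u → ‖g i v * φ v‖ ≤ b i * |φ v| := fun i v hv => by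
    rw [norm_mul, Complex.norm_real, norm_eq_abs]
    exact mul_le_mul_of_nonneg_right (hgb i v hv) (abs_nonneg _)
  have hI : ∀ i, IntegrableOn (fun v : ℝ => g i v * φ v) (Ioi u) := fun i => by
    refine Integrable.mono' (hφ.abs.const_mul (b i)) ?_ ?_
    · exact (hg i).aestronglyMeasurable.mul
        (Complex.continuous_ofReal.comp_aestronglyMeasurable hφ.aestronglyMeasurable)
    · exact (ae_restrict_mem measurableSet_Ioi).mono fun v hv => hle i v hv
  refine hasSum_integral_of_summable_integral_norm (fun i => hI i) ?_
  refine Summable.of_nonneg_of_le (fun i => integral_nonneg fun v => norm_nonneg _) (fun i => ?_)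
    ((hb.subtype (Function.support b)).mul_right (∫ v in Ioi u, |φ v|))
  rw [← integral_const_mul]
  exact setIntegral_mono_on (hI i).norm (hφ.abs.const_mul _) measurableSet_Ioi (hle i)

theorem hasDerivAt_logWeightDeriv {u : ℝ} (hu : 0 < u) :
    HasDerivAt logWeightDeriv (2 / u ^ 3 + 6 / u ^ 4) u := by
  have h2 := ((hasDerivAt_pow 2 u).inv (by positivity))
  have h3 := ((hasDerivAt_pow 3 u).inv (by positivity)).const_mul 2
  have h := (h2.add h3).neg
  convert! h using 1
  · ext v; simp [logWeightDeriv, div_eq_mul_inv]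
  · push_cast; field_simp; ring

theorem tendsto_logWeightDeriv : Tendsto logWeightDeriv atTop (𝓝 0) := by
  have h1 := tendsto_inv_atTop_zero (𝕜 := ℝ)
  have := ((h1.mul h1).add ((h1.mul (h1.mul h1)).const_mul 2)).neg
  simp only [mul_zero, add_zero, neg_zero] at this
  refine this.congr fun u => ?_
  simp only [logWeightDeriv]; ring

theorem norm_cexp_neg_mul (c : ℂ) (v : ℝ) : ‖Complex.exp (-(c * v))‖ = rexp (-(c.re * v)) := by
  rw [Complex.norm_exp]; simp

theorem norm_integral_cexp_mul_logWeightDeriv_le {c : ℂ} (hc : 0 < c.re) {u : ℝ} (hu : 0 < u) :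
    ‖∫ v in Ioi u, Complex.exp (-(c * v)) * logWeightDeriv v‖
      ≤ 2 * rexp (-(c.re * u)) * -logWeightDeriv u / ‖c‖ := by
  have hc0 : c ≠ 0 := fun h => by simp [h] at hc
  set ω2 : ℝ → ℝ := fun v => 2 / v ^ 3 + 6 / v ^ 4 with hω2
  have hω2nn : ∀ v, u < v → 0 ≤ ω2 v := fun v hv => by
    have : 0 < v := hu.trans hv
    simp only [hω2]; positivity
  have hi2 : IntegrableOn ω2 (Ioi u) :=
    integrableOn_Ioi_deriv_of_nonneg (hasDerivAt_logWeightDeriv hu).continuousAt.continuousWithinAt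
      (fun _ hx => hasDerivAt_logWeightDeriv (hu.trans hx)) (fun v hv => hω2nn v hv)
      tendsto_logWeightDeriv
  have hv2 : ∫ v in Ioi u, ω2 v = -logWeightDeriv u := by
    rw [integral_Ioi_of_hasDerivAt_of_tendsto
      (hasDerivAt_logWeightDeriv hu).continuousAt.continuousWithinAt
      (fun _ hx => hasDerivAt_logWeightDeriv (hu.trans hx)) hi2 tendsto_logWeightDeriv, zero_sub]
  have hmul : ∀ φ : ℝ → ℝ, IntegrableOn φ (Ioi u) →
      IntegrableOn (fun v : ℝ => Complex.exp (-(c * v)) * φ v) (Ioi u) := fun φ hφ => by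
    refine Integrable.mono' hφ.abs ?_ ?_
    · exact (by fun_prop : Continuous fun v : ℝ => Complex.exp (-(c * v))).aestronglyMeasurable.mul
        (Complex.continuous_ofReal.comp_aestronglyMeasurable hφ.aestronglyMeasurable)
    · refine (ae_restrict_mem measurableSet_Ioi).mono fun v hv => ?_
      rw [norm_mul, Complex.norm_real, norm_eq_abs, norm_cexp_neg_mul]
      refine mul_le_of_le_one_left (abs_nonneg _) (exp_le_one_iff.2 ?_)
      have : 0 < c.re * v := mul_pos hc (hu.trans hv)
      linarith
  set G : ℝ → ℂ := fun v => -(Complex.exp (-(c * v)) * logWeightDeriv v / c) with hG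
  have hGd : ∀ v : ℝ, 0 < v → HasDerivAt G
      (Complex.exp (-(c * v)) * logWeightDeriv v - Complex.exp (-(c * v)) * ω2 v / c) v := by
    intro v hv
    have h1 : HasDerivAt (fun x : ℝ => Complex.exp (-(c * x))) (Complex.exp (-(c * v)) * -c) v := by
      have := ((hasDerivAt_id v).ofReal_comp.const_mul c).neg.cexp
      simpa using this
    have h2 := ((h1.mul (hasDerivAt_logWeightDeriv hv).ofReal_comp).div_const c).neg
    convert! h2 using 1
    simp only [hω2]; push_cast; field_simp; ring
  have hGlim : Tendsto G atTop (𝓝 0) := by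
    have h1 : Tendsto (fun v => |logWeightDeriv v| / ‖c‖) atTop (𝓝 0) := by
      simpa using (tendsto_logWeightDeriv.abs).div_const ‖c‖
    refine squeeze_zero_norm' ?_ h1
    filter_upwards [eventually_gt_atTop 0] with v hv
    simp only [hG]
    rw [norm_neg, norm_div, norm_mul, Complex.norm_real, norm_eq_abs, norm_cexp_neg_mul]
    gcongr
    refine mul_le_of_le_one_left (abs_nonneg _) (exp_le_one_iff.2 ?_)
    have : 0 < c.re * v := mul_pos hc hv
    linarith
  have hI1 := hmul _ (integrableOn_logWeightDeriv hu)
  have hI2 := (hmul _ hi2).div_const c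
  have key := integral_Ioi_of_hasDerivAt_of_tendsto (hGd u hu).continuousAt.continuousWithinAt
    (fun v hv => hGd v (hu.trans hv)) (hI1.sub hI2) hGlim
  rw [integral_sub hI1 hI2, integral_div, sub_eq_iff_eq_add] at key
  rw [key]
  have hn : ‖∫ v in Ioi u, Complex.exp (-(c * v)) * ω2 v‖ ≤
      rexp (-(c.re * u)) * -logWeightDeriv u := by
    rw [← hv2, ← integral_const_mul]
    refine norm_integral_le_of_norm_le (hi2.const_mul _)
      ((ae_restrict_mem measurableSet_Ioi).mono fun v hv => ?_)
    rw [norm_mul, Complex.norm_real, norm_of_nonneg (hω2nn v hv), norm_cexp_neg_mul]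
    refine mul_le_mul_of_nonneg_right (exp_le_exp.2 ?_) (hω2nn v hv)
    have := mul_le_mul_of_nonneg_left (le_of_lt hv) hc.le
    linarith
  have hneg : ‖(logWeightDeriv u : ℂ)‖ = -logWeightDeriv u := by
    rw [Complex.norm_real, norm_of_nonpos (logWeightDeriv_neg hu).le]
  calc _ ≤ ‖0 - G u‖ + ‖(∫ v in Ioi u, Complex.exp (-(c * v)) * ω2 v) / c‖ := norm_add_le _ _
    _ ≤ rexp (-(c.re * u)) * -logWeightDeriv u / ‖c‖
        + rexp (-(c.re * u)) * -logWeightDeriv u / ‖c‖ := by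
        refine add_le_add (le_of_eq ?_) ?_
        · simp only [hG]
          rw [zero_sub, neg_neg, norm_div, norm_mul, hneg, norm_cexp_neg_mul]
        · rw [norm_div]; gcongr
    _ = _ := by ring

theorem summable_norm_zeroOsc {u : ℝ} (hu : 0 ≤ u) : Summable fun ρ => ‖zeroOsc ρ u‖ :=
  Summable.of_nonneg_of_le (fun _ => norm_nonneg _) (fun ρ => norm_zeroOsc_le ρ hu)
    summable_norm_one_div_mul

theorem norm_zeroOsc_mul_logWeight_add_le (ρ : ℂ) {u : ℝ} (hu : 0 < u) :
    ‖zeroOsc ρ u * logWeight u + ∫ v in Ioi u, zeroOsc ρ v * logWeightDeriv v‖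
      ≤ ‖zeroOsc ρ u‖ * (logWeight u + 1 / 3 * -logWeightDeriv u) := by
  by_cases h : xiFun ρ = 0
  · have hre : 0 < (1 - ρ).re := by
      have := re_lt_one_of_xiFun_eq_zero h
      simpa using this
    have him : 6 ≤ ‖1 - ρ‖ := (abs_im_ge_of_zero h).trans (by
      have := Complex.abs_im_le_norm (1 - ρ)
      simpa using this)
    have h1 := norm_integral_cexp_mul_logWeightDeriv_le hre hu
    have h2 : ∫ v in Ioi u, zeroOsc ρ v * logWeightDeriv v = xiMult ρ * (1 / (ρ * (1 - ρ))) *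
        ∫ v in Ioi u, Complex.exp (-((1 - ρ) * v)) * logWeightDeriv v := by
      rw [← integral_const_mul]
      refine integral_congr_ae (ae_of_all _ fun v => ?_)
      simp only [zeroOsc]; ring
    have hw := (logWeight_pos hu)
    have hd := (logWeightDeriv_neg hu)
    rw [mul_add]
    refine (norm_add_le _ _).trans (add_le_add (le_of_eq ?_) ?_)
    · rw [norm_mul, Complex.norm_real, norm_of_nonneg hw.le]
    · rw [h2, norm_zeroOsc, norm_mul, norm_mul, Complex.norm_natCast, mul_assoc _ (rexp _)]
      refine mul_le_mul_of_nonneg_left (h1.trans ?_) (by positivity)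
      rw [div_le_iff₀ (by linarith)]
      have : 0 ≤ rexp (-((1 - ρ.re) * u)) * -logWeightDeriv u :=
        mul_nonneg (exp_pos _).le (by linarith)
      simp only [Complex.sub_re, Complex.one_re]
      nlinarith
  · simp [zeroOsc, xiMult_eq_zero_of_ne h]

theorem integrableOn_tsum_zeroOsc_mul {u : ℝ} (hu : 0 < u) :
    IntegrableOn (fun v => (∑' ρ, zeroOsc ρ v) * (logWeightDeriv v : ℂ)) (Ioi u) := by
  have hcont : ContinuousOn (fun v => ∑' ρ, zeroOsc ρ v) (Ioi u) :=
    continuousOn_tsum (fun ρ => (continuous_zeroOsc ρ).continuousOn) summable_norm_one_div_mul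
      fun ρ v hv => norm_zeroOsc_le ρ (hu.trans hv).le
  refine Integrable.mono' ((integrableOn_logWeightDeriv hu).abs.const_mul
    (∑' ρ, (xiMult ρ : ℝ) * ‖1 / (ρ * (1 - ρ))‖)) ?_ ?_
  · exact (hcont.aestronglyMeasurable measurableSet_Ioi).mul
      (Complex.continuous_ofReal.comp_aestronglyMeasurable
        (integrableOn_logWeightDeriv hu).aestronglyMeasurable)
  · refine (ae_restrict_mem measurableSet_Ioi).mono fun v hv => ?_
    rw [norm_mul, Complex.norm_real, norm_eq_abs]
    exact mul_le_mul_of_nonneg_right (tsum_of_norm_bounded summable_norm_one_div_mul.hasSum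
      fun ρ => norm_zeroOsc_le ρ (hu.trans hv).le) (abs_nonneg _)

theorem abs_tsum_zeroOsc_le {u : ℝ} (hu : 0 < u) :
    |(∑' ρ, zeroOsc ρ u).re * logWeight u
      + ∫ v in Ioi u, (∑' ρ, zeroOsc ρ v).re * logWeightDeriv v|
      ≤ (∑' ρ, ‖zeroOsc ρ u‖) * (logWeight u + 1 / 3 * -logWeightDeriv u) := by
  have hsum := hasSum_integral_mul_of_le summable_norm_one_div_mul continuous_zeroOsc
    (fun ρ v hv => norm_zeroOsc_le ρ (hu.trans hv).le) (integrableOn_logWeightDeriv hu)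
  have hInt := integrableOn_tsum_zeroOsc_mul hu
  have hre : (∑' ρ, zeroOsc ρ u).re * logWeight u
      + ∫ v in Ioi u, (∑' ρ, zeroOsc ρ v).re * logWeightDeriv v
      = ((∑' ρ, zeroOsc ρ u) * logWeight u
        + ∫ v in Ioi u, (∑' ρ, zeroOsc ρ v) * logWeightDeriv v).re := by
    rw [Complex.add_re, Complex.re_mul_ofReal]
    congr 1
    have := integral_re hInt
    simp only [RCLike.re_eq_complex_re, Complex.re_mul_ofReal] at this
    exact this
  have h1 : HasSum (fun ρ => zeroOsc ρ u * (logWeight u : ℂ)) ((∑' ρ, zeroOsc ρ u) * logWeight u) :=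
    (summable_zeroOsc hu.le).hasSum.mul_right _
  rw [hre]
  refine (Complex.abs_re_le_norm _).trans ?_
  rw [← (h1.add hsum).tsum_eq, ← tsum_mul_right]
  exact tsum_of_norm_bounded ((summable_norm_zeroOsc hu.le).mul_right _).hasSum
    fun ρ => norm_zeroOsc_mul_logWeight_add_le ρ hu

theorem tsum_norm_zeroOsc_eq {u : ℝ} (hu : 0 ≤ u) :
    HasSum (fun ρ : ℂ => (xiMult ρ : ℝ) * ‖1 / (ρ * (1 - ρ))‖ *
      ((rexp (-((1 - ρ.re) * u)) + rexp (-(ρ.re * u))) / 2)) (∑' ρ, ‖zeroOsc ρ u‖) := by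
  have h1 := (summable_norm_zeroOsc hu).hasSum
  have h2 := (Equiv.subLeft (1 : ℂ)).hasSum_iff.2 h1
  have h3 := (h1.add h2).div_const 2
  rw [add_self_div_two] at h3
  convert! h3 using 1
  ext ρ
  simp only [Function.comp_def, Equiv.subLeft_apply]
  rw [norm_zeroOsc, norm_zeroOsc, xiMult_one_sub, sub_sub_cancel, mul_comm (1 - ρ) ρ]
  simp only [Complex.sub_re, Complex.one_re, sub_sub_cancel]
  ring

theorem tsum_norm_zeroOsc_le {u : ℝ} (hu : 0 ≤ u) :
    ∑' ρ, ‖zeroOsc ρ u‖ ≤ 0.02355 * (1 + rexp (-u)) := by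
  have h := hasSum_le (fun ρ => ?_) (tsum_norm_zeroOsc_eq hu)
    (summable_norm_one_div_mul.hasSum.mul_right ((1 + rexp (-u)) / 2))
  · refine h.trans ?_
    have := tsum_norm_one_div_mul_le
    have h2 := exp_pos (-u)
    nlinarith
  · by_cases h : xiFun ρ = 0
    · refine mul_le_mul_of_nonneg_left ?_ (by positivity)
      have h0 := re_pos_of_xiFun_eq_zero h
      have h1 := re_lt_one_of_xiFun_eq_zero h
      have c1 := convexOn_exp.2 (mem_univ (-u)) (mem_univ 0)
        (by linarith : 0 ≤ 1 - ρ.re) h0.le (by ring)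
      have c2 := convexOn_exp.2 (mem_univ (-u)) (mem_univ 0)
        h0.le (by linarith : 0 ≤ 1 - ρ.re) (by ring)
      simp only [smul_eq_mul, mul_zero, add_zero, exp_zero, mul_one, mul_neg] at c1 c2
      linarith
    · simp [xiMult_eq_zero_of_ne h]

theorem mul_tsum_norm_zeroOsc_le {u : ℝ} (hu : 40 ≤ u) :
    u * ∑' ρ, ‖zeroOsc ρ u‖ ≤ 1.0303 := by
  have hs := (summable_log_mul_norm.hasSum.mul_right (10 * rexp (-1))).add
    (summable_norm_one_div_mul.hasSum.mul_right (u * rexp (-(u / 2)) / 2))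
  have h := hasSum_le (fun ρ => ?_) ((tsum_norm_zeroOsc_eq (by linarith)).mul_left u) hs
  · refine h.trans ?_
    have h1 := tsum_norm_one_div_mul_le
    have h2 := tsum_log_mul_norm_le
    have h3 : u * rexp (-(u / 2)) ≤ 0.005 := by
      have e1 := add_one_le_exp (u / 8 - 1)
      have e2 : rexp (-(u / 2)) = rexp (-(3 * u / 8)) * rexp (-1) * (rexp (u / 8 - 1))⁻¹ := by
        rw [← exp_neg, ← exp_add, ← exp_add]; ring_nf
      have e3 : rexp (-(3 * u / 8)) ≤ rexp (-1) ^ 15 := by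
        rw [← exp_nat_mul, exp_le_exp]; push_cast; linarith
      have e4 : u / 8 * (rexp (u / 8 - 1))⁻¹ ≤ 1 := by
        rw [← div_eq_mul_inv, div_le_one (exp_pos _)]; linarith
      have e5 : rexp (-1) ≤ 1 / 2 := by linarith [exp_neg_one_lt_d9]
      calc u * rexp (-(u / 2))
          = 8 * (rexp (-(3 * u / 8)) * rexp (-1)) * (u / 8 * (rexp (u / 8 - 1))⁻¹) := by
            rw [e2]; ring
        _ ≤ 8 * (rexp (-1) ^ 15 * rexp (-1)) * 1 := by gcongr
        _ ≤ 8 * ((1 / 2) ^ 15 * (1 / 2)) * 1 := by gcongr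
        _ ≤ 0.005 := by norm_num
    have h4 : rexp (-1) ≤ 0.36788 := by
      have := exp_neg_one_lt_d9; linarith
    have h5 := exp_pos (-1)
    have h6 : 0 ≤ u * rexp (-(u / 2)) := by positivity
    nlinarith
  · by_cases h : xiFun ρ = 0
    · have h0 := re_pos_of_xiFun_eq_zero h
      have h1 := re_lt_one_of_xiFun_eq_zero h
      have hz := one_sub_re_ge_of_zero h
      have hz' := one_sub_re_ge_of_zero (ρ := 1 - ρ) (by rw [xiFun_one_sub, h])
      have him := abs_im_ge_of_zero h
      simp only [Complex.sub_im, Complex.one_im, zero_sub, abs_neg, Complex.sub_re, Complex.one_re,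
        sub_sub_cancel] at hz'
      set l := log |ρ.im| with hl
      have hl0 : 0 < l := log_pos (by linarith)
      set δ := 0.05 / l with hδ
      have hδ0 : 0 < δ := by positivity
      have hexp : u * rexp (-(δ * u)) ≤ 20 * rexp (-1) * l := by
        have e1 := add_one_le_exp (δ * u - 1)
        have e2 : rexp (-(δ * u)) = rexp (-1) * (rexp (δ * u - 1))⁻¹ := by
          rw [← exp_neg, ← exp_add]; ring_nf
        have e3 : u = 20 * l * (δ * u) := by rw [hδ]; field_simp; norm_num
        have e4 : δ * u * (rexp (δ * u - 1))⁻¹ ≤ 1 := by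
          rw [← div_eq_mul_inv, div_le_one (exp_pos _)]; linarith
        calc u * rexp (-(δ * u)) = 20 * rexp (-1) * l * (δ * u * (rexp (δ * u - 1))⁻¹) := by
              rw [e2]; nth_rewrite 1 [e3]; ring
          _ ≤ 20 * rexp (-1) * l * 1 := by gcongr
          _ = _ := mul_one _
      have hpair : rexp (-((1 - ρ.re) * u)) + rexp (-(ρ.re * u)) ≤
          rexp (-(δ * u)) + rexp (-(u / 2)) := by
        rcases le_total ρ.re (1 / 2) with hh | hh
        · rw [add_comm]
          gcongr
          nlinarith
        · gcongr
          nlinarith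
      have hw : 0 ≤ (xiMult ρ : ℝ) * ‖1 / (ρ * (1 - ρ))‖ := by positivity
      calc _ = (xiMult ρ : ℝ) * ‖1 / (ρ * (1 - ρ))‖ *
            (u * (rexp (-((1 - ρ.re) * u)) + rexp (-(ρ.re * u))) / 2) := by ring
        _ ≤ (xiMult ρ : ℝ) * ‖1 / (ρ * (1 - ρ))‖ *
            ((20 * rexp (-1) * l + u * rexp (-(u / 2))) / 2) := by
            gcongr
            nlinarith
        _ = _ := by ring
    · simp [xiMult_eq_zero_of_ne h]

theorem mangoldtLogRamp_le {u : ℝ} (hu : 0 < u) :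
    mangoldtLogRamp u ≤ log u - 1 / u + eulerMascheroniConstant
      + (∑' ρ, ‖zeroOsc ρ u‖) * (logWeight u + 1 / 3 * -logWeightDeriv u)
      + 6 * rexp (-u) * logWeight u := by
  obtain ⟨κ, hκ⟩ := exists_abs_mangoldtRamp_sub_le
  have hM : ∀ v, 0 < v → |mangoldtRamp v - v + κ| ≤ 0.0471 + 3 := fun v hv => by
    have h1 := hκ v hv
    have h2 : |(∑' ρ, zeroOsc ρ v).re| ≤ 0.0471 :=
      (Complex.abs_re_le_norm _).trans ((tsum_of_norm_bounded summable_norm_one_div_mul.hasSum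
        fun ρ => norm_zeroOsc_le ρ hv.le).trans tsum_norm_one_div_mul_le)
    have h3 : rexp (-v) ≤ 1 := exp_le_one_iff.2 (by linarith)
    rw [abs_le] at h1 h2 ⊢
    constructor <;> linarith [h1.1, h1.2, h2.1, h2.2]
  have hS : IntegrableOn (fun v => (∑' ρ, zeroOsc ρ v).re * logWeightDeriv v) (Ioi u) := by
    have := (integrableOn_tsum_zeroOsc_mul hu).re
    simp only [RCLike.re_eq_complex_re, Complex.re_mul_ofReal] at this
    exact this
  have hE : IntegrableOn (fun v => 3 * rexp (-u) * -logWeightDeriv v) (Ioi u) :=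
    (integrableOn_logWeightDeriv hu).neg.const_mul _
  have hle : ∫ v in Ioi u, (mangoldtRamp v - v + κ) * logWeightDeriv v ≤
      ∫ v in Ioi u, ((∑' ρ, zeroOsc ρ v).re * logWeightDeriv v
        + 3 * rexp (-u) * -logWeightDeriv v) := by
    refine setIntegral_mono_on (integrableOn_mangoldtRamp_mul hM hu)
      (hS.add hE) measurableSet_Ioi fun v hv => ?_
    have h1 := abs_le.1 (hκ v (hu.trans hv))
    have h2 := logWeightDeriv_neg (hu.trans hv)
    have h3 : rexp (-v) ≤ rexp (-u) := exp_le_exp.2 (neg_le_neg (le_of_lt hv))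
    nlinarith [h1.1]
  rw [integral_add hS hE, integral_const_mul,
    integral_neg, integral_logWeightDeriv hu] at hle
  have h4 := mangoldtLogRamp_eq hM hu
  have h5 := abs_le.1 (abs_tsum_zeroOsc_le hu)
  have h6 := abs_le.1 (hκ u hu)
  have h7 := logWeight_pos hu
  nlinarith [h5.2, h6.2]

/-- The error in Mertens' theorem at `exp u`, scaled by `u ^ 2`. -/
theorem sq_mul_mangoldtLogRamp_sub_le {u : ℝ} (hu : 9.9 ≤ u) :
    u ^ 2 * (mangoldtLogRamp u - (log u - 1 / u + eulerMascheroniConstant))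
      ≤ min (0.0236 * (u + 1.41)) 1.07 + 0.004 := by
  have hu0 : 0 < u := by linarith
  have h := mangoldtLogRamp_le hu0
  have e0 : u ^ 2 * logWeight u = u + 1 := by unfold logWeight; field_simp
  have e1 : u ^ 2 * (logWeight u + 1 / 3 * -logWeightDeriv u) = u + 4 / 3 + 2 / (3 * u) := by
    unfold logWeight logWeightDeriv; field_simp; ring
  have e2 : u ^ 2 * (mangoldtLogRamp u - (log u - 1 / u + eulerMascheroniConstant)) ≤
      (∑' ρ, ‖zeroOsc ρ u‖) * (u + 4 / 3 + 2 / (3 * u)) + 6 * (rexp (-u) * (u + 1)) := by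
    rw [← e1, ← e0]
    nlinarith [sq_nonneg u]
  have e3 : 2 / (3 * u) ≤ 0.07 := by rw [div_le_iff₀ (by linarith)]; linarith
  have hexp : rexp (-u) * (u + 1) ≤ 0.0006 ∧ rexp (-u) ≤ 0.0001 := by
    have a1 := add_one_le_exp (u - 9.9)
    have a2 : rexp (-u) = rexp (-1) ^ 9 * (rexp 0.9)⁻¹ * (rexp (u - 9.9))⁻¹ := by
      rw [← exp_neg, ← exp_neg, ← exp_nat_mul, ← exp_add, ← exp_add]; push_cast; ring_nf
    have a3 : rexp (-1) ^ 9 ≤ 0.36788 ^ 9 := by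
      gcongr; linarith [exp_neg_one_lt_d9]
    have a4 : (rexp 0.9)⁻¹ ≤ 2.305⁻¹ := by
      have := quadratic_le_exp_of_nonneg (x := 0.9) (by norm_num)
      gcongr; linarith
    have a5 : rexp (-1) ^ 9 * (rexp 0.9)⁻¹ ≤ 0.0000537 :=
      (mul_le_mul a3 a4 (by positivity) (by positivity)).trans (by norm_num)
    have a6 : (rexp (u - 9.9))⁻¹ * (u - 8.9) ≤ 1 := by
      rw [inv_mul_le_iff₀ (exp_pos _)]; linarith
    have a7 : (rexp (u - 9.9))⁻¹ ≤ 1 := inv_le_one_of_one_le₀ (by linarith)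
    have a8 : (rexp (u - 9.9))⁻¹ * (u + 1) ≤ 10.9 := by linarith
    constructor
    · calc _ = rexp (-1) ^ 9 * (rexp 0.9)⁻¹ * ((rexp (u - 9.9))⁻¹ * (u + 1)) := by rw [a2]; ring
        _ ≤ 0.0000537 * 10.9 := by gcongr
        _ ≤ _ := by norm_num
    · calc _ = rexp (-1) ^ 9 * (rexp 0.9)⁻¹ * (rexp (u - 9.9))⁻¹ := a2
        _ ≤ 0.0000537 * 1 := by gcongr
        _ ≤ _ := by norm_num
  have hZ := tsum_norm_zeroOsc_le hu0.le
  have hZ0 : 0 ≤ ∑' ρ, ‖zeroOsc ρ u‖ := tsum_nonneg fun _ => norm_nonneg _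
  have hA : (∑' ρ, ‖zeroOsc ρ u‖) * (u + 4 / 3 + 2 / (3 * u)) ≤ 0.0236 * (u + 1.41) := by
    have : 0 ≤ 2 / (3 * u) := by positivity
    calc _ ≤ 0.0236 * (u + 4 / 3 + 2 / (3 * u)) := by gcongr; linarith [hexp.2]
      _ ≤ _ := by linarith
  have hB : (∑' ρ, ‖zeroOsc ρ u‖) * (u + 4 / 3 + 2 / (3 * u)) ≤ 1.07 := by
    rcases le_total u 40 with h40 | h40
    · linarith
    · have h1 := mul_tsum_norm_zeroOsc_le h40
      have h2 : 2 / (3 * u) ≤ 2 / 120 := by gcongr; linarith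
      have h3 : u + 4 / 3 + 2 / (3 * u) ≤ u * (1 + 1.35 / 40) := by linarith
      calc _ ≤ (∑' ρ, ‖zeroOsc ρ u‖) * (u * (1 + 1.35 / 40)) := by gcongr
        _ = (u * ∑' ρ, ‖zeroOsc ρ u‖) * (1 + 1.35 / 40) := by ring
        _ ≤ 1.0303 * (1 + 1.35 / 40) := by gcongr
        _ ≤ _ := by norm_num
  have := le_min hA hB
  linarith [hexp.1]

end ExplicitFormula

section PrimeProducts
open Finset

/-- The logarithm of the Euler factor `(1 - 1 / x)⁻¹`. -/
noncomputable def logEulerFactor (x : ℝ) : ℝ := -log (1 - x⁻¹)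

theorem one_sub_inv_pos {x : ℝ} (hx : 1 < x) : 0 < 1 - x⁻¹ := sub_pos.2 (inv_lt_one_of_one_lt₀ hx)

theorem logEulerFactor_anti {x y : ℝ} (hx : 1 < x) (hxy : x ≤ y) :
    logEulerFactor y ≤ logEulerFactor x :=
  neg_le_neg (log_le_log (one_sub_inv_pos hx) (by gcongr))

theorem inv_le_logEulerFactor {x : ℝ} (hx : 1 < x) : x⁻¹ ≤ logEulerFactor x := by
  have := log_le_sub_one_of_pos (one_sub_inv_pos hx)
  unfold logEulerFactor; linarith

theorem logEulerFactor_le {x : ℝ} (hx : 1 < x) : logEulerFactor x ≤ (x - 1)⁻¹ := by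
  have h := log_le_sub_one_of_pos (inv_pos.2 (one_sub_inv_pos hx))
  have : (1 - x⁻¹)⁻¹ - 1 = (x - 1)⁻¹ := by
    have : x - 1 ≠ 0 := by linarith
    have : x ≠ 0 := by linarith
    field_simp; ring
  rw [log_inv, this] at h
  exact h

theorem logEulerFactor_sub_sum_le {x : ℝ} (hx : 1 < x) (L : ℕ) :
    logEulerFactor x - ∑ k ∈ Icc 1 L, 1 / (k * x ^ k) ≤
        (x⁻¹) ^ (L + 1) / ((L + 1) * (1 - x⁻¹)) := by
  have hx0 : 0 ≤ x⁻¹ := by positivity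
  have hs := hasSum_pow_div_log_of_abs_lt_one (x := x⁻¹)
    (by rw [abs_of_nonneg hx0]; exact inv_lt_one_of_one_lt₀ hx)
  have h1 := hs.summable.sum_add_tsum_nat_add L
  rw [hs.tsum_eq] at h1
  have h2 : ∑ k ∈ Icc 1 L, 1 / (k * x ^ k) = ∑ i ∈ range L, (x⁻¹) ^ (i + 1) / (i + 1) := by
    clear h1
    induction L with
    | zero => simp
    | succ n ih =>
      rw [sum_Icc_succ_top (by omega), sum_range_succ, ih]
      congr 1
      rw [inv_pow]; push_cast; field_simp
  have hg := (hasSum_geometric_of_lt_one hx0 (inv_lt_one_of_one_lt₀ hx)).mul_left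
    ((x⁻¹) ^ (L + 1) / (L + 1))
  have h3 := ((summable_nat_add_iff L).2 hs.summable).tsum_le_tsum (fun n => ?_) hg.summable
  · rw [hg.tsum_eq, ← div_eq_mul_inv, div_div] at h3
    rw [logEulerFactor, h2]
    linarith
  · rw [div_mul_eq_mul_div, ← pow_add]
    have : n + L + 1 = L + 1 + n := by ring
    rw [this]
    gcongr
    simp

theorem log_div_totient {N : ℕ} (hN : N ≠ 0) :
    log (N / N.totient) = ∑ p ∈ N.primeFactors, logEulerFactor p := by
  have h := congrArg (Rat.cast : ℚ → ℝ) (Nat.totient_eq_mul_prod_factors N)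
  push_cast at h
  have hN' : (N : ℝ) ≠ 0 := by exact_mod_cast hN
  have h2 : ∀ p ∈ N.primeFactors, (1 - (p : ℝ)⁻¹) ≠ 0 := fun p hp =>
    (one_sub_inv_pos (by exact_mod_cast (Nat.prime_of_mem_primeFactors hp).one_lt)).ne'
  rw [h, div_mul_cancel_left₀ hN', log_inv, log_prod h2, ← sum_neg_distrib]
  rfl

theorem sum_log_primeFactors_le {N : ℕ} (hN : N ≠ 0) : ∑ p ∈ N.primeFactors, log p ≤ log N := by
  rw [← log_prod fun p hp => by exact_mod_cast (Nat.prime_of_mem_primeFactors hp).ne_zero]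
  have h : ∏ p ∈ N.primeFactors, p ≤ N := Nat.le_of_dvd hN.bot_lt (Nat.prod_primeFactors_dvd N)
  have h' : ∏ p ∈ N.primeFactors, (p : ℝ) ≤ N := by rw [← Nat.cast_prod]; exact_mod_cast h
  refine log_le_log (prod_pos fun p hp => ?_) h'
  exact_mod_cast (Nat.prime_of_mem_primeFactors hp).pos

/-- Exchanging elements of `S` for elements of `P` along a threshold. -/
theorem sum_le_sum_add_mul {α : Type*} [DecidableEq α] (S P : Finset α) (f g : α → ℝ) (c : ℝ)
    (hP : ∀ p ∈ P \ S, c * g p ≤ f p) (hS : ∀ p ∈ S \ P, f p ≤ c * g p) :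
    ∑ p ∈ S, f p ≤ ∑ p ∈ P, f p + c * (∑ p ∈ S, g p - ∑ p ∈ P, g p) := by
  have h1 := sum_le_sum hP
  have h2 := sum_le_sum hS
  rw [← mul_sum] at h1 h2
  rw [← sum_inter_add_sum_sdiff S P f, ← sum_inter_add_sum_sdiff P S f,
    ← sum_inter_add_sum_sdiff S P g, ← sum_inter_add_sum_sdiff P S g, inter_comm P S]
  linarith

theorem log_div_totient_le {N : ℕ} {X : ℝ} (hX : 1 < X) (hN : N ≠ 0) (hNX : log N ≤ X) :
    log (N / N.totient) ≤ ∑ p ∈ Nat.primesLE ⌊X⌋₊, logEulerFactor p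
      + logEulerFactor X / log X * (X - Chebyshev.theta X) := by
  have hf := (inv_pos.2 (zero_lt_one.trans hX)).trans_le (inv_le_logEulerFactor hX)
  have hl := log_pos hX
  rw [log_div_totient hN, Chebyshev.theta_eq_sum_primesLE]
  refine (sum_le_sum_add_mul _ (Nat.primesLE ⌊X⌋₊) _ (fun p => log p)
    (logEulerFactor X / log X) ?_ ?_).trans ?_
  · intro p hp
    have hp := (mem_sdiff.1 hp).1
    rw [Nat.mem_primesLE, Nat.le_floor_iff (by linarith)] at hp
    have h1 : (1 : ℝ) < p := by exact_mod_cast hp.2.one_lt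
    have h2 := logEulerFactor_anti h1 hp.1
    have h3 := log_le_log (by linarith) hp.1
    have h4 := log_pos h1
    rw [div_mul_eq_mul_div, div_le_iff₀ hl]
    exact mul_le_mul h2 h3 h4.le (hf.le.trans h2)
  · intro p hp
    obtain ⟨hp, hp'⟩ := mem_sdiff.1 hp
    have hp := Nat.prime_of_mem_primeFactors hp
    rw [Nat.mem_primesLE, Nat.le_floor_iff (by linarith)] at hp'
    have h1 : X ≤ p := by by_contra! h; exact hp' ⟨h.le, hp⟩
    have h2 := logEulerFactor_anti hX h1
    have h3 := log_le_log (by linarith) h1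
    rw [div_mul_eq_mul_div, le_div_iff₀ hl]
    exact mul_le_mul h2 h3 hl.le hf.le
  · have := (sum_log_primeFactors_le hN).trans hNX
    gcongr


theorem card_primesLE_le (n : ℕ) : (#(Nat.primesLE n) : ℝ) ≤ n / 2 + 1 := by
  rw [Nat.primesLE_card_eq_primeCounting]
  rcases lt_or_ge n 2 with h | h
  · interval_cases n <;> norm_num
  obtain ⟨m, rfl⟩ := Nat.exists_eq_add_of_le' h
  have h1 := Nat.primeCounting'_add_le (a := 2) (k := 3) (by norm_num) (by norm_num) m
  have h2 : Nat.primeCounting' 3 = 1 := by decide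
  rw [h2, Nat.totient_two, add_comm 3 m, one_mul] at h1
  have h3 : ((m / 2 : ℕ) : ℝ) ≤ m / 2 := Nat.cast_div_le
  have h4 : (Nat.primeCounting (m + 2) : ℝ) ≤ 1 + ((m / 2 : ℕ) + 1) := by exact_mod_cast h1
  push_cast
  linarith

theorem logEulerFactor_sub_sum_filter_le {p M N : ℕ} {X : ℝ} (hp : p.Prime) (hpM : p ≤ M)
    (hN : M < 2 ^ N) (hX : 0 < X) (hXM : X ≤ M + 1) :
    logEulerFactor p - ∑ k ∈ Icc 1 N with p ^ k ≤ M, 1 / ((k : ℝ) * (p : ℝ) ^ k) ≤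
      if p ≤ M.sqrt then 2 / (3 * X) else 1 / 2 * (((p - 1 : ℕ) : ℝ)⁻¹ - (p : ℝ)⁻¹) := by
  have hM0 : M ≠ 0 := by have := hp.pos; omega
  have hf : {k ∈ Icc 1 N | p ^ k ≤ M} = Icc 1 (Nat.log p M) := by
    ext k
    simp only [mem_filter, mem_Icc]
    rw [and_assoc, ← Nat.le_log_iff_pow_le hp.one_lt hM0]
    refine and_congr_right fun _ => and_iff_right_of_imp fun h => h.trans ?_
    exact (Nat.log_anti_left one_lt_two hp.two_le).trans (Nat.log_lt_of_lt_pow hM0 hN).le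
  have h1 : (1 : ℝ) < p := by exact_mod_cast hp.one_lt
  have h2 : (2 : ℝ) ≤ p := by exact_mod_cast hp.two_le
  rw [hf]
  refine (logEulerFactor_sub_sum_le h1 _).trans ?_
  have hlt : M + 1 ≤ p ^ (Nat.log p M + 1) := Nat.lt_pow_succ_log_self hp.one_lt M
  have hlt' : (M + 1 : ℝ) ≤ p ^ (Nat.log p M + 1) := by exact_mod_cast hlt
  split_ifs with h
  · have hL : 2 ≤ Nat.log p M :=
      Nat.le_log_of_pow_le hp.one_lt (by rw [sq]; exact Nat.le_sqrt.1 h)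
    have hL' : (2 : ℝ) ≤ Nat.log p M := by exact_mod_cast hL
    have h3 : (p : ℝ)⁻¹ ≤ 1 / 2 := by
      rw [inv_le_comm₀ (by linarith) (by norm_num)]
      norm_num
      exact hp.two_le
    rw [inv_pow, div_le_div_iff₀ (by nlinarith) (by positivity)]
    have h4 : ((p : ℝ) ^ (Nat.log p M + 1))⁻¹ ≤ X⁻¹ := inv_anti₀ hX (hXM.trans hlt')
    have h5 : X⁻¹ * X = 1 := inv_mul_cancel₀ hX.ne'
    nlinarith
  · have hL : Nat.log p M = 1 := by
      rw [Nat.log_eq_one_iff']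
      exact ⟨hpM, by by_contra! h'; exact h (Nat.le_sqrt.2 h')⟩
    rw [hL, Nat.cast_sub hp.one_le, Nat.cast_one]
    refine le_of_eq ?_
    have h3 : (p : ℝ) - 1 ≠ 0 := by linarith
    have h4 : (p : ℝ) ≠ 0 := by linarith
    have h5 : 1 - (p : ℝ)⁻¹ ≠ 0 := (one_sub_inv_pos h1).ne'
    rw [show 1 - (p : ℝ)⁻¹ = (p - 1) / p by field_simp]
    simp only [inv_pow]
    push_cast
    field_simp
    ring

theorem sum_logEulerFactor_le {u : ℝ} (hu : 1 ≤ u) :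
    ∑ p ∈ Nat.primesLE ⌊rexp u⌋₊, logEulerFactor p ≤ mangoldtLogSum u
      + 1 / (2 * (√(rexp u) - 1)) + (√(rexp u) / 2 + 1) * (2 / (3 * rexp u)) := by
  set X := rexp u with hX
  set M := ⌊X⌋₊ with hM
  have hX0 : 0 < X := exp_pos u
  have hXM : X ≤ M + 1 := (Nat.lt_floor_add_one X).le
  have h1 : ∑ p ∈ Nat.primesLE M, ∑ k ∈ Icc 1 M with p ^ k ≤ M, 1 / ((k : ℝ) * (p : ℝ) ^ k)
      ≤ mangoldtLogSum u := by
    have ht : ∀ p ∈ Nat.primesLE M, ∀ k ∈ {k ∈ Icc 1 M | p ^ k ≤ M}, 1 / ((k : ℝ) * (p : ℝ) ^ k) =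
        ArithmeticFunction.vonMangoldt (p ^ k) / log ((p ^ k : ℕ) : ℝ) / ((p ^ k : ℕ) : ℝ) := by
      intro p hp k hk
      have hp := Nat.prime_of_mem_primesLE hp
      have hk : k ≠ 0 := by have := (mem_Icc.1 (mem_filter.1 hk).1).1; omega
      rw [ArithmeticFunction.vonMangoldt_apply_pow hk,
        ArithmeticFunction.vonMangoldt_apply_prime hp, Nat.cast_pow, log_pow]
      have h1 : log p ≠ 0 := (log_pos (by exact_mod_cast hp.one_lt)).ne'
      have h2 : (p : ℝ) ≠ 0 := by exact_mod_cast hp.ne_zero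
      field_simp
    rw [sum_congr rfl fun p hp => sum_congr rfl (ht p hp),
      sum_sigma' (Nat.primesLE M) (fun p => {k ∈ Icc 1 M | p ^ k ≤ M}) (fun p k =>
        ArithmeticFunction.vonMangoldt (p ^ k) / log ((p ^ k : ℕ) : ℝ) / ((p ^ k : ℕ) : ℝ)),
      ← sum_image (g := fun x : (_ : ℕ) × ℕ => x.1 ^ x.2) (f := fun n =>
        ArithmeticFunction.vonMangoldt n / log n / n)]
    · refine sum_le_sum_of_subset_of_nonneg ?_ fun n _ _ => mangoldtLogSum_term_nonneg n
      intro n hn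
      obtain ⟨⟨p, k⟩, hx, rfl⟩ := mem_image.1 hn
      simp only [mem_sigma, mem_filter, Nat.mem_primesLE] at hx
      exact mem_Ioc.2 ⟨pow_pos hx.1.2.pos _, hx.2.2⟩
    · rintro ⟨p, k⟩ hx ⟨q, l⟩ hy hxy
      simp only [coe_sigma, Set.mem_sigma_iff, mem_coe, mem_filter, Nat.mem_primesLE,
        mem_Icc] at hx hy hxy
      have h1 := hx.1.2.pow_minFac (k := k) (by omega)
      rw [hxy, hy.1.2.pow_minFac (by omega)] at h1
      subst h1
      rw [Nat.pow_right_injective hy.1.2.two_le hxy]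
  have h2 : ∑ p ∈ Nat.primesLE M, (logEulerFactor p
      - ∑ k ∈ Icc 1 M with p ^ k ≤ M, 1 / ((k : ℝ) * (p : ℝ) ^ k)) ≤
      ∑ p ∈ Nat.primesLE M, if p ≤ M.sqrt then 2 / (3 * X) else
        1 / 2 * (((p - 1 : ℕ) : ℝ)⁻¹ - (p : ℝ)⁻¹) := sum_le_sum fun p hp => by
    rw [Nat.mem_primesLE] at hp
    exact logEulerFactor_sub_sum_filter_le hp.2 hp.1 Nat.lt_two_pow_self hX0 hXM
  have hs : (M.sqrt : ℝ) ≤ √X := by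
    rw [← Real.sqrt_sq (Nat.cast_nonneg M.sqrt)]
    refine sqrt_le_sqrt (le_trans ?_ (Nat.floor_le hX0.le))
    exact_mod_cast Nat.sqrt_le' M
  have hs1 : √X - 1 ≤ M.sqrt := by
    have : √X ≤ M.sqrt + 1 := by
      rw [Real.sqrt_le_left (by positivity)]
      refine hXM.trans ?_
      exact_mod_cast Nat.succ_le_succ_sqrt' M
    linarith
  have hX1 : 1 < √X := by
    rw [Real.lt_sqrt zero_le_one]; simp [hX]; linarith
  rw [sum_ite, sum_const, nsmul_eq_mul] at h2
  have h3 : (#{p ∈ Nat.primesLE M | p ≤ M.sqrt} : ℝ) ≤ √X / 2 + 1 := by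
    refine le_trans ?_ ((card_primesLE_le M.sqrt).trans (by gcongr))
    gcongr
    intro p hp
    rw [mem_filter, Nat.mem_primesLE] at hp
    exact Nat.mem_primesLE.2 ⟨hp.2, hp.1.2⟩
  have h4 : ∑ p ∈ Nat.primesLE M with ¬ p ≤ M.sqrt, 1 / 2 * (((p - 1 : ℕ) : ℝ)⁻¹ - (p : ℝ)⁻¹) ≤
      1 / (2 * (√X - 1)) := by
    have hsub : {p ∈ Nat.primesLE M | ¬ p ≤ M.sqrt} ⊆ Ioc M.sqrt M := fun p hp => by
      rw [mem_filter, Nat.mem_primesLE] at hp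
      exact mem_Ioc.2 ⟨not_le.1 hp.2, hp.1.1⟩
    have hpos : 0 < M.sqrt := by exact_mod_cast (sub_pos.2 hX1).trans_le hs1
    refine (sum_le_sum_of_subset_of_nonneg hsub fun p hp _ => ?_).trans ?_
    · have : 2 ≤ p := by have := (mem_Ioc.1 hp).1; omega
      have h5 : (0 : ℝ) < (p - 1 : ℕ) := by exact_mod_cast (by omega)
      have : (p : ℝ)⁻¹ ≤ ((p - 1 : ℕ) : ℝ)⁻¹ := by gcongr; omega
      linarith
    · have ht : ∀ m, M.sqrt ≤ m → ∑ p ∈ Ioc M.sqrt m, (((p - 1 : ℕ) : ℝ)⁻¹ - (p : ℝ)⁻¹) =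
          (M.sqrt : ℝ)⁻¹ - (m : ℝ)⁻¹ := fun m hm => by
        induction m, hm using Nat.le_induction with
        | base => simp
        | succ m hm ih => rw [sum_Ioc_succ_top hm, ih]; simp
      rw [← mul_sum, ht M (Nat.sqrt_le_self M)]
      have h6 : (M.sqrt : ℝ)⁻¹ ≤ (√X - 1)⁻¹ := inv_anti₀ (by linarith) hs1
      have h7 : 0 ≤ (M : ℝ)⁻¹ := by positivity
      rw [one_div (2 * _), mul_inv]
      linarith
  rw [sum_sub_distrib] at h2
  have h5 : (#{p ∈ Nat.primesLE M | p ≤ M.sqrt} : ℝ) * (2 / (3 * X)) ≤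
    (√X / 2 + 1) * (2 / (3 * X)) := by gcongr
  linarith

end PrimeProducts

section LargeRange

theorem exp_neg_le_of_pow_le {x c : ℝ} {a b : ℕ} (hb : b ≠ 0) (hc : 0 ≤ c) (h : (a : ℝ) ≤ b * x)
    (hac : (0.36788 : ℝ) ^ a ≤ c ^ b) : rexp (-x) ≤ c := by
  refine le_of_pow_le_pow_left₀ hb hc (le_trans ?_ hac)
  calc rexp (-x) ^ b = rexp (-(b * x)) := by rw [← exp_nat_mul]; ring_nf
    _ ≤ rexp (-a) := exp_le_exp.2 (by linarith)
    _ = rexp (-1) ^ a := by rw [← exp_nat_mul]; ring_nf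
    _ ≤ _ := by gcongr; linarith [exp_neg_one_lt_d9]

theorem psi_sub_theta_le_of_large {u : ℝ} (hu : 9.9 ≤ u) :
    Chebyshev.psi (rexp u) - Chebyshev.theta (rexp u) ≤
      √(rexp u) * (1.3864 + u * rexp (-u / 4) + 5.3864 * (rexp (-u / 6) + rexp (-u * 3 / 10))) := by
  have h4 : log 4 ≤ 1.3864 := by
    rw [show (4 : ℝ) = 2 ^ 2 by norm_num, log_pow]; push_cast; linarith [log_two_lt_d9]
  have h := Chebyshev.psi_sub_theta_le_psi_add_psi_add_psi (rexp u)
  simp only [← exp_mul] at h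
  have hsq : √(rexp u) = rexp (u / 2) := by rw [← exp_half]
  have h2 := Chebyshev.psi_le (x := rexp (u * 2⁻¹)) (one_le_exp (by linarith))
  have h3 := Chebyshev.psi_le_const_mul_self (x := rexp (u * 3⁻¹)) (exp_pos _).le
  have h5 := Chebyshev.psi_le_const_mul_self (x := rexp (u * 5⁻¹)) (exp_pos _).le
  have e2 : √(rexp (u * 2⁻¹)) = rexp (u / 2) * rexp (-u / 4) := by
    rw [← exp_half, ← exp_add]; ring_nf
  have e3 : rexp (u * 3⁻¹) = rexp (u / 2) * rexp (-u / 6) := by rw [← exp_add]; ring_nf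
  have e5 : rexp (u * 5⁻¹) = rexp (u / 2) * rexp (-u * 3 / 10) := by rw [← exp_add]; ring_nf
  rw [e2, log_exp] at h2
  rw [e3] at h3
  rw [e5] at h5
  rw [e3, e5] at h
  have p1 : log 4 * rexp (u * 2⁻¹) ≤ 1.3864 * rexp (u * 2⁻¹) := by gcongr
  have p3 : (log 4 + 4) * (rexp (u / 2) * rexp (-u / 6)) ≤
    5.3864 * (rexp (u / 2) * rexp (-u / 6)) := by gcongr; linarith
  have p5 : (log 4 + 4) * (rexp (u / 2) * rexp (-u * 3 / 10)) ≤
    5.3864 * (rexp (u / 2) * rexp (-u * 3 / 10)) := by gcongr; linarith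
  have e1 : rexp (u * 2⁻¹) = rexp (u / 2) := by ring_nf
  rw [e1] at h h2 p1
  rw [hsq]
  linarith

/-- The contribution of the prime powers exceeding `X = exp u`, together with `ψ - θ`. -/
theorem prime_power_terms_le {u : ℝ} (hu : 9.9 ≤ u) :
    1 / (2 * (√(rexp u) - 1)) + (√(rexp u) / 2 + 1) * (2 / (3 * rexp u)) +
      (Chebyshev.psi (rexp u) - Chebyshev.theta (rexp u)) / (rexp u * u) + 1 / ((rexp u - 1) * u)
      ≤ 1.21 * rexp (-u / 2) := by
  have h4 : rexp (-u / 4) ≤ 0.085 := by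
    rw [neg_div]; exact exp_neg_le_of_pow_le (a := 99) (b := 40) (by norm_num) (by norm_num)
      (by push_cast; linarith) (by norm_num)
  have h6 : rexp (-u / 6) ≤ 0.195 := by
    rw [neg_div]; exact exp_neg_le_of_pow_le (a := 33) (b := 20) (by norm_num) (by norm_num)
      (by push_cast; linarith) (by norm_num)
  have h10 : rexp (-u * 3 / 10) ≤ 0.055 := by
    rw [neg_mul, neg_div]
    exact exp_neg_le_of_pow_le (a := 59) (b := 20) (by norm_num) (by norm_num)
      (by push_cast; linarith) (by norm_num)
  have h2 : rexp (-u / 2) ≤ 0.0072 := by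
    rw [neg_div]; exact exp_neg_le_of_pow_le (a := 99) (b := 20) (by norm_num) (by norm_num)
      (by push_cast; linarith) (by norm_num)
  have hsq : √(rexp u) = (rexp (-u / 2))⁻¹ := by rw [← exp_half, ← exp_neg]; ring_nf
  have hX : rexp u = (rexp (-u / 2))⁻¹ ^ 2 := by rw [← exp_neg, ← exp_nat_mul]; push_cast; ring_nf
  have hpsi := psi_sub_theta_le_of_large hu
  rw [hsq] at hpsi ⊢
  set ε := rexp (-u / 2) with hε
  have hε0 : 0 < ε := exp_pos _
  have t1 : 1 / (2 * (ε⁻¹ - 1)) ≤ 0.504 * ε := by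
    rw [show 1 / (2 * (ε⁻¹ - 1)) = ε / (2 * (1 - ε)) by field_simp, div_le_iff₀ (by linarith)]
    nlinarith
  have t2 : (ε⁻¹ / 2 + 1) * (2 / (3 * rexp u)) ≤ 0.339 * ε := by
    rw [hX, show (ε⁻¹ / 2 + 1) * (2 / (3 * ε⁻¹ ^ 2)) = ε * (1 / 3 + 2 / 3 * ε) by field_simp]
    nlinarith
  have t3 : (Chebyshev.psi (rexp u) - Chebyshev.theta (rexp u)) / (rexp u * u) ≤ 0.363 * ε := by
    rw [div_le_iff₀ (by positivity)]
    refine hpsi.trans ?_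
    rw [hX, show 0.363 * ε * (ε⁻¹ ^ 2 * u) = ε⁻¹ * (0.363 * u) by field_simp]
    gcongr
    nlinarith
  have t4 : 1 / ((rexp u - 1) * u) ≤ 0.001 * ε := by
    rw [hX, show 1 / ((ε⁻¹ ^ 2 - 1) * u) = ε * (ε / ((1 - ε ^ 2) * u)) by
      have : 1 - ε ^ 2 ≠ 0 := by nlinarith
      have : ε⁻¹ ^ 2 - 1 ≠ 0 := by
        rw [show ε⁻¹ ^ 2 - 1 = (1 - ε ^ 2) / ε ^ 2 by field_simp]; positivity
      field_simp, mul_comm 0.001]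
    gcongr
    have h8 : ε ^ 2 ≤ 0.001 := by nlinarith
    have h9 : 9 ≤ (1 - ε ^ 2) * u := by nlinarith
    rw [div_le_iff₀ (by linarith)]
    linarith
  linarith

theorem log_div_totient_le_of_large {N : ℕ} {u : ℝ} (hu : 9.9 ≤ u) (hN : N ≠ 0)
    (hNu : log N ≤ rexp u) :
    log (N / N.totient) ≤ log u + eulerMascheroniConstant + 1.35 / u ^ 2 := by
  have hu0 : 0 < u := by linarith
  have hX : 1 < rexp u := one_lt_exp_iff.2 hu0
  have h1 := log_div_totient_le hX hN hNu
  rw [log_exp] at h1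
  have h2 := sum_logEulerFactor_le (u := u) (by linarith)
  have h3 := prime_power_terms_le hu
  have h4 := sq_mul_mangoldtLogRamp_sub_le hu
  have h5 : mangoldtLogSum u = mangoldtLogRamp u +
      Chebyshev.psi (rexp u) / (rexp u * u) := by
    unfold mangoldtLogRamp; rw [exp_neg]; field_simp; ring
  have h6 : logEulerFactor (rexp u) / u * (rexp u - Chebyshev.theta (rexp u)) ≤
      1 / u - Chebyshev.theta (rexp u) / (rexp u * u) + 1 / ((rexp u - 1) * u) := by
    have hX1 : 0 < rexp u - 1 := by linarith
    have a1 := inv_le_logEulerFactor hX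
    have a2 := logEulerFactor_le hX
    have hth := Chebyshev.theta_nonneg (rexp u)
    have a3 : 1 / u - Chebyshev.theta (rexp u) / (rexp u * u) =
      (rexp u)⁻¹ / u * (rexp u - Chebyshev.theta (rexp u)) := by field_simp
    rcases le_total (Chebyshev.theta (rexp u)) (rexp u) with h | h
    · have a4 : (rexp u - 1)⁻¹ / u * (rexp u - Chebyshev.theta (rexp u)) =
        (rexp u)⁻¹ / u * (rexp u - Chebyshev.theta (rexp u)) + 1 / ((rexp u - 1) * u) *
          ((rexp u - Chebyshev.theta (rexp u)) / rexp u) := by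
        field_simp; ring
      have a5 : (rexp u - Chebyshev.theta (rexp u)) / rexp u ≤ 1 := by
        rw [div_le_one (exp_pos u)]; linarith
      have a6 : 1 / ((rexp u - 1) * u) * ((rexp u - Chebyshev.theta (rexp u)) / rexp u) ≤
        1 / ((rexp u - 1) * u) := mul_le_of_le_one_right (by positivity) a5
      have a7 : logEulerFactor (rexp u) / u * (rexp u - Chebyshev.theta (rexp u)) ≤
        (rexp u - 1)⁻¹ / u * (rexp u - Chebyshev.theta (rexp u)) :=
        mul_le_mul_of_nonneg_right (by gcongr) (by linarith)
      linarith
    · have a7 : logEulerFactor (rexp u) / u * (rexp u - Chebyshev.theta (rexp u)) ≤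
        (rexp u)⁻¹ / u * (rexp u - Chebyshev.theta (rexp u)) :=
        mul_le_mul_of_nonpos_right (by gcongr) (by linarith)
      have : 0 ≤ 1 / ((rexp u - 1) * u) := by positivity
      linarith
  have h7 : u ^ 2 * rexp (-u / 2) ≤ 0.706 * rexp (-(0.2979 * (u - 9.9))) := by
    have b1 : rexp (-4.95) ≤ 0.0072 := exp_neg_le_of_pow_le (a := 99) (b := 20) (by norm_num)
      (by norm_num) (by norm_num) (by norm_num)
    have b2 : u ≤ 9.9 * rexp (0.10105 * (u - 9.9)) := by
      have := add_one_le_exp (0.10105 * (u - 9.9)); linarith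
    have b3 : u ^ 2 ≤ 98.01 * rexp (0.2021 * (u - 9.9)) := by
      calc u ^ 2 ≤ (9.9 * rexp (0.10105 * (u - 9.9))) ^ 2 := by gcongr
        _ = _ := by rw [mul_pow, ← exp_nat_mul]; push_cast; ring_nf
    calc u ^ 2 * rexp (-u / 2)
        ≤ 98.01 * rexp (0.2021 * (u - 9.9)) * (rexp (-4.95) * rexp (-(0.5 * (u - 9.9)))) := by
          rw [← exp_add (-4.95)]
          gcongr
          linarith
      _ = 98.01 * rexp (-4.95) * rexp (-(0.2979 * (u - 9.9))) := by
          rw [show -(0.2979 * (u - 9.9)) = 0.2021 * (u - 9.9) + -(0.5 * (u - 9.9)) by ring,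
            exp_add (0.2021 * (u - 9.9))]
          ring
      _ ≤ _ := by gcongr; linarith
  have h8 : u ^ 2 * (mangoldtLogRamp u - (log u - 1 / u + eulerMascheroniConstant))
      + u ^ 2 * (1.21 * rexp (-u / 2)) ≤ 1.35 := by
    rcases le_total u 18.9 with h | h
    · have b1 : rexp (-(0.2979 * (u - 9.9))) ≤ 1 := exp_le_one_iff.2 (by linarith)
      have b2 := h4.trans (add_le_add_left (min_le_left _ _) _)
      linarith
    · have b1 : rexp (-(0.2979 * (u - 9.9))) ≤ 0.28 := by
        rw [exp_neg, inv_le_comm₀ (exp_pos _) (by norm_num)]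
        have := add_one_le_exp (0.2979 * (u - 9.9))
        norm_num
        linarith
      have b2 := h4.trans (add_le_add_left (min_le_right _ _) _)
      linarith
  have h9 : mangoldtLogRamp u - (log u - 1 / u + eulerMascheroniConstant)
      + 1.21 * rexp (-u / 2) ≤ 1.35 / u ^ 2 := by
    rw [le_div_iff₀ (by positivity)]; linarith
  have h10 : (Chebyshev.psi (rexp u) - Chebyshev.theta (rexp u)) / (rexp u * u) =
    Chebyshev.psi (rexp u) / (rexp u * u) - Chebyshev.theta (rexp u) / (rexp u * u) := sub_div _ _ _
  linarith

end LargeRange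

section FiniteRange
open Finset

/-- Primality test for `11 ≤ n < 22801`. -/
def primeTest (n : ℕ) : Bool :=
  Nat.beq (Nat.gcd n (cond (Nat.ble n 120) 210 (cond (Nat.ble n 288) 30030
    1492182350939279320058875736615841068547583863326864530410))) 1

/-- `∏ n ∈ Ico a b, f n`, by binary splitting. -/
def prodSplit (f : ℕ → ℕ) : ℕ → ℕ → ℕ → ℕ
  | 0, a, _ => f a
  | d + 1, a, b => cond (Nat.ble b a) 1 (cond (Nat.ble b (a + 1)) (f a)
    (prodSplit f d a ((a + b) / 2) * prodSplit f d ((a + b) / 2) b))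

/-- The check that the product `A / B` is admissible when `log N ≥ log T`, where `T ^ e ≥ 2 ^ k`
and `log (log T) ≥ t / 4096 * log 2`. -/
def blockTest (T e k t A B : ℕ) : Bool :=
  Nat.ble (2 ^ k) (T ^ e) &&
    (Nat.ble (2 ^ t * (e * 10 ^ 8) ^ 4096) ((k * 69314718) ^ 4096) &&
      (Nat.ble (12 * (4096 * 10 ^ 8)) (10 * (t * 69314718)) &&
        Nat.ble (A * (t * 69314718) * (4096 * 10 ^ 8) * 10 ^ 5)
          (B * (178106 * (t * 69314718) ^ 2 + 251000 * (4096 * 10 ^ 8) ^ 2))))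

/-- Runs `blockTest` over consecutive blocks of primes. In the list, `(m', k, t)` is the end of the
block starting at the prime `m` and its parameters; `A` and `B` are the products of `p` and `p - 1`
over the primes `p < m`. -/
def rangeTest : List (ℕ × ℕ × ℕ) → ℕ → ℕ → ℕ → Bool
  | [], m, A, _ => Nat.ble (2 ^ 29000) (A * m)
  | (m', k, t) :: l, m, A, B =>
    Nat.ble (m + 1) m' && (Nat.ble m' (m + 4096) && (Nat.ble m' 22800 && (primeTest m' &&
      (blockTest (A * m) (100000 / m + 1) k t
        (A * prodSplit (fun n => cond (primeTest n) n 1) 12 m m')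
        (B * prodSplit (fun n => cond (primeTest n) (n - 1) 1) 12 m m') &&
      rangeTest l m' (A * prodSplit (fun n => cond (primeTest n) n 1) 12 m m')
        (B * prodSplit (fun n => cond (primeTest n) (n - 1) 1) 12 m m')))))

theorem rangeTest_eq_true : rangeTest
    [(13, 101579, 12096), (17, 114426, 13786), (19, 111550, 15221), (23, 122174, 16416),
     (29, 120583, 17468), (31, 112406, 18422), (37, 121120, 19258), (41, 115565, 20026),
     (43, 117393, 20723), (47, 124530, 21355), (53, 125750, 21938), (59, 122317, 22485),
     (61, 119842, 22998), (67, 125680, 23474), (73, 123471, 23924), (83, 130204, 24746),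
     (97, 129801, 25486), (103, 124539, 26163), (109, 130249, 26783), (131, 135541, 27350),
     (149, 128727, 28130), (163, 127631, 28838), (181, 130050, 29482), (199, 133610, 30260),
     (233, 136835, 30961), (263, 133769, 31753), (293, 133701, 32465), (347, 136684, 33234),
     (389, 132364, 34039), (443, 135765, 34860), (503, 136658, 35681), (587, 138028, 36492),
     (659, 135734, 37289), (757, 139003, 38125), (863, 139268, 38926), (997, 139421, 39740),
     (1129, 139336, 40555), (1301, 141580, 41397), (1499, 140666, 42214), (1723, 141331, 43064),
     (1999, 143320, 43898), (2293, 142728, 44735), (2657, 141643, 45562), (3011, 140736, 46391),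
     (3469, 144622, 47209), (3947, 141962, 48039), (4549, 146085, 48853), (5227, 141909, 49669),
     (5953, 147880, 50476), (6829, 144111, 51284), (7817, 145742, 52090), (8933, 144500, 52885),
     (10163, 152621, 53681), (11681, 145296, 54468), (13241, 149355, 55253),
     (15121, 151479, 56033), (17191, 151081, 56806), (19559, 147444, 57573),
     (20983, 167755, 58336)] 11 210 48 = true := by
  decide +kernel

theorem primorial_ten : primorial 10 = 210 := by decide +kernel

theorem primorial_sixteen : primorial 16 = 30030 := by decide +kernel

theorem primorial_hundred_fifty : primorial 150 =
    1492182350939279320058875736615841068547583863326864530410 := by decide +kernel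

end FiniteRange

section FiniteRangeCorrectness
open Finset

theorem prime_iff_coprime_primorial {n s : ℕ} (hs : s < n) (hn : 2 ≤ n) (hns : n < (s + 1) ^ 2) :
    n.Prime ↔ Nat.Coprime n (primorial s) := by
  refine ⟨fun h => ?_, fun h => ?_⟩
  · rw [h.coprime_iff_not_dvd, h.dvd_primorial_iff]; omega
  · by_contra hp
    have h1 := Nat.minFac_sq_le_self (by omega) hp
    have h2 : n.minFac < s + 1 := lt_of_pow_lt_pow_left₀ 2 (by omega) (h1.trans_lt hns)
    have h3 : n.minFac.Prime := Nat.minFac_prime (by omega)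
    exact h3.one_lt.ne' (Nat.Coprime.eq_one_of_dvd (h.coprime_dvd_left n.minFac_dvd)
      (h3.dvd_primorial_iff.2 (by omega)))

theorem primeTest_iff {n : ℕ} (h : 11 ≤ n) (h' : n < 22801) : primeTest n = true ↔ n.Prime := by
  unfold primeTest
  rw [Nat.beq_eq]
  rcases hb : Nat.ble n 120 with _ | _
  · rcases hb' : Nat.ble n 288 with _ | _
    · rw [cond_false, cond_false, ← primorial_hundred_fifty]
      rw [← Bool.not_eq_true, Nat.ble_eq] at hb hb'
      exact (prime_iff_coprime_primorial (by omega) (by omega) (by omega)).symm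
    · rw [cond_false, cond_true, ← primorial_sixteen]
      rw [← Bool.not_eq_true, Nat.ble_eq] at hb
      rw [Nat.ble_eq] at hb'
      exact (prime_iff_coprime_primorial (by omega) (by omega) (by omega)).symm
  · rw [cond_true, ← primorial_ten]
    rw [Nat.ble_eq] at hb
    exact (prime_iff_coprime_primorial (by omega) (by omega) (by omega)).symm

theorem prodSplit_eq (f : ℕ → ℕ) (d : ℕ) : ∀ a b : ℕ, a < b → b - a ≤ 2 ^ d →
    prodSplit f d a b = ∏ n ∈ Ico a b, f n := by
  induction d with
  | zero =>
    intro a b h1 h2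
    obtain rfl : b = a + 1 := by omega
    simp [prodSplit]
  | succ d ih =>
    intro a b h1 h2
    rw [prodSplit]
    rcases hb : Nat.ble b a with _ | _
    · rw [cond_false]
      rcases hb' : Nat.ble b (a + 1) with _ | _
      · rw [← Bool.not_eq_true, Nat.ble_eq] at hb'
        rw [cond_false, ih _ _ (by omega) (by omega), ih _ _ (by omega) (by omega),
          prod_Ico_consecutive _ (by omega) (by omega)]
      · rw [Nat.ble_eq] at hb'
        obtain rfl : b = a + 1 := by omega
        simp
    · rw [Nat.ble_eq] at hb; omega

theorem prod_primesBelow_mul_prodSplit {m m' d : ℕ} (g : ℕ → ℕ) (h : 11 ≤ m) (hmm : m < m')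
    (h' : m' ≤ 22800) (hd : m' - m ≤ 2 ^ d) :
    (∏ p ∈ m.primesBelow, g p) * prodSplit (fun n => cond (primeTest n) (g n) 1) d m m' =
      ∏ p ∈ m'.primesBelow, g p := by
  rw [prodSplit_eq _ _ _ _ hmm hd]
  have h1 : ∏ n ∈ Ico m m', cond (primeTest n) (g n) 1 =
      ∏ n ∈ Ico m m', if n.Prime then g n else 1 := by
    refine prod_congr rfl fun n hn => ?_
    have hn := mem_Ico.1 hn
    have := primeTest_iff (n := n) (by omega) (by omega)
    rcases hb : primeTest n with _ | _
    · rw [if_neg (by rw [← this, hb]; decide)]; rfl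
    · rw [if_pos (this.1 hb)]; rfl
  rw [h1, Nat.primesBelow, Nat.primesBelow, prod_filter, prod_filter, range_eq_Ico,
    prod_Ico_consecutive _ (by omega) hmm.le, range_eq_Ico]

theorem div_totient_le_of_lt_theta {N m : ℕ} (hN : N ≠ 0) (hm : m.Prime)
    (h : log N < Chebyshev.theta m) :
    (N / N.totient : ℝ) ≤
      ((∏ p ∈ m.primesBelow, p : ℕ) : ℝ) / ((∏ p ∈ m.primesBelow, (p - 1) : ℕ) : ℝ) := by
  have hm1 : (1 : ℝ) < m := by exact_mod_cast hm.one_lt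
  have hle : Nat.primesLE m = insert m m.primesBelow := by
    rw [Nat.primesLE, Nat.primesBelow_succ, if_pos hm]
  have hcard : #N.primeFactors ≤ #m.primesBelow := by
    by_contra! hlt
    have hc : #(Nat.primesLE m) ≤ #N.primeFactors := by
      rw [hle]; exact (card_insert_le _ _).trans hlt
    have hc' : (#(Nat.primesLE m) : ℝ) ≤ #N.primeFactors := by exact_mod_cast hc
    have h1 := sum_le_sum_add_mul (Nat.primesLE m) N.primeFactors (fun p => log p) (fun _ => 1)
      (log m) (fun p hp => ?_) (fun p hp => ?_)
    · rw [← Chebyshev.theta_eq_sum_primesLE_log, sum_const, sum_const, nsmul_eq_mul,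
        nsmul_eq_mul] at h1
      have h2 := sum_log_primeFactors_le hN
      nlinarith [log_pos hm1]
    · rw [mem_sdiff, Nat.mem_primesLE] at hp
      have hp' : m ≤ p := by
        by_contra! hlt'
        exact hp.2 ⟨hlt'.le, Nat.prime_of_mem_primeFactors hp.1⟩
      rw [mul_one]
      exact log_le_log (by linarith) (by exact_mod_cast hp')
    · rw [mem_sdiff, Nat.mem_primesLE] at hp
      rw [mul_one]
      exact log_le_log (by exact_mod_cast hp.1.2.pos) (by exact_mod_cast hp.1.1)
  have hcard' : (#N.primeFactors : ℝ) ≤ #m.primesBelow := by exact_mod_cast hcard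
  have h3 := sum_le_sum_add_mul N.primeFactors m.primesBelow (fun p => logEulerFactor p)
    (fun _ => 1) (logEulerFactor m) (fun p hp => ?_) (fun p hp => ?_)
  · rw [← log_div_totient hN, sum_const, sum_const, nsmul_eq_mul, nsmul_eq_mul] at h3
    have h4 : 0 < logEulerFactor m :=
      (inv_pos.2 (zero_lt_one.trans hm1)).trans_le (inv_le_logEulerFactor hm1)
    have hprod : ((∏ p ∈ m.primesBelow, p : ℕ) : ℝ) / ((∏ p ∈ m.primesBelow, (p - 1) : ℕ) : ℝ) =
        ∏ p ∈ m.primesBelow, (1 - (p : ℝ)⁻¹)⁻¹ := by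
      rw [Nat.cast_prod, Nat.cast_prod, ← prod_div_distrib]
      refine prod_congr rfl fun p hp => ?_
      have hp := Nat.prime_of_mem_primesBelow hp
      have h5 : (p : ℝ) ≠ 0 := by exact_mod_cast hp.ne_zero
      rw [Nat.cast_sub hp.one_le, Nat.cast_one]
      rw [show 1 - (p : ℝ)⁻¹ = (p - 1) / p by field_simp, inv_div]
    have hpos : ∀ p ∈ m.primesBelow, 0 < (1 - (p : ℝ)⁻¹)⁻¹ := fun p hp =>
      inv_pos.2 (one_sub_inv_pos (by exact_mod_cast (Nat.prime_of_mem_primesBelow hp).one_lt))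
    rw [hprod, ← log_le_log_iff ?_ (prod_pos hpos), log_prod fun p hp => (hpos p hp).ne']
    · simp only [log_inv]
      change _ ≤ ∑ p ∈ m.primesBelow, logEulerFactor p
      nlinarith
    · have : 0 < N.totient := Nat.totient_pos.2 hN.bot_lt
      have : 0 < N := hN.bot_lt
      positivity
  · rw [mem_sdiff, Nat.mem_primesBelow] at hp
    rw [mul_one]
    exact logEulerFactor_anti (by exact_mod_cast hp.1.2.one_lt) (by exact_mod_cast hp.1.1.le)
  · rw [mem_sdiff, Nat.mem_primesBelow] at hp
    have hp' : m ≤ p := by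
      by_contra! hlt'
      exact hp.2 ⟨hlt', Nat.prime_of_mem_primeFactors hp.1⟩
    rw [mul_one]
    exact logEulerFactor_anti hm1 (by exact_mod_cast hp')

end FiniteRangeCorrectness

theorem exp_eulerMascheroni_gt : 1.78106 < rexp eulerMascheroniConstant := by
  have h := sum_le_exp_of_nonneg (x := 0.57721) (by norm_num) 10
  refine lt_of_lt_of_le ?_ (h.trans (exp_le_exp.2 eulerMascheroni_gt.le))
  norm_num [Finset.sum_range_succ, Nat.factorial]

theorem exp_eulerMascheroni_lt : rexp eulerMascheroniConstant < 1.79 := by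
  have h1 : rexp eulerMascheroniConstant ^ 19 < 1.79 ^ 19 := by
    rw [← exp_nat_mul]
    have h2 : rexp 1 ^ 11 < 2.7182818286 ^ 11 :=
      pow_lt_pow_left₀ exp_one_lt_d9 (exp_pos _).le (by norm_num)
    rw [← exp_nat_mul] at h2
    have h3 := exp_le_exp.2 (show ((19 : ℕ) : ℝ) * eulerMascheroniConstant ≤ (11 : ℕ) * 1 by
      have := eulerMascheroni_lt
      norm_num
      linarith)
    refine (h3.trans_lt h2).trans_le ?_
    norm_num
  exact lt_of_pow_lt_pow_left₀ 19 (by norm_num) h1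

theorem two_pow_le_log {t c d n : ℕ} (hc : 0 < c) (hn : 0 < n) (h : 2 ^ t * c ^ n ≤ d ^ n) :
    (t : ℝ) / n * log 2 ≤ log (d / c) := by
  refine le_log_of_two_pow_le hn ?_
  rw [div_pow, le_div_iff₀ (by positivity)]
  exact_mod_cast h

theorem div_le_of_blockTest {T e k t A B : ℕ} (h : blockTest T e k t A B = true) (he : 0 < e)
    (hB : 0 < B) {u : ℝ} (hu : log T ≤ rexp u) :
    (A / B : ℝ) ≤ rexp eulerMascheroniConstant * u + 2.51 / u := by
  simp only [blockTest, Bool.and_eq_true, Nat.ble_eq] at h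
  obtain ⟨h1, h2, h3, h4⟩ := h
  have hl2 := log_two_gt_d9
  have h5 : (k : ℝ) / e * log 2 ≤ log T := by
    refine le_log_of_two_pow_le he ?_
    exact_mod_cast h1
  have h6 := two_pow_le_log (c := e * 10 ^ 8) (d := k * 69314718) (n := 4096) (by positivity)
    (by norm_num) h2
  have h3' : (12 * (4096 * 10 ^ 8) : ℝ) ≤ 10 * (t * 69314718) := by exact_mod_cast h3
  have hk : 0 < k := by
    by_contra! hk
    rw [Nat.le_zero.1 hk, zero_mul, Nat.cast_zero, zero_div, log_zero] at h6
    have ht : (0 : ℝ) < t := by linarith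
    exact h6.not_gt (by positivity)
  have h4' : (A * (t * 69314718) * (4096 * 10 ^ 8) * 10 ^ 5 : ℝ) ≤
      B * (178106 * (t * 69314718) ^ 2 + 251000 * (4096 * 10 ^ 8) ^ 2) := by exact_mod_cast h4
  have he' : (0 : ℝ) < e := by exact_mod_cast he
  have hB' : (0 : ℝ) < B := by exact_mod_cast hB
  have hk' : (0 : ℝ) < k := by exact_mod_cast hk
  have h7 : ((k * 69314718 : ℕ) : ℝ) / ((e * 10 ^ 8 : ℕ) : ℝ) ≤ rexp u := by
    refine le_trans ?_ (h5.trans hu)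
    push_cast
    rw [mul_div_mul_comm]
    gcongr
    linarith
  have h8 := log_le_log (by push_cast; positivity) h7
  rw [log_exp] at h8
  set y : ℝ := t * 69314718 / (4096 * 10 ^ 8) with hy
  have hyu : y ≤ u := by
    refine le_trans ?_ (h6.trans h8)
    rw [hy]
    push_cast
    have : (0 : ℝ) ≤ t := t.cast_nonneg
    nlinarith
  have hy1 : 1.2 ≤ y := by
    rw [hy, le_div_iff₀ (by norm_num)]
    linarith
  have hy' : (t * 69314718 : ℝ) = y * (4096 * 10 ^ 8) := by
    rw [hy]; field_simp
  rw [hy'] at h4'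
  have h9 : (A : ℝ) * y ≤ B * (1.78106 * y ^ 2 + 2.51) := by nlinarith
  have h10 : (A / B : ℝ) ≤ 1.78106 * y + 2.51 / y := by
    rw [div_le_iff₀ hB']
    have : (1.78106 * y + 2.51 / y) * B = B * (1.78106 * y ^ 2 + 2.51) / y := by
      field_simp
    rw [this, le_div_iff₀ (by linarith)]
    exact h9
  have hu1 : 0 < u := by linarith
  have h11 : 1.78106 * y + 2.51 / y ≤ 1.78106 * u + 2.51 / u := by
    have : 1.78106 * u + 2.51 / u - (1.78106 * y + 2.51 / y) =
        (u - y) * (1.78106 * (u * y) - 2.51) / (u * y) := by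
      field_simp
      ring
    have h12 : 0 ≤ (u - y) * (1.78106 * (u * y) - 2.51) / (u * y) := by
      have : 1.2 * 1.2 ≤ u * y := by nlinarith
      have := mul_nonneg (sub_nonneg.2 hyu) (show 0 ≤ 1.78106 * (u * y) - 2.51 by linarith)
      positivity
    linarith
  have := mul_le_mul_of_nonneg_right exp_eulerMascheroni_gt.le hu1.le
  linarith

section RangeTest
open Finset

theorem theta_prime {m : ℕ} (hm : m.Prime) :
    Chebyshev.theta m = log ((∏ p ∈ m.primesBelow, p) * m : ℕ) := by
  have hle : Nat.primesLE m = insert m m.primesBelow := by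
    rw [Nat.primesLE, Nat.primesBelow_succ, if_pos hm]
  have hmem : m ∉ m.primesBelow := by simp [Nat.mem_primesBelow]
  have hpos : ∀ p ∈ m.primesBelow, (p : ℝ) ≠ 0 := fun p hp => by
    exact_mod_cast (Nat.prime_of_mem_primesBelow hp).ne_zero
  rw [Chebyshev.theta_eq_sum_primesLE_log, hle, sum_insert hmem, Nat.cast_mul, Nat.cast_prod,
    log_mul (prod_ne_zero_iff.2 hpos) (by exact_mod_cast hm.ne_zero), log_prod hpos, add_comm]

theorem div_totient_le_or_of_rangeTest {N : ℕ} {u : ℝ} (hN : N ≠ 0) (hu : log N = rexp u)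
    (l : List (ℕ × ℕ × ℕ)) : ∀ m : ℕ, 11 ≤ m → m.Prime → Chebyshev.theta m ≤ log N →
    rangeTest l m (∏ p ∈ m.primesBelow, p) (∏ p ∈ m.primesBelow, (p - 1)) = true →
    (N / N.totient : ℝ) ≤ rexp eulerMascheroniConstant * u + 2.51 / u ∨ 20000 ≤ log N := by
  induction l with
  | nil =>
    intro m _ hmp hm h
    right
    refine le_trans ?_ hm
    rw [theta_prime hmp]
    rw [rangeTest, Nat.ble_eq] at h
    have h1 := le_log_of_two_pow_le (x := ((∏ p ∈ m.primesBelow, p) * m : ℕ)) (a := 29000) (b := 1)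
      one_pos (by rw [pow_one]; exact_mod_cast h)
    have h2 := log_two_gt_d9
    rw [Nat.cast_one, div_one] at h1
    refine le_trans ?_ h1
    push_cast
    linarith
  | cons a l ih =>
    obtain ⟨m', k, t⟩ := a
    intro m h11 hmp hm h
    simp only [rangeTest, Bool.and_eq_true, Nat.ble_eq] at h
    obtain ⟨h1, h2, h3, h4, h5, h6⟩ := h
    rw [prod_primesBelow_mul_prodSplit (fun p => p) h11 h1 h3 (by omega),
      prod_primesBelow_mul_prodSplit (fun p => p - 1) h11 h1 h3 (by omega)] at h5 h6
    have hmp' := (primeTest_iff (by omega) (by omega)).1 h4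
    rcases le_or_gt (Chebyshev.theta m') (log N) with hle | hlt
    · exact ih m' (by omega) hmp' hle h6
    · left
      refine (div_totient_le_of_lt_theta hN hmp' hlt).trans
        (div_le_of_blockTest h5 (Nat.succ_pos _) ?_ ?_)
      · exact prod_pos fun p hp =>
          Nat.sub_pos_of_lt (Nat.prime_of_mem_primesBelow hp).one_lt
      · rwa [← theta_prime hmp, ← hu]

end RangeTest

theorem div_totient_le_of_small {N : ℕ} {u : ℝ} (hN : N ≠ 0) (hu : 2.05 ≤ u)
    (hNu : log N = rexp u) :
    (N / N.totient : ℝ) ≤ rexp eulerMascheroniConstant * u + 2.51 / u ∨ 20000 ≤ log N := by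
  have hA : ∏ p ∈ Nat.primesBelow 11, p = 210 := by decide +kernel
  have hB : ∏ p ∈ Nat.primesBelow 11, (p - 1) = 48 := by decide +kernel
  have h := rangeTest_eq_true
  rw [← hA, ← hB] at h
  refine div_totient_le_or_of_rangeTest hN hNu _ 11 le_rfl (by norm_num) ?_ h
  rw [theta_prime (by norm_num), hA, hNu]
  have h1 := log_le_of_le_two_pow (x := 2310) (a := 56) (b := 5) (by norm_num) (by norm_num)
    (by norm_num)
  have h2 := log_two_lt_d9
  have h3 := sum_le_exp_of_nonneg (x := 2.05) (by norm_num) 12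
  refine le_trans ?_ (h3.trans (exp_le_exp.2 hu))
  norm_num [Finset.sum_range_succ, Nat.factorial] at h1 ⊢
  linarith

theorem div_totient_le {N : ℕ} {u : ℝ} (hN : N ≠ 0) (hu : 2.05 ≤ u) (hNu : log N = rexp u) :
    (N / N.totient : ℝ) ≤ rexp eulerMascheroniConstant * u + 2.51 / u := by
  rcases div_totient_le_of_small hN hu hNu with h | h
  · exact h
  have hu9 : 9.9 ≤ u := by
    rw [hNu] at h
    rw [← exp_le_exp]
    refine le_trans ?_ h
    refine le_of_pow_le_pow_left₀ (n := 10) (by norm_num) (by norm_num) ?_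
    rw [← exp_nat_mul]
    have h2 : rexp 1 ^ 99 < 2.7182818286 ^ 99 :=
      pow_lt_pow_left₀ exp_one_lt_d9 (exp_pos _).le (by norm_num)
    rw [← exp_nat_mul] at h2
    norm_num at h2 ⊢
    linarith
  have h1 := log_div_totient_le_of_large hu9 hN hNu.le
  have hpos : (0 : ℝ) < N / N.totient := by
    have : 0 < N.totient := Nat.totient_pos.2 hN.bot_lt
    have : 0 < N := hN.bot_lt
    positivity
  have hu0 : 0 < u := by linarith
  set τ := 1.35 / u ^ 2 with hτ
  have hτ0 : 0 ≤ τ := by positivity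
  have hτ1 : τ ≤ 0.014 := by
    rw [hτ, div_le_iff₀ (by positivity)]
    nlinarith
  have h2 : (N / N.totient : ℝ) ≤ u * rexp eulerMascheroniConstant * rexp τ := by
    rw [← exp_log hpos]
    refine (exp_le_exp.2 h1).trans ?_
    rw [exp_add, exp_add, exp_log hu0]
  have h3 : rexp τ ≤ 1 + τ + τ ^ 2 := by
    have := (abs_le.1 (abs_exp_sub_one_sub_id_le (x := τ) (by rw [abs_of_nonneg hτ0]; linarith))).2
    linarith
  have h4 : rexp τ ≤ 1 + 1.37 / u ^ 2 := by
    have : 1.37 / u ^ 2 = 1.37 / 1.35 * τ := by rw [hτ]; field_simp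
    rw [this]
    nlinarith
  have h5 := exp_eulerMascheroni_lt
  have h6 := exp_pos eulerMascheroniConstant
  refine h2.trans ((mul_le_mul_of_nonneg_left h4 (by positivity)).trans ?_)
  have h7 : u * rexp eulerMascheroniConstant * (1 + 1.37 / u ^ 2) =
      rexp eulerMascheroniConstant * u + rexp eulerMascheroniConstant * 1.37 / u := by
    field_simp
  rw [h7]
  gcongr
  linarith

open Finset in
theorem sigma_one_mul_totient_le (n : ℕ) :
    ArithmeticFunction.sigma 1 n * n.totient ≤ n ^ 2 := by
  induction n using Nat.recOnPosPrimePosCoprime with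
  | zero => simp
  | one => simp
  | prime_pow p i hp hi =>
    obtain ⟨i, rfl⟩ := Nat.exists_eq_succ_of_ne_zero hi.ne'
    obtain ⟨q, rfl⟩ := Nat.exists_eq_succ_of_ne_zero hp.ne_zero
    rw [ArithmeticFunction.sigma_one_apply_prime_pow hp, Nat.totient_prime_pow hp hi]
    have h := geom_sum_mul_add q (i + 1 + 1)
    simp only [Nat.succ_eq_add_one, Nat.add_sub_cancel] at *
    calc (∑ k ∈ range (i + 1 + 1), (q + 1) ^ k) * ((q + 1) ^ i * q)
        = (∑ k ∈ range (i + 1 + 1), (q + 1) ^ k) * q * (q + 1) ^ i := by ring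
      _ ≤ (q + 1) ^ (i + 1 + 1) * (q + 1) ^ i := Nat.mul_le_mul_right _ (by omega)
      _ = ((q + 1) ^ (i + 1)) ^ 2 := by ring
  | coprime a b ha hb hab iha ihb =>
    rw [ArithmeticFunction.isMultiplicative_sigma.map_mul_of_coprime hab, Nat.totient_mul hab]
    calc _ = (ArithmeticFunction.sigma 1 a * a.totient) *
          (ArithmeticFunction.sigma 1 b * b.totient) := by ring
      _ ≤ a ^ 2 * b ^ 2 := Nat.mul_le_mul iha ihb
      _ = (a * b) ^ 2 := by ring

theorem sigma_one_two_pow_mul_odd_le {k n : ℕ} (hk : 1 ≤ k) (hn : Odd n) :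
    2 ^ (k + 1) * (ArithmeticFunction.sigma 1 (2 ^ k * n) * (2 ^ k * n).totient) ≤
      (2 ^ (k + 1) - 1) * (2 ^ k * n) ^ 2 := by
  have hc : (2 ^ k).Coprime n := Nat.Coprime.pow_left k (Nat.coprime_two_left.2 hn)
  obtain ⟨k, rfl⟩ := Nat.exists_eq_add_of_le' hk
  have h2 := geom_sum_mul_add 1 (k + 1 + 1)
  rw [ArithmeticFunction.isMultiplicative_sigma.map_mul_of_coprime hc, Nat.totient_mul hc,
    ArithmeticFunction.sigma_one_apply_prime_pow Nat.prime_two,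
    Nat.totient_prime_pow Nat.prime_two hk]
  rw [mul_one, one_add_one_eq_two] at h2
  rw [← h2]
  simp only [Nat.add_sub_cancel]
  rw [h2]
  calc _ = (∑ j ∈ Finset.range (k + 1 + 1), 2 ^ j) * (2 ^ (k + 1)) ^ 2 *
        (ArithmeticFunction.sigma 1 n * n.totient) := by ring
    _ ≤ (∑ j ∈ Finset.range (k + 1 + 1), 2 ^ j) * (2 ^ (k + 1)) ^ 2 * n ^ 2 :=
      Nat.mul_le_mul_left _ (sigma_one_mul_totient_le n)
    _ = _ := by ring

/-- For `k ≥ 1` and odd `n` with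
`n > exp(exp(√(2.51·(2^(k+1) − 1)/e^γ)))/2^k`, Robin's inequality holds for
`2^k·n`. -/
theorem robin_of_pow_two_mul_odd (k n : ℕ) (hk : 1 ≤ k) (hn : Odd n)
    (h : (n : ℝ) >
      Real.exp (Real.exp (Real.sqrt
        (2.51 * (2 ^ (k + 1) - 1) / Real.exp Real.eulerMascheroniConstant))) / 2 ^ k) :
    RobinInequality (2 ^ k * n) := by
  unfold RobinInequality
  have hN : 2 ^ k * n ≠ 0 := mul_ne_zero (by positivity) hn.pos.ne'
  have hσ := sigma_one_two_pow_mul_odd_le hk hn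
  set N := 2 ^ k * n with hNdef
  have hG := exp_pos eulerMascheroniConstant
  have hG2 := exp_eulerMascheroni_lt
  set G := rexp eulerMascheroniConstant with hGdef
  set D : ℝ := 2 ^ (k + 1) with hD
  set s := √(2.51 * (D - 1) / G) with hs
  have hD4 : 4 ≤ D := by
    have : (2 : ℝ) ^ 2 ≤ 2 ^ (k + 1) := pow_le_pow_right₀ one_le_two (by omega)
    linarith
  have hNlt : rexp (rexp s) < N := by
    have h2 : (0 : ℝ) < 2 ^ k := by positivity
    rw [gt_iff_lt, div_lt_iff₀ h2] at h
    rw [hNdef]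
    push_cast
    linarith
  have hlog : rexp s < log N := (lt_log_iff_exp_lt ((exp_pos _).trans hNlt)).2 hNlt
  have hlog0 : 0 < log N := (exp_pos _).trans hlog
  have hsu : s < log (log N) := (lt_log_iff_exp_lt hlog0).2 hlog
  set u := log (log N) with hu
  have hs2 : 2.05 ≤ s := by
    rw [hs]
    refine le_sqrt_of_sq_le ?_
    rw [le_div_iff₀ hG]
    nlinarith
  have hsq : s ^ 2 = 2.51 * (D - 1) / G := sq_sqrt (div_nonneg (by linarith) hG.le)
  have hu0 : 0 < u := by linarith
  have hkey : 2.51 * (D - 1) < G * u ^ 2 := by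
    have : s ^ 2 < u ^ 2 := by nlinarith
    rw [hsq, div_lt_iff₀ hG] at this
    linarith
  have hT := div_totient_le hN (hs2.trans hsu.le) (exp_log hlog0).symm
  have hφ : (0 : ℝ) < N.totient := by exact_mod_cast Nat.totient_pos.2 hN.bot_lt
  have hNpos : (0 : ℝ) < N := by exact_mod_cast hN.bot_lt
  have hσ' : D * ((ArithmeticFunction.sigma 1 N : ℝ) * N.totient) ≤ (D - 1) * (N : ℝ) ^ 2 := by
    have := (Nat.cast_le (α := ℝ)).2 hσ
    rw [Nat.cast_mul, Nat.cast_mul _ (N ^ 2), Nat.cast_sub Nat.one_le_two_pow] at this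
    push_cast at this
    exact this
  rw [div_le_iff₀ hφ] at hT
  have h1 : (D - 1) * (G * u + 2.51 / u) < D * (G * u) := by
    have : 2.51 * (D - 1) / u < G * u := by
      rw [div_lt_iff₀ hu0]
      linarith
    have h3 : (D - 1) * (2.51 / u) = 2.51 * (D - 1) / u := by ring
    linarith
  have h2 : D * N.totient * (ArithmeticFunction.sigma 1 N : ℝ) < D * N.totient * (G * N * u) := by
    calc D * N.totient * (ArithmeticFunction.sigma 1 N : ℝ) ≤ (D - 1) * (N : ℝ) ^ 2 := by linarith
      _ = (D - 1) * N * N := by ring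
      _ ≤ (D - 1) * N * ((G * u + 2.51 / u) * N.totient) :=
        mul_le_mul_of_nonneg_left hT (mul_nonneg (by linarith) hNpos.le)
      _ = (D - 1) * (G * u + 2.51 / u) * (N * N.totient) := by ring
      _ < D * (G * u) * (N * N.totient) := mul_lt_mul_of_pos_right h1 (mul_pos hNpos hφ)
      _ = _ := by ring
  exact lt_of_mul_lt_mul_left h2 (by positivity)
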